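/- Let f : ℂ → ℂ be an entire function, neither constant nor affine, having only finitely many critical points and only finitely many finite asymptotic values. Let z₀ ∈ ℂ be a periodic point of exact period n ≥ 1 whose multiplier satisfies (f^n)'(z₀) = e^{2πiα} for some irrational real α, and suppose f^n is NOT linearizable at z₀ (i.e., the cycle {z₀, f(z₀), …, f^{n−1}(z₀)} is a Cremer cycle). Then there exists a point s ∈ ℂ, which is either a finite asymptotic value of f or a recurrent critical point of f, such that the entire cycle {z₀, f(z₀), …, f^{n−1}(z₀)} is contained in the derived set d(s) of the forward orbit of s. -/

import Mathlib

open Metric Set Function Filter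

/-- `a` is a finite asymptotic value of `f`: there is a continuous curve `γ` tending to `∞`
along which `f` tends to `a`. -/
def AsymptoticValue (f : ℂ → ℂ) (a : ℂ) : Prop :=
  ∃ γ : ℝ → ℂ, Continuous γ ∧ Tendsto (fun t => ‖γ t‖) atTop atTop ∧
    Tendsto (fun t => f (γ t)) atTop (nhds a)

/-- The derived set of the forward orbit of `s` under `f`: all accumulation points of
`{f^k(s) : k ≥ 0}`. -/
def orbitDerivedSet (f : ℂ → ℂ) (s : ℂ) : Set ℂ :=
  {z : ℂ | ∀ U ∈ nhds z, ∃ k : ℕ, f^[k] s ∈ U ∧ f^[k] s ≠ z}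

/-- `c` is a recurrent critical point of `f`: `f'(c) = 0` and `c` lies in its ω-limit set. -/
def RecurrentCriticalPoint (f : ℂ → ℂ) (c : ℂ) : Prop :=
  deriv f c = 0 ∧
    ∃ φ : ℕ → ℕ, StrictMono φ ∧ Tendsto (fun i => f^[φ i] c) atTop (nhds c)

/-- `f` is linearizable at the fixed point `z₀` with multiplier `lam`. -/
def LinearizableAt (f : ℂ → ℂ) (z₀ lam : ℂ) : Prop :=
  ∃ r > (0 : ℝ), ∃ h : ℂ → ℂ,
    DifferentiableOn ℂ h (ball (0 : ℂ) r) ∧ InjOn h (ball (0 : ℂ) r) ∧ h 0 = z₀ ∧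
    ∀ z ∈ ball (0 : ℂ) r, f (h z) = h (lam * z)

set_option linter.unusedVariables false

theorem bloch_aux {φ : ℂ → ℂ} {p : ℂ} {r m : ℝ} (hr : 0 < r) (hm : 0 < m)
    (hd : DifferentiableOn ℂ φ (ball p r)) (hp : ‖deriv φ p‖ = m)
    (hb : ∀ z ∈ ball p r, ‖deriv φ z‖ ≤ 2 * m) :
    ball (φ p) (m * r / 24) ⊆ φ '' ball p r := by
  have hdd : DifferentiableOn ℂ (deriv φ) (ball p r) := hd.deriv isOpen_ball
  have h1 : ∀ z ∈ ball p r, ‖deriv φ z - deriv φ p‖ ≤ 3 * m / r * ‖z - p‖ := by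
    intro z hz
    have := Complex.dist_le_div_mul_dist_of_mapsTo_ball (R₂ := 3 * m) hdd (by
      intro w hw
      rw [mem_closedBall, dist_eq_norm]
      calc _ ≤ ‖deriv φ w‖ + ‖deriv φ p‖ := norm_sub_le _ _
        _ ≤ _ := by linarith [hb w hw]) hz
    simpa [dist_eq_norm] using this
  have h2 : ∀ z ∈ sphere p (r/6), m * r / 12 ≤ ‖φ z - φ p‖ := by
    intro z hz
    have hzz : ‖z - p‖ = r / 6 := by simpa [dist_eq_norm] using hz
    have hsub : closedBall p (r/6) ⊆ ball p r := closedBall_subset_ball (by linarith)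
    have := (convex_closedBall p (r/6)).norm_image_sub_le_of_norm_hasDerivWithin_le
      (f := fun z => φ z - deriv φ p * z) (f' := fun z => deriv φ z - deriv φ p) (C := m / 2)
      (x := p) (y := z) (fun w hw => by
        have := ((hd.differentiableAt (isOpen_ball.mem_nhds (hsub hw))).hasDerivAt.fun_sub
          ((hasDerivAt_id w).const_mul (deriv φ p))).hasDerivWithinAt (s := closedBall p (r/6))
        simpa using this) (fun w hw => by
        refine (h1 w (hsub hw)).trans ?_
        have : ‖w - p‖ ≤ r / 6 := by simpa [dist_eq_norm] using hw
        calc 3 * m / r * ‖w - p‖ ≤ 3 * m / r * (r / 6) := by gcongr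
          _ = _ := by field_simp; norm_num) (mem_closedBall_self (by linarith)) (sphere_subset_closedBall hz)
    rw [hzz] at this
    have e : φ z - φ p = (φ z - deriv φ p * z - (φ p - deriv φ p * p)) + deriv φ p * (z - p) := by ring
    rw [e]
    have h3 : ‖deriv φ p * (z - p)‖ = m * (r / 6) := by rw [norm_mul, hp, hzz]
    have := norm_sub_le_norm_add (φ z - deriv φ p * z - (φ p - deriv φ p * p)) (deriv φ p * (z - p))
    have h4 := norm_sub_norm_le (deriv φ p * (z - p)) (-(φ z - deriv φ p * z - (φ p - deriv φ p * p)))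
    rw [norm_neg, sub_neg_eq_add, add_comm (deriv φ p * (z - p))] at h4
    linarith
  have h3 := DiffContOnCl.ball_subset_image_closedBall (f := φ) (z₀ := p) (r := r/6) (ε := m * r / 12)
    ((hd.mono (closedBall_subset_ball (show r/6 < r by linarith))).diffContOnCl_ball subset_rfl) (by linarith) h2 (by
      have hsub : deriv φ p ≠ 0 := by rw [← norm_pos_iff, hp]; exact hm
      have := ((hd.differentiableAt (isOpen_ball.mem_nhds (mem_ball_self hr))).hasDerivAt).eventually_ne hsub (c := φ p)
      exact (this.frequently).filter_mono nhdsWithin_le_nhds)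
  have e : m * r / 24 = m * r / 12 / 2 := by ring
  rw [e]
  exact h3.trans (image_mono (closedBall_subset_ball (by linarith)))

/-- Bloch's theorem (crude). -/
theorem bloch {φ : ℂ → ℂ} {p : ℂ} {R L : ℝ} (hR : 0 < R) (hL : 0 < L)
    (hd : DifferentiableOn ℂ φ (ball p R))
    (hb : ∀ w, ¬ ball w L ⊆ φ '' ball p R) : ‖deriv φ p‖ * R ≤ 48 * L := by
  by_contra hcon
  push Not at hcon
  have hpos : 0 < ‖deriv φ p‖ := by
    by_contra h
    have : ‖deriv φ p‖ = 0 := le_antisymm (not_lt.1 h) (norm_nonneg _)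
    rw [this] at hcon; linarith
  obtain ⟨t, ht1, ht2⟩ : ∃ t, 48 * L / ‖deriv φ p‖ < t ∧ t < R :=
    exists_between (by rw [div_lt_iff₀ hpos]; linarith)
  have ht0 : 0 < t := lt_trans (by positivity) ht1
  rw [div_lt_iff₀ hpos] at ht1
  have hsub : closedBall p t ⊆ ball p R := closedBall_subset_ball ht2
  have hcont : ContinuousOn (fun z => (t - ‖z - p‖) * ‖deriv φ z‖) (closedBall p t) := by
    have : ContinuousOn (deriv φ) (closedBall p t) := (hd.deriv isOpen_ball).continuousOn.mono hsub
    fun_prop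
  obtain ⟨q, hq, hmax⟩ := (isCompact_closedBall p t).exists_isMaxOn ⟨p, mem_closedBall_self ht0.le⟩ hcont
  have hp' := hmax (mem_closedBall_self ht0.le)
  simp only [mem_ofPred_eq, sub_self, norm_zero, sub_zero] at hp'
  set m := ‖deriv φ q‖ with hm
  set d := t - ‖q - p‖ with hdd
  have hqt : ‖q - p‖ ≤ t := by simpa [dist_eq_norm] using hq
  have hdm : 0 < d * m := lt_of_lt_of_le (by positivity) hp'
  have hd0 : 0 < d := by
    rcases lt_or_eq_of_le (sub_nonneg.2 hqt) with h | h
    · exact h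
    · rw [hdd, ← h] at hdm; simp at hdm
  have hm0 : 0 < m := pos_of_mul_pos_right hdm hd0.le
  have hsub2 : ball q (d/2) ⊆ ball p R := by
    intro z hz
    rw [mem_ball, dist_eq_norm] at hz ⊢
    have : ‖z - p‖ ≤ ‖z - q‖ + ‖q - p‖ := norm_sub_le_norm_sub_add_norm_sub _ _ _
    linarith
  have := bloch_aux (φ := φ) (p := q) (r := d/2) (m := m) (by linarith) hm0 (hd.mono hsub2) rfl (by
    intro z hz
    rw [mem_ball, dist_eq_norm] at hz
    have h1 : ‖z - p‖ ≤ ‖z - q‖ + ‖q - p‖ := norm_sub_le_norm_sub_add_norm_sub _ _ _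
    have h2 := hmax (show z ∈ closedBall p t by rw [mem_closedBall, dist_eq_norm]; linarith)
    simp only [mem_ofPred_eq] at h2
    have h3 : d / 2 * ‖deriv φ z‖ ≤ d * m := le_trans (by gcongr; linarith) h2
    nlinarith)
  refine hb (φ q) ((ball_subset_ball ?_).trans (this.trans (image_mono hsub2)))
  have : t * ‖deriv φ p‖ ≤ d * m := hp'
  linarith

/-- Holomorphic logarithm on a ball. -/
theorem exists_log_ball {Φ : ℂ → ℂ} {p : ℂ} {R : ℝ} (hR : 0 < R)
    (hd : DifferentiableOn ℂ Φ (ball p R)) (h0 : ∀ z ∈ ball p R, Φ z ≠ 0) :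
    ∃ φ : ℂ → ℂ, DifferentiableOn ℂ φ (ball p R) ∧ (∀ z ∈ ball p R, deriv φ z = deriv Φ z / Φ z) ∧
      ∀ z ∈ ball p R, Complex.exp (φ z) = Φ z := by
  have h1 : DifferentiableOn ℂ (fun z => deriv Φ z / Φ z) (ball p R) :=
    (hd.deriv isOpen_ball).div hd h0
  obtain ⟨φ, hφp, hφ⟩ := h1.isExactOn_ball.with_val_at p (Complex.log (Φ p))
  have hp := mem_ball_self (x := p) hR
  refine ⟨φ, fun z hz => (hφ z hz).differentiableAt.differentiableWithinAt, fun z hz => (hφ z hz).deriv, ?_⟩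
  have hder : ∀ z ∈ ball p R, HasDerivAt (fun z => Φ z * Complex.exp (-φ z)) 0 z := by
    intro z hz
    have h2 := (hd.differentiableAt (isOpen_ball.mem_nhds hz)).hasDerivAt.fun_mul ((hφ z hz).neg.cexp)
    refine h2.congr_deriv ?_
    have := h0 z hz
    have e : Φ z * (Complex.exp (-φ z) * -(deriv Φ z / Φ z)) = - (deriv Φ z * Complex.exp (-φ z)) := by
      field_simp
    simp only [Pi.neg_apply]
    rw [e]; ring
  intro z hz
  have hconst := (convex_ball p R).is_const_of_fderivWithin_eq_zero (𝕜 := ℂ)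
    (f := fun z => Φ z * Complex.exp (-φ z))
    (fun z hz => (hder z hz).differentiableAt.differentiableWithinAt) (fun z hz => by
      rw [fderivWithin_of_isOpen isOpen_ball hz]
      have := (hder z hz).hasFDerivAt.fderiv
      rw [this]; ext; simp) hz hp
  simp only [hφp, Complex.exp_neg, Complex.exp_log (h0 p hp)] at hconst
  rw [mul_inv_cancel₀ (h0 p hp)] at hconst
  have := Complex.exp_ne_zero (φ z)
  field_simp at hconst
  exact hconst.symm

theorem exists_sub_log {Φ : ℂ → ℂ} {p q : ℂ} {R : ℝ} (hR : 0 < R)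
    (hd : DifferentiableOn ℂ Φ (ball p R)) (hi : InjOn Φ (ball p R)) (hq : ∀ z ∈ ball p R, Φ z ≠ q) :
    ∃ φ : ℂ → ℂ, DifferentiableOn ℂ φ (ball p R) ∧ (∀ z ∈ ball p R, deriv φ z = deriv Φ z / (Φ z - q)) ∧
      (∀ z ∈ ball p R, Complex.exp (φ z) = Φ z - q) ∧
      ∀ z ∈ ball p R, ‖deriv φ z‖ * (R - ‖z - p‖) ≤ 192 := by
  obtain ⟨φ, h1, h2, h3⟩ := exists_log_ball (Φ := fun z => Φ z - q) hR (hd.sub_const q)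
    (fun z hz => sub_ne_zero.2 (hq z hz))
  refine ⟨φ, h1, fun z hz => by rw [h2 z hz]; simp, h3, fun z hz => ?_⟩
  have hzz : ‖z - p‖ < R := by simpa [dist_eq_norm] using hz
  have hsub : ball z (R - ‖z - p‖) ⊆ ball p R := by
    apply ball_subset_ball'; rw [dist_eq_norm]; linarith
  have := bloch (φ := φ) (p := z) (R := R - ‖z - p‖) (L := 4) (by linarith) (by norm_num) (h1.mono hsub) (by
    intro w hw
    have hπ : Real.pi < 4 := Real.pi_lt_four
    have e1 : w + Real.pi * Complex.I ∈ ball w 4 := by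
      simp [dist_eq_norm, abs_of_pos Real.pi_pos, hπ]
    have e2 : w - Real.pi * Complex.I ∈ ball w 4 := by
      simp [dist_eq_norm, abs_of_pos Real.pi_pos, hπ]
    obtain ⟨a, ha, ha'⟩ := hw e1
    obtain ⟨b, hb, hb'⟩ := hw e2
    have hab : φ a = φ b + 2 * Real.pi * Complex.I := by rw [ha', hb']; ring
    have h4 : Φ a - q = Φ b - q := by
      rw [← h3 a (hsub ha), ← h3 b (hsub hb), hab, Complex.exp_periodic]
    have h5 := hi (hsub ha) (hsub hb) (by linear_combination h4)
    rw [h5] at hab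
    have : (2 * Real.pi * Complex.I : ℂ) = 0 := by linear_combination -hab
    simp [Real.pi_ne_zero] at this)
  linarith

/-- (KO) derivative bound for an injective map omitting `q`. -/
theorem koebe_avoid {Φ : ℂ → ℂ} {p q : ℂ} {R : ℝ} (hR : 0 < R)
    (hd : DifferentiableOn ℂ Φ (ball p R)) (hi : InjOn Φ (ball p R)) (hq : ∀ z ∈ ball p R, Φ z ≠ q) :
    ‖deriv Φ p‖ * R ≤ 192 * ‖Φ p - q‖ := by
  obtain ⟨φ, -, h2, -, h4⟩ := exists_sub_log hR hd hi hq
  have hp := mem_ball_self (x := p) hR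
  have := h4 p hp
  rw [h2 p hp, norm_div] at this
  have h0 : 0 < ‖Φ p - q‖ := norm_pos_iff.2 (sub_ne_zero.2 (hq p hp))
  simp only [sub_self, norm_zero, sub_zero] at this
  rw [div_mul_eq_mul_div, div_le_iff₀ h0] at this
  exact this

/-- (K1) -/
theorem koebe_quarter {Φ : ℂ → ℂ} {p : ℂ} {R : ℝ} (hR : 0 < R)
    (hd : DifferentiableOn ℂ Φ (ball p R)) (hi : InjOn Φ (ball p R)) :
    ball (Φ p) (‖deriv Φ p‖ * R / 192) ⊆ Φ '' ball p R := by
  intro q hq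
  by_contra h
  have := koebe_avoid (q := q) hR hd hi (fun z hz e => h ⟨z, hz, e⟩)
  rw [mem_ball, dist_eq_norm, norm_sub_rev] at hq
  linarith

/-- (K2) -/
theorem koebe_growth_avoid {Φ : ℂ → ℂ} {p q : ℂ} {R t : ℝ} (hR : 0 < R)
    (hd : DifferentiableOn ℂ Φ (ball p R)) (hi : InjOn Φ (ball p R)) (hq : ∀ z ∈ ball p R, Φ z ≠ q)
    (ht0 : 0 ≤ t) (ht : t < 1) {z : ℂ} (hz : ‖z - p‖ ≤ t * R) :
    ‖Φ z - q‖ ≤ ‖Φ p - q‖ * Real.exp (192 * t / (1 - t)) ∧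
    ‖Φ z - Φ p‖ ≤ ‖Φ p - q‖ * (Real.exp (192 * t / (1 - t)) - 1) := by
  obtain ⟨φ, h1, h2, h3, h4⟩ := exists_sub_log hR hd hi hq
  have hp := mem_ball_self (x := p) hR
  have hsub : closedBall p (t * R) ⊆ ball p R := closedBall_subset_ball (by nlinarith)
  have hzc : z ∈ closedBall p (t * R) := by rw [mem_closedBall, dist_eq_norm]; exact hz
  have hΔ : ‖φ z - φ p‖ ≤ 192 * t / (1 - t) := by
    have := (convex_closedBall p (t*R)).norm_image_sub_le_of_norm_deriv_le (𝕜 := ℂ) (f := φ)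
      (C := 192 / ((1 - t) * R)) (fun w hw => h1.differentiableAt (isOpen_ball.mem_nhds (hsub hw)))
      (fun w hw => by
        have h5 := h4 w (hsub hw)
        have hw' : ‖w - p‖ ≤ t * R := by simpa [dist_eq_norm] using hw
        rw [le_div_iff₀ (by nlinarith)]
        refine le_trans ?_ h5
        gcongr
        linarith) (mem_closedBall_self (by positivity)) hzc
    refine this.trans ?_
    have : 0 < 1 - t := by linarith
    calc 192 / ((1 - t) * R) * ‖z - p‖ ≤ 192 / ((1 - t) * R) * (t * R) := by gcongr
      _ = _ := by field_simp
  have e : Φ z - q = (Φ p - q) * Complex.exp (φ z - φ p) := by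
    rw [← h3 z (hsub hzc), ← h3 p hp, ← Complex.exp_add]; congr 1; ring
  constructor
  · rw [e, norm_mul]
    gcongr
    refine (Complex.norm_exp_le_exp_norm _).trans (Real.exp_le_exp.2 hΔ)
  · have e2 : Φ z - Φ p = (Φ p - q) * (Complex.exp (φ z - φ p) - 1) := by
      linear_combination e
    rw [e2, norm_mul]
    gcongr
    have := Complex.norm_exp_sub_sum_le_exp_norm_sub_sum (φ z - φ p) 1
    simp at this
    linarith [Real.exp_le_exp.2 hΔ]


theorem local_form {f : ℂ → ℂ} {c : ℂ} (hf : AnalyticAt ℂ f c) (hne : ¬ ∀ᶠ z in nhds c, f z = f c) :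
    ∃ m : ℕ, 1 ≤ m ∧ ∃ ψ : ℂ → ℂ, AnalyticAt ℂ ψ c ∧ ψ c = 0 ∧ deriv ψ c ≠ 0 ∧
      ∀ᶠ z in nhds c, f z = f c + ψ z ^ m := by
  have hg : AnalyticAt ℂ (fun z => f z - f c) c := hf.sub analyticAt_const
  obtain ⟨m, g, hga, hg0, hgm⟩ := (hg.exists_eventuallyEq_pow_smul_nonzero_iff).2 (by
    simpa [sub_eq_zero] using hne)
  have hm : 1 ≤ m := by
    by_contra h
    have h0 : m = 0 := by omega
    subst h0
    have := hgm.self_of_nhds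
    simp at this
    exact hg0 this.symm
  have hm' : (m : ℂ) ≠ 0 := by exact_mod_cast (by omega : m ≠ 0)
  obtain ⟨k, hk⟩ := IsAlgClosed.exists_pow_nat_eq (g c) (by omega : 0 < m)
  have hk0 : k ≠ 0 := by
    rintro rfl
    rw [zero_pow (by omega)] at hk; exact hg0 hk.symm
  set L : ℂ → ℂ := fun z => Complex.exp (Complex.log (g z / g c) / m) with hL
  have hLa : AnalyticAt ℂ L c := by
    apply AnalyticAt.cexp
    refine AnalyticAt.div ?_ analyticAt_const hm'
    exact (hga.div analyticAt_const hg0).clog (by simp [div_self hg0])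
  have hLc : L c = 1 := by simp [hL, div_self hg0]
  refine ⟨m, hm, fun z => (z - c) * (k * L z), ?_, by simp, ?_, ?_⟩
  · exact (analyticAt_id.sub analyticAt_const).mul (analyticAt_const.mul hLa)
  · have : HasDerivAt (fun z => (z - c) * (k * L z)) (1 * (k * L c) + (c - c) * (k * deriv L c)) c :=
      ((hasDerivAt_id c).sub_const c).mul (hLa.differentiableAt.hasDerivAt.const_mul k)
    rw [this.deriv]
    simp [hLc, hk0]
  · have hgne : ∀ᶠ z in nhds c, g z ≠ 0 := hga.continuousAt.eventually_ne hg0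
    filter_upwards [hgm, hgne] with z hz hz0
    have h1 : f z = f c + (z - c) ^ m * g z := by
      rw [smul_eq_mul] at hz; linear_combination hz
    rw [h1, mul_pow, mul_pow, hk]
    simp only [hL]
    rw [← Complex.exp_nat_mul, mul_div_cancel₀ _ hm', Complex.exp_log (div_ne_zero hz0 hg0)]
    field_simp

theorem deriv_ne_zero_of_injOn {Φ : ℂ → ℂ} {U : Set ℂ} (hU : IsOpen U) (hd : DifferentiableOn ℂ Φ U)
    (hi : InjOn Φ U) {c : ℂ} (hc : c ∈ U) : deriv Φ c ≠ 0 := by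
  have hU' : U ∈ nhds c := hU.mem_nhds hc
  have hne : ¬ ∀ᶠ z in nhds c, Φ z = Φ c := by
    intro h
    have h2 : ∀ᶠ z in nhds c, z = c := by
      filter_upwards [h, hU'] with z hz hzU using hi hzU hc hz
    have := (h2.filter_mono nhdsWithin_le_nhds : ∀ᶠ z in nhdsWithin c {c}ᶜ, z = c)
    obtain ⟨z, hz, hz'⟩ := (this.and self_mem_nhdsWithin).exists
    exact hz' hz
  obtain ⟨m, hm, ψ, hψa, hψ0, hψ', hev⟩ := local_form (hd.analyticAt hU') hne
  rcases Nat.lt_or_ge 1 m with h2 | h1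
  · exfalso
    have hmap := hψa.hasStrictDerivAt.map_nhds_eq hψ'
    rw [hψ0] at hmap
    have hS : ψ '' {z | Φ z = Φ c + ψ z ^ m ∧ z ∈ U} ∈ nhds (0:ℂ) := by
      rw [← hmap]
      exact image_mem_map (hev.and hU')
    obtain ⟨r, hr, hrS⟩ := Metric.mem_nhds_iff.1 hS
    set ω := Complex.exp (2 * Real.pi * Complex.I / m)
    have hω := Complex.isPrimitiveRoot_exp m (by omega)
    have hωn : ‖ω‖ = 1 := hω.norm'_eq_one (by omega)
    have hw : ((r/2 : ℝ) : ℂ) ∈ ball (0:ℂ) r := by simp [abs_of_pos hr]; linarith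
    have hw2 : ω * ((r/2 : ℝ) : ℂ) ∈ ball (0:ℂ) r := by
      rw [mem_ball_zero_iff, norm_mul, hωn, one_mul]; simpa using hw
    obtain ⟨a, ⟨ha, haU⟩, ha2⟩ := hrS hw
    obtain ⟨b, ⟨hb, hbU⟩, hb2⟩ := hrS hw2
    have hab : Φ a = Φ b := by
      rw [ha, hb, ha2, hb2, mul_pow, hω.pow_eq_one, one_mul]
    have := hi haU hbU hab
    rw [this, hb2] at ha2
    have hr0 : ((r/2 : ℝ) : ℂ) ≠ 0 := by exact_mod_cast (by linarith : r/2 ≠ 0)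
    have h3 : ω = 1 := by
      field_simp at ha2
      exact ha2
    exact hω.ne_one h2 h3
  · have : m = 1 := by omega
    subst this
    simp only [pow_one] at hev
    have : HasDerivAt Φ (deriv ψ c) c :=
      (hψa.differentiableAt.hasDerivAt.const_add (Φ c)).congr_of_eventuallyEq hev
    rw [this.deriv]; exact hψ'

/-- inverse of an injective holomorphic map. -/
theorem exists_inverse {Φ : ℂ → ℂ} {U : Set ℂ} (hU : IsOpen U) (hd : DifferentiableOn ℂ Φ U)
    (hi : InjOn Φ U) : IsOpen (Φ '' U) ∧ ∃ g : ℂ → ℂ, DifferentiableOn ℂ g (Φ '' U) ∧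
      (∀ z ∈ U, g (Φ z) = z) ∧ ∀ z ∈ U, HasDerivAt g (deriv Φ z)⁻¹ (Φ z) := by
  have hsd : ∀ z ∈ U, HasStrictDerivAt Φ (deriv Φ z) z := fun z hz =>
    (hd.analyticAt (hU.mem_nhds hz)).hasStrictDerivAt
  have hlg : ∀ z ∈ U, invFunOn Φ U (Φ z) = z := fun z hz => hi.leftInvOn_invFunOn hz
  have hg : ∀ z ∈ U, HasDerivAt (invFunOn Φ U) (deriv Φ z)⁻¹ (Φ z) := fun z hz =>
    ((hsd z hz).to_local_left_inverse (deriv_ne_zero_of_injOn hU hd hi hz)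
      (mem_of_superset (hU.mem_nhds hz) hlg)).hasDerivAt
  refine ⟨?_, invFunOn Φ U, ?_, hlg, hg⟩
  · rw [isOpen_iff_mem_nhds]
    rintro _ ⟨z, hz, rfl⟩
    rw [← (hsd z hz).map_nhds_eq (deriv_ne_zero_of_injOn hU hd hi hz)]
    exact image_mem_map (hU.mem_nhds hz)
  · rintro _ ⟨z, hz, rfl⟩
    exact (hg z hz).differentiableAt.differentiableWithinAt

noncomputable def KC (t : ℝ) : ℝ := 2 * (Real.exp (192 * t / (1 - t)) - 1)

theorem KC_nonneg {t : ℝ} (h0 : 0 ≤ t) (h1 : t < 1) : 0 ≤ KC t := by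
  have : 0 < 1 - t := by linarith
  have : (1:ℝ) ≤ Real.exp (192 * t / (1 - t)) := Real.one_le_exp (by positivity)
  unfold KC; linarith

theorem exists_omitted {Φ : ℂ → ℂ} {p : ℂ} {R : ℝ} (hR : 0 < R)
    (hd : DifferentiableOn ℂ Φ (ball p R)) (hi : InjOn Φ (ball p R)) :
    ∃ q, ‖Φ p - q‖ ≤ 2 * ‖deriv Φ p‖ * R ∧ ∀ z ∈ ball p R, Φ z ≠ q := by
  by_contra hcon
  push Not at hcon
  have hp := mem_ball_self (x := p) hR
  set s := ‖deriv Φ p‖ with hs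
  have hs0 : 0 < s := norm_pos_iff.2 (deriv_ne_zero_of_injOn isOpen_ball hd hi hp)
  obtain ⟨-, g, hg1, hg2, hg3⟩ := exists_inverse isOpen_ball hd hi
  have hsub : ball (Φ p) (2 * s * R) ⊆ Φ '' ball p R := by
    intro q hq
    rw [mem_ball, dist_eq_norm, norm_sub_rev] at hq
    exact hcon q hq.le
  have := Complex.norm_deriv_le_div_of_mapsTo_ball (f := g) (c := Φ p) (R₁ := 2 * s * R) (R₂ := R)
    (hg1.mono hsub) (by
      intro w hw
      obtain ⟨z, hz, rfl⟩ := hsub hw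
      rw [hg2 z hz, hg2 p hp]
      exact ball_subset_closedBall hz) (by positivity)
  rw [(hg3 p hp).deriv, norm_inv, ← hs, inv_eq_one_div, div_le_div_iff₀ hs0 (by positivity)] at this
  nlinarith [mul_pos hs0 hR]

/-- growth theorem -/
theorem koebe_growth {Φ : ℂ → ℂ} {p : ℂ} {R t : ℝ} (hR : 0 < R)
    (hd : DifferentiableOn ℂ Φ (ball p R)) (hi : InjOn Φ (ball p R))
    (ht0 : 0 ≤ t) (ht : t < 1) {z : ℂ} (hz : ‖z - p‖ ≤ t * R) :
    ‖Φ z - Φ p‖ ≤ KC t * (‖deriv Φ p‖ * R) := by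
  obtain ⟨q, hq1, hq2⟩ := exists_omitted hR hd hi
  have h := (koebe_growth_avoid hR hd hi hq2 ht0 ht hz).2
  have h1 := KC_nonneg ht0 ht
  unfold KC at *
  have : ‖Φ p - q‖ * (Real.exp (192 * t / (1 - t)) - 1) ≤
    (2 * ‖deriv Φ p‖ * R) * (Real.exp (192 * t / (1 - t)) - 1) := by
    gcongr; linarith
  nlinarith

/-- distortion: derivative comparison (upper bound) -/
theorem koebe_deriv {Φ : ℂ → ℂ} {p : ℂ} {R t : ℝ} (hR : 0 < R)
    (hd : DifferentiableOn ℂ Φ (ball p R)) (hi : InjOn Φ (ball p R))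
    (ht0 : 0 ≤ t) (ht : t < 1) {z : ℂ} (hz : ‖z - p‖ ≤ t * R) :
    ‖deriv Φ z‖ ≤ 2 * KC ((1 + t) / 2) / (1 - t) * ‖deriv Φ p‖ := by
  set u := (1 + t) / 2
  have hu : u < 1 := by simp only [u]; linarith
  have hu0 : 0 ≤ u := by simp only [u]; linarith
  have hr : 0 < (1 - t) / 2 * R := by have : 0 < 1 - t := by linarith
                                      positivity
  have hKC := KC_nonneg hu0 hu
  have hsub : closedBall z ((1 - t) / 2 * R) ⊆ closedBall p (u * R) := by
    apply closedBall_subset_closedBall'; rw [dist_eq_norm]; simp only [u]; nlinarith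
  have hsub2 : closedBall p (u * R) ⊆ ball p R := closedBall_subset_ball (by nlinarith)
  have := Complex.norm_deriv_le_of_forall_mem_sphere_norm_le (f := fun w => Φ w - Φ p) (c := z)
    (C := KC u * (‖deriv Φ p‖ * R)) hr
    (((hd.sub_const _).mono (hsub.trans hsub2)).diffContOnCl_ball subset_rfl) (by
      intro w hw
      refine koebe_growth hR hd hi hu0 hu ?_
      have := hsub (sphere_subset_closedBall hw)
      simpa [dist_eq_norm] using this)
  rw [deriv_sub_const] at this
  refine this.trans (le_of_eq ?_)
  have : 1 - t ≠ 0 := by linarith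
  field_simp

theorem koebe_chain {N : Set ℂ} (hN : IsOpen N) (hc : IsPreconnected N) {u v : ℂ} (hu : u ∈ N) (hv : v ∈ N) :
    ∃ C : ℝ, 0 < C ∧ ∀ φ : ℂ → ℂ, DifferentiableOn ℂ φ N → InjOn φ N →
      ‖deriv φ v‖ ≤ C * ‖deriv φ u‖ ∧ ‖φ v - φ u‖ ≤ C * ‖deriv φ u‖ := by
  set P : ℂ → ℂ → Prop := fun u v => ∃ C : ℝ, 0 < C ∧ ∀ φ : ℂ → ℂ, DifferentiableOn ℂ φ N → InjOn φ N →
      ‖deriv φ v‖ ≤ C * ‖deriv φ u‖ ∧ ‖φ v - φ u‖ ≤ C * ‖deriv φ u‖ with hP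
  have key : ∀ x y : ℂ, ∀ R > 0, ball x R ⊆ N → ‖y - x‖ ≤ 1 / 2 * R → P x y := by
    intro x y R hR hsub hy
    have hK := KC_nonneg (t := (1 + 1/2)/2) (by norm_num) (by norm_num)
    have hK2 := KC_nonneg (t := 1/2) (by norm_num) (by norm_num)
    refine ⟨2 * KC ((1 + 1/2) / 2) / (1 - 1/2) + KC (1/2) * R + 1, ?_, fun φ hφ hi => ?_⟩
    · norm_num at *; positivity
    have h1 := koebe_deriv hR (hφ.mono hsub) (hi.mono hsub) (t := 1/2) (by norm_num) (by norm_num) hy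
    have h2 := koebe_growth hR (hφ.mono hsub) (hi.mono hsub) (t := 1/2) (by norm_num) (by norm_num) hy
    have h3 : 0 ≤ 2 * KC ((1 + 1/2) / 2) / (1 - 1/2) * ‖deriv φ x‖ := by norm_num at *; positivity
    have h4 : 0 ≤ KC (1/2) * R * ‖deriv φ x‖ := by positivity
    have h5 := norm_nonneg (deriv φ x)
    constructor <;> nlinarith
  refine hc.induction₂' P (fun x hx => ?_) (fun x y z _ _ _ h1 h2 => ?_) hu hv
  · obtain ⟨R, hR, hsub⟩ := Metric.isOpen_iff.1 hN x hx
    have : ∀ᶠ y in nhds x, y ∈ ball x (R/4) := ball_mem_nhds x (by linarith)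
    filter_upwards [mem_nhdsWithin_of_mem_nhds this] with y hy
    have hy' : ‖y - x‖ < R/4 := by simpa [dist_eq_norm] using hy
    refine ⟨key x y R hR hsub (by linarith), key y x (R/2) (by linarith) ?_ ?_⟩
    · refine (ball_subset_ball' ?_).trans hsub
      rw [dist_eq_norm]; linarith
    · rw [norm_sub_rev]; linarith
  · obtain ⟨C1, hC1, h1⟩ := h1
    obtain ⟨C2, hC2, h2⟩ := h2
    refine ⟨C2 * C1 + C1, by positivity, fun φ hφ hi => ?_⟩
    obtain ⟨a1, a2⟩ := h1 φ hφ hi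
    obtain ⟨b1, b2⟩ := h2 φ hφ hi
    have h5 := norm_nonneg (deriv φ x)
    have h6 : C2 * ‖deriv φ y‖ ≤ C2 * C1 * ‖deriv φ x‖ := by rw [mul_assoc]; gcongr
    constructor
    · nlinarith
    · have : ‖φ z - φ x‖ ≤ ‖φ z - φ y‖ + ‖φ y - φ x‖ := norm_sub_le_norm_sub_add_norm_sub _ _ _
      nlinarith


/-- pseudo-hyperbolic distance -/
noncomputable def pd (z w : ℂ) : ℝ := ‖z - w‖ / ‖1 - (starRingEnd ℂ) w * z‖

/-- Blaschke-type maps of the unit disc with degree at most `D`. -/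
def BL (D : ℕ) (Q : ℂ → ℂ) : Prop :=
  MapsTo Q (ball 0 1) (ball 0 1) ∧ ∀ w ∈ ball (0:ℂ) 1, ∃ s : Multiset ℂ, s ≠ 0 ∧ s.card ≤ D ∧
    (∀ a ∈ s, a ∈ ball (0:ℂ) 1) ∧ ∀ z ∈ ball (0:ℂ) 1, pd (Q z) w = (s.map (pd z)).prod

theorem one_sub_ne {z w : ℂ} (hz : ‖z‖ ≤ 1) (hw : ‖w‖ < 1) : 1 - (starRingEnd ℂ) w * z ≠ 0 := by
  intro h
  have h1 : (starRingEnd ℂ) w * z = 1 := by linear_combination -h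
  have h2 : ‖(starRingEnd ℂ) w * z‖ = 1 := by rw [h1]; simp
  rw [norm_mul, RCLike.norm_conj] at h2
  nlinarith [norm_nonneg z, norm_nonneg w]

theorem pd_nonneg (z w : ℂ) : 0 ≤ pd z w := by unfold pd; positivity

theorem pd_zero (z : ℂ) : pd z 0 = ‖z‖ := by simp [pd]

theorem pd_self (z : ℂ) : pd z z = 0 := by simp [pd]

theorem pd_eq_zero {z w : ℂ} (hz : ‖z‖ ≤ 1) (hw : ‖w‖ < 1) : pd z w = 0 ↔ z = w := by
  unfold pd
  rw [div_eq_zero_iff, norm_eq_zero, norm_eq_zero, sub_eq_zero]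
  simp [one_sub_ne hz hw]

theorem pd_key (z w : ℂ) : ‖1 - (starRingEnd ℂ) w * z‖ ^ 2 - ‖z - w‖ ^ 2 =
    (1 - ‖z‖^2) * (1 - ‖w‖^2) := by
  rw [← Complex.normSq_eq_norm_sq, ← Complex.normSq_eq_norm_sq, ← Complex.normSq_eq_norm_sq,
    ← Complex.normSq_eq_norm_sq]
  simp [Complex.normSq_apply]
  ring

theorem pd_of_norm_one {z w : ℂ} (hz : ‖z‖ = 1) (hw : ‖w‖ < 1) : pd z w = 1 := by
  have h := pd_key z w
  rw [hz] at h
  have h1 : ‖1 - (starRingEnd ℂ) w * z‖ = ‖z - w‖ := by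
    rw [← sq_eq_sq₀ (norm_nonneg _) (norm_nonneg _)]; linarith
  unfold pd
  rw [← h1, div_self]
  exact norm_ne_zero_iff.2 (one_sub_ne hz.le hw)

theorem pd_lower {z w : ℂ} (hz : ‖z‖ < 1) (hw : ‖w‖ < 1) :
    |‖z‖ - ‖w‖| / (1 - ‖w‖ * ‖z‖) ≤ pd z w := by
  have h := pd_key z w
  have h1 : 0 < ‖1 - (starRingEnd ℂ) w * z‖ := norm_pos_iff.2 (one_sub_ne hz.le hw)
  have hx := norm_nonneg z
  have hy := norm_nonneg w
  have h2 : 0 < 1 - ‖w‖ * ‖z‖ := by nlinarith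
  have h3 : 1 - ‖w‖ * ‖z‖ ≤ ‖1 - (starRingEnd ℂ) w * z‖ := by
    have := norm_sub_norm_le (1:ℂ) ((starRingEnd ℂ) w * z)
    rw [norm_mul, RCLike.norm_conj, norm_one] at this
    exact this
  unfold pd
  rw [div_le_div_iff₀ h2 h1]
  apply abs_le_of_sq_le_sq' _ (by positivity) |>.2
  rw [mul_pow, mul_pow, sq_abs]
  set X := ‖1 - (starRingEnd ℂ) w * z‖
  set Y := ‖z - w‖
  have h4 : Y ^ 2 = X ^ 2 - (1 - ‖z‖^2) * (1 - ‖w‖^2) := by linarith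
  rw [h4]
  have h5 : (1 - ‖w‖ * ‖z‖)^2 ≤ X^2 := by gcongr
  have h6 : 0 ≤ (1 - ‖z‖^2) * (1 - ‖w‖^2) := by
    apply mul_nonneg <;> nlinarith
  nlinarith [mul_le_mul_of_nonneg_left h5 h6]

theorem pd_lower' {z w : ℂ} (hz : ‖z‖ < 1) (hw : ‖w‖ < 1) : |‖z‖ - ‖w‖| ≤ pd z w := by
  refine le_trans ?_ (pd_lower hz hw)
  have hx := norm_nonneg z
  have hy := norm_nonneg w
  rw [le_div_iff₀ (by nlinarith)]
  nlinarith [abs_nonneg (‖z‖ - ‖w‖), mul_nonneg hy hx]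

theorem continuousOn_pd {w : ℂ} (hw : ‖w‖ < 1) : ContinuousOn (fun z => pd z w) (closedBall 0 1) := by
  unfold pd
  refine ContinuousOn.div (by fun_prop) (by fun_prop) (fun z hz => ?_)
  exact norm_ne_zero_iff.2 (one_sub_ne (by simpa using hz) hw)

theorem BL.proper {D : ℕ} {Q : ℂ → ℂ} (h : BL D Q) {K : ℝ} (hK : K < 1) :
    ∃ t : ℝ, t < 1 ∧ ∀ z ∈ ball (0:ℂ) 1, ‖Q z‖ ≤ K → ‖z‖ ≤ t := by
  obtain ⟨s, -, -, hs, hQ⟩ := h.2 0 (by simp)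
  have hc : ContinuousOn (fun z => (s.map (pd z)).prod) (closedBall (0:ℂ) 1) := by
    apply continuousOn_multiset_prod
    intro a ha
    exact continuousOn_pd (by simpa using hs a ha)
  have hcpt : IsCompact ({z | (s.map (pd z)).prod ≤ K} ∩ closedBall (0:ℂ) 1) := by
    rw [inter_comm]
    exact (isCompact_closedBall _ _).of_isClosed_subset
      (hc.preimage_isClosed_of_isClosed isClosed_closedBall isClosed_Iic) inter_subset_left
  rcases ({z | (s.map (pd z)).prod ≤ K} ∩ closedBall (0:ℂ) 1).eq_empty_or_nonempty with he | hne
  · refine ⟨0, by norm_num, fun z hz hzK => ?_⟩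
    exfalso
    have : z ∈ ({z | (s.map (pd z)).prod ≤ K} ∩ closedBall (0:ℂ) 1) :=
      ⟨by rw [mem_ofPred_eq, ← hQ z hz, pd_zero]; exact hzK, ball_subset_closedBall hz⟩
    rw [he] at this; exact this
  · obtain ⟨z0, hz0, hmax⟩ := hcpt.exists_isMaxOn hne (continuous_norm.continuousOn)
    refine ⟨‖z0‖, ?_, fun z hz hzK => ?_⟩
    · rcases lt_or_eq_of_le (show ‖z0‖ ≤ 1 by simpa using hz0.2) with h1 | h1
      · exact h1
      · exfalso
        have h2 := hz0.1
        have : s.map (pd z0) = s.map (fun _ => (1:ℝ)) :=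
          Multiset.map_congr rfl (fun a ha => pd_of_norm_one h1 (by simpa using hs a ha))
        rw [mem_ofPred_eq, this] at h2
        simp at h2
        linarith
    · exact hmax ⟨by rw [mem_ofPred_eq, ← hQ z hz, pd_zero]; exact hzK, ball_subset_closedBall hz⟩

theorem BL.surj {D : ℕ} {Q : ℂ → ℂ} (h : BL D Q) {w : ℂ} (hw : w ∈ ball (0:ℂ) 1) :
    ∃ z ∈ ball (0:ℂ) 1, Q z = w := by
  obtain ⟨s, hs0, -, hs, hQ⟩ := h.2 w hw
  obtain ⟨a, ha⟩ := Multiset.exists_mem_of_ne_zero hs0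
  refine ⟨a, hs a ha, ?_⟩
  have h1 := hQ a (hs a ha)
  rw [Multiset.prod_eq_zero (Multiset.mem_map.2 ⟨a, ha, pd_self a⟩)] at h1
  have := h.1 (hs a ha)
  exact (pd_eq_zero (mem_ball_zero_iff.1 this).le (by simpa using hw)).1 h1

theorem BL.zeros {D : ℕ} {Q : ℂ → ℂ} (h : BL D Q) {w : ℂ} (hw : w ∈ ball (0:ℂ) 1) :
    ∃ s : Finset ℂ, s.card ≤ D ∧ ∀ z ∈ ball (0:ℂ) 1, Q z = w → z ∈ s := by
  classical
  obtain ⟨s, hs0, hcard, hs, hQ⟩ := h.2 w hw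
  refine ⟨s.toFinset, (Multiset.toFinset_card_le s).trans hcard, fun z hz hzw => ?_⟩
  have h1 := hQ z hz
  rw [hzw, pd_self] at h1
  obtain ⟨a, ha, ha'⟩ := Multiset.mem_map.1 (Multiset.prod_eq_zero_iff.1 h1.symm)
  rw [pd_eq_zero (mem_ball_zero_iff.1 hz).le (by simpa using hs a ha)] at ha'
  simpa [ha'] using ha

theorem BL.id : BL 1 (fun z => z) :=
  ⟨fun z hz => hz, fun w hw => ⟨{w}, by simp, by simp, by simpa using hw, by simp⟩⟩

theorem BL.mono {D D' : ℕ} {Q : ℂ → ℂ} (h : BL D Q) (hD : D ≤ D') : BL D' Q :=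
  ⟨h.1, fun w hw => let ⟨s, h1, h2, h3⟩ := h.2 w hw; ⟨s, h1, h2.trans hD, h3⟩⟩

theorem BL.comp {D E : ℕ} {P Q : ℂ → ℂ} (hP : BL D P) (hQ : BL E Q) : BL (D * E) (fun z => P (Q z)) := by
  refine ⟨fun z hz => hP.1 (hQ.1 hz), fun w hw => ?_⟩
  obtain ⟨s, hs0, hs1, hs2, hs3⟩ := hP.2 w hw
  have : ∀ a : ℂ, ∃ s : Multiset ℂ, a ∈ ball (0:ℂ) 1 → s ≠ 0 ∧ s.card ≤ E ∧
    (∀ a ∈ s, a ∈ ball (0:ℂ) 1) ∧ ∀ z ∈ ball (0:ℂ) 1, pd (Q z) a = (s.map (pd z)).prod := by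
    intro a
    by_cases ha : a ∈ ball (0:ℂ) 1
    · obtain ⟨s, hs⟩ := hQ.2 a ha
      exact ⟨s, fun _ => hs⟩
    · exact ⟨0, fun h => absurd h ha⟩
  choose T hT using this
  refine ⟨s.bind T, ?_, ?_, ?_, ?_⟩
  · obtain ⟨a, ha⟩ := Multiset.exists_mem_of_ne_zero hs0
    obtain ⟨b, hb⟩ := Multiset.exists_mem_of_ne_zero (hT a (hs2 a ha)).1
    exact fun h => by
      have : b ∈ s.bind T := Multiset.mem_bind.2 ⟨a, ha, hb⟩
      rw [h] at this; simp at this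
  · rw [Multiset.card_bind]
    refine (Multiset.sum_le_card_nsmul (s.map (Multiset.card ∘ T)) E ?_).trans ?_
    · intro x hx
      obtain ⟨a, ha, rfl⟩ := Multiset.mem_map.1 hx
      exact (hT a (hs2 a ha)).2.1
    · simp; exact Nat.mul_le_mul_right _ hs1
  · intro b hb
    obtain ⟨a, ha, hb⟩ := Multiset.mem_bind.1 hb
    exact (hT a (hs2 a ha)).2.2.1 b hb
  · intro z hz
    rw [hs3 (Q z) (hQ.1 hz), Multiset.map_bind, Multiset.prod_bind]
    congr 1
    refine Multiset.map_congr rfl (fun a ha => ?_)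
    exact (hT a (hs2 a ha)).2.2.2 z hz

/-- disc automorphism sending `0` to `a` -/
noncomputable def mob (a z : ℂ) : ℂ := (z + a) / (1 + (starRingEnd ℂ) a * z)

theorem one_add_ne {z w : ℂ} (hz : ‖z‖ ≤ 1) (hw : ‖w‖ < 1) : 1 + (starRingEnd ℂ) w * z ≠ 0 := by
  have := one_sub_ne (z := z) (w := -w) hz (by simpa using hw)
  simpa using this

theorem mob_zero (a : ℂ) : mob a 0 = a := by simp [mob]

theorem mob_neg {a : ℂ} : mob (-a) a = 0 := by simp [mob]

theorem norm_mob_lt {a z : ℂ} (ha : ‖a‖ < 1) (hz : ‖z‖ < 1) : ‖mob a z‖ < 1 := by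
  have h0 := one_add_ne hz.le ha
  have h := pd_key z (-a)
  simp only [map_neg, neg_mul, sub_neg_eq_add, norm_neg] at h
  unfold mob
  rw [norm_div, div_lt_one (norm_pos_iff.2 h0)]
  have h1 : 0 < (1 - ‖z‖^2) * (1 - ‖a‖^2) := by
    apply mul_pos <;> nlinarith [norm_nonneg z, norm_nonneg a]
  exact lt_of_pow_lt_pow_left₀ 2 (norm_nonneg _) (by linarith)

theorem differentiableOn_mob {a : ℂ} (ha : ‖a‖ < 1) : DifferentiableOn ℂ (mob a) (ball 0 1) := by
  unfold mob
  refine DifferentiableOn.div (by fun_prop) (by fun_prop) (fun z hz => ?_)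
  exact one_add_ne (mem_ball_zero_iff.1 hz).le ha

theorem mob_mul {a z : ℂ} (ha : ‖a‖ < 1) (hz : ‖z‖ ≤ 1) : mob a z * (1 + (starRingEnd ℂ) a * z) = z + a := by
  unfold mob
  exact div_mul_cancel₀ _ (one_add_ne hz ha)

theorem mob_neg_mob {a z : ℂ} (ha : ‖a‖ < 1) (hz : ‖z‖ < 1) : mob (-a) (mob a z) = z := by
  have h1 := one_add_ne (w := -a) (norm_mob_lt ha hz).le (by simpa using ha)
  have h2 := mob_mul ha hz.le
  rw [mob, div_eq_iff h1]
  simp only [map_neg]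
  linear_combination h2

theorem mob_mob_neg {a z : ℂ} (ha : ‖a‖ < 1) (hz : ‖z‖ < 1) : mob a (mob (-a) z) = z := by
  have := mob_neg_mob (a := -a) (z := z) (by simpa using ha) hz
  simpa using this

theorem mob_injOn {a : ℂ} (ha : ‖a‖ < 1) : InjOn (mob a) (ball 0 1) := by
  intro z hz w hw h
  rw [← mob_neg_mob ha (mem_ball_zero_iff.1 hz), h, mob_neg_mob ha (mem_ball_zero_iff.1 hw)]

theorem pd_mob {a z w : ℂ} (ha : ‖a‖ < 1) (hz : ‖z‖ < 1) (hw : ‖w‖ < 1) :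
    pd (mob a z) (mob a w) = pd z w := by
  have h0 := one_add_ne hz.le ha
  have h1 := one_add_ne hw.le ha
  have h2 : (1:ℂ) + (starRingEnd ℂ) (-a) * a ≠ 0 := one_add_ne ha.le (by simpa using ha)
  have h3 : (1:ℂ) + a * (starRingEnd ℂ) w ≠ 0 := by
    intro h
    apply h1
    have := congrArg (starRingEnd ℂ) h
    simpa using this
  have hmz := mob_mul ha hz.le
  have hmw := mob_mul ha hw.le
  have hmw' := congrArg (starRingEnd ℂ) hmw
  simp only [map_add, map_one, map_mul, Complex.conj_conj] at hmw'
  have e1 : mob a z - mob a w = (z - w) * (1 + (starRingEnd ℂ) (-a) * a) /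
      ((1 + (starRingEnd ℂ) a * z) * (1 + (starRingEnd ℂ) a * w)) := by
    rw [eq_div_iff (mul_ne_zero h0 h1), map_neg]
    linear_combination (1 + (starRingEnd ℂ) a * w) * hmz - (1 + (starRingEnd ℂ) a * z) * hmw
  have e2 : 1 - (starRingEnd ℂ) (mob a w) * mob a z = (1 - (starRingEnd ℂ) w * z) *
      (1 + (starRingEnd ℂ) (-a) * a) / ((1 + (starRingEnd ℂ) a * z) * (1 + a * (starRingEnd ℂ) w)) := by
    rw [eq_div_iff (mul_ne_zero h0 h3), map_neg]
    linear_combination (-(starRingEnd ℂ) (mob a w) * (1 + a * (starRingEnd ℂ) w)) * hmz - (z + a) * hmw'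
  have h4 : ‖1 + a * (starRingEnd ℂ) w‖ = ‖1 + (starRingEnd ℂ) a * w‖ := by
    rw [← RCLike.norm_conj]; simp
  unfold pd
  rw [e1, e2]
  simp only [norm_div, norm_mul, h4]
  have k0 := norm_ne_zero_iff.2 h0
  have k1 := norm_ne_zero_iff.2 h1
  have k2 := norm_ne_zero_iff.2 h2
  have k3 := norm_ne_zero_iff.2 (one_sub_ne hz.le hw)
  generalize ‖1 + (starRingEnd ℂ) a * z‖ = x0 at *
  generalize ‖1 + (starRingEnd ℂ) a * w‖ = x1 at *
  generalize ‖1 + (starRingEnd ℂ) (-a) * a‖ = x2 at *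
  generalize ‖1 - (starRingEnd ℂ) w * z‖ = x3 at *
  field_simp

theorem BL.mob {a : ℂ} (ha : ‖a‖ < 1) : BL 1 (mob a) := by
  have hna : ‖-a‖ < 1 := by simpa using ha
  refine ⟨fun z hz => mem_ball_zero_iff.2 (norm_mob_lt ha (mem_ball_zero_iff.1 hz)), fun w hw => ?_⟩
  have hw' := mem_ball_zero_iff.1 hw
  refine ⟨{_root_.mob (-a) w}, by simp, by simp, ?_, fun z hz => ?_⟩
  · simpa using norm_mob_lt hna hw'
  · have := pd_mob ha (mem_ball_zero_iff.1 hz) (norm_mob_lt hna hw')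
    rw [mob_mob_neg ha hw'] at this
    simpa using this

theorem BL.pow {m : ℕ} (hm : 1 ≤ m) : BL m (fun z => z ^ m) := by
  refine ⟨fun z hz => ?_, fun w hw => ?_⟩
  · rw [mem_ball_zero_iff] at hz ⊢
    rw [norm_pow]; exact pow_lt_one₀ (norm_nonneg _) hz (by omega)
  obtain ⟨k, hk⟩ := IsAlgClosed.exists_pow_nat_eq w (by omega : 0 < m)
  have hω := Complex.isPrimitiveRoot_exp m (by omega)
  have hkn : ‖k‖ < 1 := by
    rw [mem_ball_zero_iff, ← hk, norm_pow] at hw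
    by_contra h
    exact absurd hw (not_lt.2 (one_le_pow₀ (not_lt.1 h)))
  have hroot : ∀ x ∈ Polynomial.nthRootsFinset m (1:ℂ), ‖x‖ = 1 := by
    intro x hx
    rw [Polynomial.mem_nthRootsFinset (by omega)] at hx
    exact Complex.norm_eq_one_of_pow_eq_one hx (by omega)
  refine ⟨(Polynomial.nthRootsFinset m (1:ℂ)).val.map (fun x => x * k), ?_, ?_, ?_, ?_⟩
  · intro h
    have := congrArg Multiset.card h
    simp [hω.card_nthRootsFinset] at this
    omega
  · simp [hω.card_nthRootsFinset]
  · intro a ha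
    obtain ⟨x, hx, rfl⟩ := Multiset.mem_map.1 ha
    simpa [hroot x hx] using hkn
  · intro z hz
    rw [Multiset.map_map]
    have e1 := hω.pow_sub_pow_eq_prod_sub_mul z k (by omega)
    have e2 := hω.pow_sub_pow_eq_prod_sub_mul 1 ((starRingEnd ℂ) k * z) (by omega)
    have hz' := mem_ball_zero_iff.1 hz
    have e3 : ‖∏ x ∈ Polynomial.nthRootsFinset m (1:ℂ), (1 - x * ((starRingEnd ℂ) k * z))‖
        = ∏ x ∈ Polynomial.nthRootsFinset m (1:ℂ), ‖1 - (starRingEnd ℂ) (x * k) * z‖ := by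
      rw [norm_prod]
      refine Finset.prod_bij' (fun x _ => (starRingEnd ℂ) x) (fun x _ => (starRingEnd ℂ) x) ?_ ?_ ?_ ?_ ?_
      · intro x hx
        rw [Polynomial.mem_nthRootsFinset (by omega)] at hx ⊢
        rw [← map_pow, hx, map_one]
      · intro x hx
        rw [Polynomial.mem_nthRootsFinset (by omega)] at hx ⊢
        rw [← map_pow, hx, map_one]
      · simp
      · simp
      · intro x hx
        simp [mul_assoc]
    change pd (z ^ m) w = ∏ x ∈ Polynomial.nthRootsFinset m (1:ℂ), pd z (x * k)
    unfold pd
    rw [Finset.prod_div_distrib, ← e3, ← e2, ← norm_prod, ← e1, hk]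
    congr 2
    rw [mul_pow, ← map_pow, hk]; simp

theorem exists_good_circle {s : Multiset ℂ} {D : ℕ} (hs : s.card ≤ D) (B : ℕ → ℂ → Prop)
    (hB : ∀ i j a, B i a → B j a → i = j) : ∃ k ≤ D, ∀ a ∈ s, ¬ B k a := by
  classical
  by_contra hcon
  push Not at hcon
  choose! g hg using hcon
  have hmaps : MapsTo g (Finset.range (D + 1)) s.toFinset := by
    intro k hk
    have hk' : k ≤ D := by simp at hk; omega
    simpa using (hg k hk').1
  have hinj : InjOn g (Finset.range (D+1) : Finset ℕ) := by
    intro i hi j hj hij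
    have hi' : i ≤ D := by simp at hi; omega
    have hj' : j ≤ D := by simp at hj; omega
    exact hB i j (g i) (hg i hi').2 (hij ▸ (hg j hj').2)
  have h1 := Finset.card_le_card_of_injOn g hmaps hinj
  have h2 := Multiset.toFinset_card_le s
  simp at h1
  omega

theorem exists_on_circle {Z : Set ℂ} (hZ : IsPreconnected Z) (h0 : (0:ℂ) ∈ Z) {z : ℂ} (hz : z ∈ Z) {r : ℝ}
    (hr0 : 0 ≤ r) (hr : r ≤ ‖z‖) : ∃ w ∈ Z, ‖w‖ = r := by
  have := hZ.intermediate_value h0 hz continuous_norm.continuousOn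
  obtain ⟨w, hw, hw'⟩ := this ⟨by simpa using hr0, hr⟩
  exact ⟨w, hw, hw'⟩

theorem pow_le_multiset_prod {s : Multiset ℂ} {D : ℕ} (hs : s.card ≤ D) {F : ℂ → ℝ} {c : ℝ} (hc0 : 0 ≤ c) (hc1 : c ≤ 1)
    (hF : ∀ a ∈ s, c ≤ F a) : c ^ D ≤ (s.map F).prod := by
  have h1 : c ^ s.card ≤ (s.map F).prod := by
    induction s using Multiset.induction with
    | empty => simp
    | cons a s ih =>
      have h2 := ih (by simp at hs; omega) (fun b hb => hF b (Multiset.mem_cons_of_mem hb))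
      simp only [Multiset.card_cons, Multiset.map_cons, Multiset.prod_cons]
      rw [pow_succ, mul_comm]
      have := hF a (Multiset.mem_cons_self a s)
      gcongr
      linarith
  exact (pow_le_pow_of_le_one hc0 hc1 hs).trans h1

/-- smallness of components -/
theorem BL.small (D : ℕ) {t : ℝ} (ht : 0 < t) (ht1 : t < 1) : ∃ σ : ℝ, 0 < σ ∧ ∀ Q, BL D Q → ∀ Z : Set ℂ,
    IsPreconnected Z → (0:ℂ) ∈ Z → Z ⊆ ball 0 1 → (∀ z ∈ Z, ‖Q z‖ ≤ σ) → ∀ z ∈ Z, ‖z‖ < t := by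
  set c := t / (2 * (D + 1)) with hc
  have hc0 : 0 < c := by positivity
  have hc1 : c ≤ 1 := by rw [hc, div_le_one (by positivity)]; nlinarith [(Nat.cast_nonneg D : (0:ℝ) ≤ D)]
  refine ⟨c ^ D / 2, by positivity, fun Q hQ Z hZ h0 hZ1 hσ z hz => ?_⟩
  by_contra hcon
  push Not at hcon
  obtain ⟨s, -, hs1, hs2, hs3⟩ := hQ.2 0 (by simp)
  have hte : t = 2 * c * (D + 1) := by rw [hc]; field_simp
  obtain ⟨k, hk, hk2⟩ := exists_good_circle hs1 (fun k a => |2 * c * (k + 1) - ‖a‖| < c) (by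
    intro i j a hi hj
    rw [abs_lt] at hi hj
    have h1 : (i:ℝ) < j + 1 := by by_contra h; nlinarith
    have h2 : (j:ℝ) < i + 1 := by by_contra h; nlinarith
    have h1' : i < j + 1 := by exact_mod_cast h1
    have h2' : j < i + 1 := by exact_mod_cast h2
    omega)
  have hkD : (k:ℝ) ≤ D := by exact_mod_cast hk
  obtain ⟨w, hw, hw'⟩ := exists_on_circle hZ h0 hz (r := 2 * c * (k + 1)) (by positivity)
    (le_trans (by rw [hte]; gcongr) hcon)
  have h1 := hs3 w (hZ1 hw)
  have h2 := pow_le_multiset_prod (F := pd w) hs1 hc0.le hc1 (fun a ha => by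
    have := hk2 a ha
    rw [← hw'] at this
    exact (not_lt.1 this).trans (pd_lower' (mem_ball_zero_iff.1 (hZ1 hw)) (mem_ball_zero_iff.1 (hs2 a ha))))
  rw [← h1, pd_zero] at h2
  have := hσ w hw
  have : 0 < c ^ D := by positivity
  linarith

/-- components are compactly contained -/
theorem BL.compact (D : ℕ) {σ : ℝ} (hσ : σ < 1) : ∃ t : ℝ, 0 < t ∧ t < 1 ∧ ∀ Q, BL D Q → ∀ Z : Set ℂ,
    IsPreconnected Z → (0:ℂ) ∈ Z → Z ⊆ ball 0 1 → (∀ z ∈ Z, ‖Q z‖ ≤ σ) → ∀ z ∈ Z, ‖z‖ < t := by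
  obtain ⟨γ, hγ0, hγ1, hγ⟩ : ∃ γ : ℝ, 0 < γ ∧ γ < 1/2 ∧ σ < ((1 - γ) / (1 + γ)) ^ D := by
    have hcont : ContinuousAt (fun γ : ℝ => ((1 - γ) / (1 + γ)) ^ D) 0 := by
      apply ContinuousAt.pow
      apply ContinuousAt.div <;> first | fun_prop | norm_num
    have h1 : ∀ᶠ γ in nhds (0:ℝ), σ < ((1 - γ) / (1 + γ)) ^ D :=
      hcont.eventually_const_lt (by simpa using hσ)
    have h2 : ∀ᶠ γ in nhds (0:ℝ), γ < 1/2 := eventually_lt_nhds (by norm_num)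
    obtain ⟨γ, ⟨h3, h4⟩, h5⟩ := (((h1.and h2).filter_mono nhdsWithin_le_nhds).and
      (self_mem_nhdsWithin (a := (0:ℝ)) (s := Ioi 0))).exists
    exact ⟨γ, h5, h4, h3⟩
  have hpw : ∀ {i j : ℕ}, i ≤ j → γ ^ j ≤ γ ^ i := fun h => pow_le_pow_of_le_one hγ0.le (by linarith) h
  refine ⟨1 - γ ^ (2 * D + 2), ?_, ?_, fun Q hQ Z hZ h0 hZ1 hσ' z hz => ?_⟩
  · have : γ ^ (2 * D + 2) < 1 := pow_lt_one₀ hγ0.le (by linarith) (by omega)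
    linarith
  · have : 0 < γ ^ (2 * D + 2) := by positivity
    linarith
  by_contra hcon
  push Not at hcon
  obtain ⟨s, -, hs1, hs2, hs3⟩ := hQ.2 0 (by simp)
  obtain ⟨k, hk, hk2⟩ := exists_good_circle hs1
    (fun k a => γ ^ (2 * k + 3) < 1 - ‖a‖ ∧ 1 - ‖a‖ < γ ^ (2 * k + 1)) (by
    intro i j a hi hj
    by_contra hij
    rcases Nat.lt_or_gt_of_ne hij with h | h
    · have := hpw (show 2 * i + 3 ≤ 2 * j + 1 by omega)
      linarith [hi.1, hj.2]
    · have := hpw (show 2 * j + 3 ≤ 2 * i + 1 by omega)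
      linarith [hj.1, hi.2])
  obtain ⟨w, hw, hw'⟩ := exists_on_circle hZ h0 hz (r := 1 - γ ^ (2 * k + 2)) (by
      have : γ ^ (2 * k + 2) ≤ 1 := pow_le_one₀ hγ0.le (by linarith)
      linarith)
    (le_trans (by linarith [hpw (show 2 * k + 2 ≤ 2 * D + 2 by omega)]) hcon)
  have h1 := hs3 w (hZ1 hw)
  have h2 := pow_le_multiset_prod (F := pd w) (c := (1 - γ) / (1 + γ)) hs1
    (div_nonneg (by linarith) (by linarith)) (by rw [div_le_one] <;> linarith) (fun a ha => by
    have h3 := hk2 a ha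
    have hwn := mem_ball_zero_iff.1 (hZ1 hw)
    have han := mem_ball_zero_iff.1 (hs2 a ha)
    refine le_trans ?_ (pd_lower hwn han)
    have hx := norm_nonneg w
    have hy := norm_nonneg a
    have e1 : γ ^ (2 * k + 3) = γ ^ (2 * k + 2) * γ := by ring
    have e2 : γ ^ (2 * k + 2) = γ ^ (2 * k + 1) * γ := by ring
    rw [e1] at h3
    set u := γ ^ (2 * k + 2) with hu
    set p := γ ^ (2 * k + 1)
    have hu0 : 0 < u := by positivity
    have hp0 : 0 < p := by positivity
    have hv : 0 < 1 - ‖a‖ := by linarith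
    have hwe : ‖w‖ = 1 - u := hw'
    rw [div_le_div_iff₀ (by linarith) (by nlinarith)]
    by_cases h4 : u * γ < 1 - ‖a‖
    · have h5 : p ≤ 1 - ‖a‖ := by by_contra h; exact h3 ⟨h4, not_le.1 h⟩
      have h7 : 0 ≤ γ * (1 - ‖a‖) - u := by rw [e2]; nlinarith
      rw [hwe, abs_of_nonneg (by nlinarith)]
      nlinarith [mul_nonneg hu0.le hv.le]
    · push Not at h4
      rw [hwe, abs_of_nonpos (by nlinarith)]
      nlinarith [mul_nonneg hu0.le hv.le])
  rw [← h1, pd_zero] at h2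
  have := hσ' w hw
  linarith


/-- curve lemma -/
theorem curve_lemma {f : ℂ → ℂ} (hf : Differentiable ℂ f) (hnc : ∀ z, ¬ ∀ᶠ w in nhds z, f w = f z)
    {σ : ℝ → ℂ} (hσ : ContinuousOn σ (Ico 0 1)) {b : ℂ} (hb : ¬ AsymptoticValue f b)
    (hlim : Tendsto (fun t => f (σ t)) (nhdsWithin 1 (Iio 1)) (nhds b)) :
    ∃ q, f q = b ∧ Tendsto σ (nhdsWithin 1 (Iio 1)) (nhds q) := by
  have hfq : ∃ B : ℝ, ∃ᶠ t in nhdsWithin (1:ℝ) (Iio 1), ‖σ t‖ ≤ B := by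
    by_contra hcon
    push Not at hcon
    apply hb
    have hto : Tendsto (fun t : ℝ => |t| / (1 + |t|)) atTop (nhdsWithin 1 (Iio 1)) := by
      rw [tendsto_nhdsWithin_iff]
      constructor
      · have h1 : Tendsto (fun t : ℝ => 1 - 1 / (1 + t)) atTop (nhds (1 - 0)) := by
          apply Tendsto.const_sub
          apply Tendsto.div_atTop tendsto_const_nhds
          exact tendsto_atTop_add_const_left _ _ tendsto_id
        rw [sub_zero] at h1
        refine h1.congr' ?_
        filter_upwards [eventually_ge_atTop 0] with t ht
        rw [abs_of_nonneg ht]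
        have : (1 + t) ≠ 0 := by linarith
        field_simp
        ring
      · filter_upwards with t
        have : 0 < 1 + |t| := by positivity
        rw [mem_Iio, div_lt_one this]; linarith
    refine ⟨fun t => σ (|t| / (1 + |t|)), ?_, ?_, hlim.comp hto⟩
    · apply hσ.comp_continuous
      · exact continuous_abs.div (by fun_prop) (fun t => by positivity)
      · intro t
        have : 0 < 1 + |t| := by positivity
        refine ⟨by positivity, ?_⟩
        rw [div_lt_one this]; linarith
    · have : Tendsto (fun t => ‖σ t‖) (nhdsWithin 1 (Iio 1)) atTop := by
        rw [Filter.tendsto_atTop]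
        intro B
        filter_upwards [(hcon B)] with t ht
        exact ht.le
      exact this.comp hto
  obtain ⟨B, hB⟩ := hfq
  obtain ⟨q, -, hq⟩ := (isCompact_closedBall (0:ℂ) B).exists_mapClusterPt_of_frequently
    (f := σ) (l := nhdsWithin (1:ℝ) (Iio 1)) (hB.mono (fun t ht => by simpa using ht))
  have hfq : f q = b := by
    have h1 : MapClusterPt (f q) (nhdsWithin (1:ℝ) (Iio 1)) (fun t => f (σ t)) :=
      hq.continuousAt_comp hf.continuous.continuousAt
    have h2 : ClusterPt (f q) (nhds b) := h1.clusterPt.mono hlim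
    exact eq_of_nhds_neBot h2
  refine ⟨q, hfq, ?_⟩
  have hiso : ∀ᶠ z in nhdsWithin q {q}ᶜ, f z ≠ b := by
    rcases (hf.analyticAt q).eventually_eq_or_eventually_ne (analyticAt_const (v := b)) with h | h
    · exact absurd (h.mono fun z hz => by rw [hz, hfq]) (hnc q)
    · exact h
  rw [eventually_nhdsWithin_iff, Metric.eventually_nhds_iff] at hiso
  obtain ⟨e0, he0, hiso⟩ := hiso
  rw [Metric.tendsto_nhds]
  intro e he
  set r := min e (e0/2) with hr
  have hr0 : 0 < r := by positivity
  have hre : r ≤ e := min_le_left _ _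
  have hre0 : r < e0 := lt_of_le_of_lt (min_le_right _ _) (by linarith)
  obtain ⟨m, hm0, hm⟩ : ∃ m > 0, ∀ z ∈ sphere q r, m ≤ ‖f z - b‖ := by
    obtain ⟨x, hx, hmin⟩ := (isCompact_sphere q r).exists_isMinOn (NormedSpace.sphere_nonempty.2 hr0.le)
      (f := fun z => ‖f z - b‖) (by have := hf.continuous; fun_prop)
    refine ⟨‖f x - b‖, ?_, fun z hz => hmin hz⟩
    rw [gt_iff_lt, norm_pos_iff, sub_ne_zero]
    have hx' : dist x q = r := hx
    refine hiso (by rw [hx']; exact hre0) ?_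
    rintro rfl
    simp at hx'; linarith
  have hev : ∀ᶠ t in nhdsWithin (1:ℝ) (Iio 1), ‖f (σ t) - b‖ < m := by
    have := Metric.tendsto_nhds.1 hlim m hm0
    simpa [dist_eq_norm] using this
  rw [eventually_nhdsWithin_iff, Metric.eventually_nhds_iff] at hev
  obtain ⟨d, hd, hev⟩ := hev
  set t0 := max 0 (1 - d) with ht0
  have hI : ∀ t ∈ Ioo t0 1, ‖f (σ t) - b‖ < m := by
    intro t ht
    apply hev _ ht.2
    rw [Real.dist_eq, abs_lt]
    have : 1 - d ≤ t0 := le_max_right _ _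
    constructor <;> linarith [ht.1, ht.2]
  have ht01 : t0 < 1 := max_lt one_pos (by linarith)
  have hmemI : Ioo t0 1 ∈ nhdsWithin (1:ℝ) (Iio 1) := Ioo_mem_nhdsLT ht01
  have hsub : Ioo t0 1 ⊆ Ico 0 1 := fun t ht => ⟨(le_max_left _ _).trans ht.1.le, ht.2⟩
  have hconn : IsPreconnected (σ '' Ioo t0 1) := isPreconnected_Ioo.image _ (hσ.mono hsub)
  have hfr : ∃ᶠ t in nhdsWithin (1:ℝ) (Iio 1), σ t ∈ ball q r :=
    mapClusterPt_iff_frequently.1 hq _ (ball_mem_nhds q hr0)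
  obtain ⟨t1, ht1, ht1'⟩ := (hfr.and_eventually hmemI).exists
  have hin : σ '' Ioo t0 1 ⊆ ball q r := by
    apply hconn.subset_left_of_subset_union isOpen_ball (isClosed_closedBall (x := q) (ε := r)).isOpen_compl
    · exact disjoint_left.2 fun z hz hz' => hz' (ball_subset_closedBall hz)
    · rintro _ ⟨t, ht, rfl⟩
      rcases lt_trichotomy (dist (σ t) q) r with h | h | h
      · left; exact h
      · exact absurd (hm _ h) (not_le.2 (hI t ht))
      · right; simpa using h
    · exact ⟨σ t1, ⟨t1, ht1', rfl⟩, ht1⟩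
  filter_upwards [hmemI] with t ht
  exact lt_of_lt_of_le (hin ⟨t, ht, rfl⟩) hre

/-- local injectivity at a noncritical point -/
theorem exists_injOn_ball {f : ℂ → ℂ} {q : ℂ} (hf : AnalyticAt ℂ f q) (h : deriv f q ≠ 0) :
    ∃ r > 0, DifferentiableOn ℂ f (ball q r) ∧ InjOn f (ball q r) := by
  have h1 : ∀ᶠ z in nhds q, AnalyticAt ℂ f z := hf.eventually_analyticAt
  have hs := hf.hasStrictDerivAt.hasStrictFDerivAt_equiv h
  have h2 := hs.toOpenPartialHomeomorph f |>.open_source.mem_nhds hs.mem_toOpenPartialHomeomorph_source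
  obtain ⟨r, hr, hr'⟩ := Metric.eventually_nhds_iff_ball.1 (h1.and h2)
  refine ⟨r, hr, fun z hz => (hr' z hz).1.differentiableAt.differentiableWithinAt, ?_⟩
  exact (hs.toOpenPartialHomeomorph f).injOn.mono (fun z hz => (hr' z hz).2)

/-- identity theorem for holomorphic functions on open preconnected sets -/
theorem ident {f g : ℂ → ℂ} {U : Set ℂ} (hU : IsOpen U) (hc : IsPreconnected U)
    (hf : DifferentiableOn ℂ f U) (hg : DifferentiableOn ℂ g U) {z : ℂ} (hz : z ∈ U)
    (h : ∀ᶠ w in nhds z, f w = g w) : EqOn f g U :=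
  (hf.analyticOnNhd hU).eqOn_of_preconnected_of_eventuallyEq (hg.analyticOnNhd hU) hc hz h

/-- two lifts that agree at a point where `f` is noncritical agree near that point. -/
theorem lifts_eventuallyEq {f φ χ : ℂ → ℂ} (hf : Differentiable ℂ f) {z : ℂ} (h1 : ContinuousAt φ z)
    (h2 : ContinuousAt χ z) (heq : φ z = χ z) (hd : deriv f (φ z) ≠ 0)
    (hl : ∀ᶠ w in nhds z, f (φ w) = f (χ w)) : ∀ᶠ w in nhds z, φ w = χ w := by
  obtain ⟨r, hr, -, hi⟩ := exists_injOn_ball (hf.analyticAt _) hd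
  have e1 := h1.eventually (ball_mem_nhds _ hr)
  have e2 := h2.eventually (heq ▸ ball_mem_nhds (φ z) hr)
  filter_upwards [hl, e1, e2] with w a b c
  exact hi b (by rw [heq]; exact c) a

theorem lift_ext_pt {f Ψ φ : ℂ → ℂ} (hf : Differentiable ℂ f) (hnc : ∀ z, ¬ ∀ᶠ w in nhds z, f w = f z)
    (hΨ : DifferentiableOn ℂ Ψ (ball 0 1)) {R : ℝ} (hR : 0 < R) (hR1 : R < 1)
    (hφ : DifferentiableOn ℂ φ (ball 0 R)) (hl : ∀ z ∈ ball (0:ℂ) R, f (φ z) = Ψ z) {ζ : ℂ} (hζ : ‖ζ‖ = R)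
    (hasy : ¬ AsymptoticValue f (Ψ ζ)) (hcr : ∀ c, f c = Ψ ζ → deriv f c ≠ 0) :
    ∃ δ > 0, ∃ χ, DifferentiableOn ℂ χ (ball ζ δ) ∧ (∀ z ∈ ball ζ δ, f (χ z) = Ψ z) ∧
      ∀ z ∈ ball ζ δ, z ∈ ball (0:ℂ) R → χ z = φ z := by
  have hζ1 : ζ ∈ ball (0:ℂ) 1 := by rw [mem_ball_zero_iff, hζ]; exact hR1
  have hin : ∀ t ∈ Ico (0:ℝ) 1, (t:ℂ) * ζ ∈ ball (0:ℂ) R := by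
    intro t ht
    rw [mem_ball_zero_iff, norm_mul, hζ, Complex.norm_real, Real.norm_of_nonneg ht.1]
    nlinarith [ht.2]
  have hΨc : ContinuousAt Ψ ζ := (hΨ.differentiableAt (isOpen_ball.mem_nhds hζ1)).continuousAt
  have htl : Tendsto (fun t : ℝ => (t:ℂ) * ζ) (nhdsWithin 1 (Iio 1)) (nhds ζ) := by
    have : Continuous (fun t : ℝ => (t:ℂ) * ζ) := by fun_prop
    have := this.tendsto 1
    simp only [Complex.ofReal_one, one_mul] at this
    exact this.mono_left nhdsWithin_le_nhds
  have hI : Ico (0:ℝ) 1 ∈ nhdsWithin (1:ℝ) (Iio 1) := mem_of_superset (Ioo_mem_nhdsLT (zero_lt_one' ℝ)) Ioo_subset_Ico_self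
  obtain ⟨q, hq, hql⟩ := curve_lemma hf hnc (σ := fun t => φ (t * ζ))
    (hφ.continuousOn.comp (by fun_prop) hin) hasy
    ((hΨc.tendsto.comp htl).congr' (by
      filter_upwards [hI] with t ht
      exact (hl _ (hin t ht)).symm))
  obtain ⟨r, hr, hrd, hri⟩ := exists_injOn_ball (hf.analyticAt _) (hcr q hq)
  obtain ⟨hop, g, hg, hgl, -⟩ := exists_inverse isOpen_ball hrd hri
  have hmem : ∀ᶠ z in nhds ζ, Ψ z ∈ f '' ball q r ∧ z ∈ ball (0:ℂ) 1 :=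
    (hΨc.eventually (hop.mem_nhds ⟨q, mem_ball_self hr, hq⟩)).and (isOpen_ball.mem_nhds hζ1)
  obtain ⟨δ, hδ, hδ'⟩ := Metric.eventually_nhds_iff_ball.1 hmem
  have hχd : DifferentiableOn ℂ (fun z => g (Ψ z)) (ball ζ δ) :=
    hg.comp (hΨ.mono fun z hz => (hδ' z hz).2) (fun z hz => (hδ' z hz).1)
  refine ⟨δ, hδ, fun z => g (Ψ z), hχd, ?_, ?_⟩
  · intro z hz
    obtain ⟨u, hu, hu'⟩ := (hδ' z hz).1
    simp only
    rw [← hu', hgl u hu]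
  · intro z hz hzR
    obtain ⟨t, ht1, ht2, ht3⟩ := ((hql.eventually (ball_mem_nhds q hr)).and ((eventually_mem_set.2 hI).and (htl.eventually (ball_mem_nhds ζ hδ)))).exists
    have hp : (t:ℂ) * ζ ∈ ball ζ δ ∩ ball 0 R := ⟨ht3, hin t ht2⟩
    have hφc : ContinuousAt φ (t * ζ) := (hφ.differentiableAt (isOpen_ball.mem_nhds hp.2)).continuousAt
    refine ident (isOpen_ball.inter isOpen_ball) ((convex_ball ζ δ).inter (convex_ball 0 R)).isPreconnected
      (hχd.mono inter_subset_left) (hφ.mono inter_subset_right) hp ?_ ⟨hz, hzR⟩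
    filter_upwards [hφc.eventually (isOpen_ball.mem_nhds ht1), isOpen_ball.mem_nhds hp.2] with w hw hw2
    rw [← hl w hw2, hgl _ hw]

theorem lift_ext {f Ψ φ : ℂ → ℂ} (hf : Differentiable ℂ f) (hnc : ∀ z, ¬ ∀ᶠ w in nhds z, f w = f z)
    (hΨ : DifferentiableOn ℂ Ψ (ball 0 1)) {R : ℝ} (hR : 0 < R) (hR1 : R < 1)
    (hφ : DifferentiableOn ℂ φ (ball 0 R)) (hl : ∀ z ∈ ball (0:ℂ) R, f (φ z) = Ψ z)
    (hasy : ∀ ζ ∈ ball (0:ℂ) 1, ¬ AsymptoticValue f (Ψ ζ))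
    (hcr : ∀ ζ ∈ ball (0:ℂ) 1, ζ ≠ 0 → ∀ c, f c = Ψ ζ → deriv f c ≠ 0) :
    ∃ R', R < R' ∧ R' ≤ 1 ∧ ∃ χ, DifferentiableOn ℂ χ (ball 0 R') ∧ (∀ z ∈ ball (0:ℂ) R', f (χ z) = Ψ z) ∧
      ∀ z ∈ ball (0:ℂ) R, χ z = φ z := by
  classical
  have hs1 : ∀ ζ ∈ sphere (0:ℂ) R, ζ ∈ ball (0:ℂ) 1 ∧ ζ ≠ 0 ∧ ‖ζ‖ = R := by
    intro ζ hζ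
    have : ‖ζ‖ = R := by simpa using hζ
    refine ⟨by simpa [this] using hR1, ?_, this⟩
    rintro rfl; simp at this; linarith
  have h1 : ∀ ζ ∈ sphere (0:ℂ) R, _ := fun ζ hζ =>
    lift_ext_pt hf hnc hΨ hR hR1 hφ hl (hs1 ζ hζ).2.2 (hasy ζ (hs1 ζ hζ).1)
      (hcr ζ (hs1 ζ hζ).1 (hs1 ζ hζ).2.1)
  choose! D hD X hX using h1
  obtain ⟨δ, hδ, hδ'⟩ := lebesgue_number_lemma_of_metric (isCompact_sphere (0:ℂ) R)
    (c := fun ζ : sphere (0:ℂ) R => ball (ζ:ℂ) (D ζ)) (fun _ => isOpen_ball)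
    (fun ζ hζ => mem_iUnion.2 ⟨⟨ζ, hζ⟩, mem_ball_self (hD ζ hζ)⟩)
  have h2 : ∀ ζ ∈ sphere (0:ℂ) R, ∃ χ, DifferentiableOn ℂ χ (ball ζ δ) ∧ (∀ z ∈ ball ζ δ, f (χ z) = Ψ z) ∧
      ∀ z ∈ ball ζ δ, z ∈ ball (0:ℂ) R → χ z = φ z := by
    intro ζ hζ
    obtain ⟨⟨i, hi⟩, hs⟩ := hδ' ζ hζ
    obtain ⟨a, b, c⟩ := hX i hi
    exact ⟨X i, a.mono hs, fun z hz => b z (hs hz), fun z hz => c z (hs hz)⟩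
  choose! Y hY using h2
  clear hX hδ' hD
  set P : ℂ → ℂ := fun z => ((R / ‖z‖ : ℝ) : ℂ) * z with hP
  have hPs : ∀ z, z ≠ 0 → P z ∈ sphere (0:ℂ) R := by
    intro z hz
    have : 0 < ‖z‖ := norm_pos_iff.2 hz
    simp only [hP, mem_sphere_zero_iff_norm, norm_mul, Complex.norm_real, norm_div, norm_norm, Real.norm_of_nonneg hR.le]
    field_simp
  have hPd : ∀ z, R ≤ ‖z‖ → ‖z - P z‖ = ‖z‖ - R := by
    intro z hz
    have h0 : 0 < ‖z‖ := by linarith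
    have : z - P z = (((‖z‖ - R)/‖z‖ : ℝ) : ℂ) * z := by
      simp only [hP]; push_cast
      have : (‖z‖ : ℂ) ≠ 0 := by exact_mod_cast h0.ne'
      field_simp
    rw [this, norm_mul, Complex.norm_real, Real.norm_of_nonneg (by apply div_nonneg <;> linarith)]
    field_simp
  set χ : ℂ → ℂ := fun z => if ‖z‖ < R then φ z else Y (P z) z with hχ
  have hχ1 : ∀ z, ‖z‖ < R → χ z = φ z := fun z hz => by simp [hχ, hz]
  have hχ2 : ∀ z, R ≤ ‖z‖ → χ z = Y (P z) z := fun z hz => by simp [hχ, hz.not_gt]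
  refine ⟨min (R + δ/2) 1, lt_min (by linarith) hR1, min_le_right _ _, χ, ?_, ?_, fun z hz => hχ1 z (by simpa using hz)⟩
  · intro z hz
    have hzz : ‖z‖ < R + δ / 2 := lt_of_lt_of_le (by simpa using hz) (min_le_left _ _)
    by_cases hzR : ‖z‖ < R
    · have hm : z ∈ ball (0:ℂ) R := by simpa using hzR
      refine (((hφ.differentiableAt (isOpen_ball.mem_nhds hm)).congr_of_eventuallyEq ?_)).differentiableWithinAt
      filter_upwards [isOpen_ball.mem_nhds hm] with w hw using hχ1 w (by simpa using hw)
    · push Not at hzR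
      have hz0 : z ≠ 0 := by rintro rfl; simp at hzR; linarith
      have hζ := hPs z hz0
      set ζ := P z with hζdef
      have hzζ : ‖z - ζ‖ < δ / 2 := by rw [hPd z hzR]; linarith
      have hzm : z ∈ ball ζ δ := by rw [mem_ball, dist_eq_norm]; linarith
      refine ((((hY ζ hζ).1.differentiableAt (isOpen_ball.mem_nhds hzm)).congr_of_eventuallyEq ?_)).differentiableWithinAt
      have hη : 0 < (δ/2 - ‖z - ζ‖) / 4 := by linarith
      filter_upwards [ball_mem_nhds z hη] with w hw
      have hw' : ‖w - z‖ < (δ/2 - ‖z - ζ‖) / 4 := by simpa [dist_eq_norm] using hw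
      have hwζ : ‖w - ζ‖ ≤ ‖w - z‖ + ‖z - ζ‖ := by
        have := norm_add_le (w - z) (z - ζ); simpa using this
      have hwm : w ∈ ball ζ δ := by rw [mem_ball, dist_eq_norm]; linarith [norm_nonneg (z - ζ)]
      by_cases hwR : ‖w‖ < R
      · rw [hχ1 w hwR, (hY ζ hζ).2.2 w hwm (by simpa using hwR)]
      · push Not at hwR
        rw [hχ2 w hwR]
        have hw0 : w ≠ 0 := by rintro rfl; simp at hwR; linarith
        have hω := hPs w hw0
        set ω := P w with hωdef
        have hwω : ‖w - ω‖ ≤ ‖w - z‖ + ‖z - ζ‖ := by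
          rw [hPd w hwR, hPd z hzR]
          have := norm_sub_norm_le w z; linarith
        have hwω' : w ∈ ball ω δ := by rw [mem_ball, dist_eq_norm]; linarith [norm_nonneg (z - ζ)]
        have hζω : ‖ζ - ω‖ < δ := by
          have := norm_add_le (ζ - w) (w - ω)
          rw [norm_sub_rev ζ w] at this
          simp only [sub_add_sub_cancel] at this
          linarith [norm_nonneg (z - ζ)]
        -- a point s ζ in all three balls
        have hev : ∀ᶠ s : ℝ in nhdsWithin 1 (Iio 1), (s:ℂ) * ζ ∈ ball ζ δ ∩ ball ω δ ∧ s ∈ Ioo (0:ℝ) 1 := by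
          have hc : Continuous (fun t : ℝ => (t:ℂ) * ζ) := by fun_prop
          have := hc.tendsto 1
          simp only [Complex.ofReal_one, one_mul] at this
          refine ((this.mono_left nhdsWithin_le_nhds).eventually ((isOpen_ball.inter isOpen_ball).mem_nhds
            ⟨mem_ball_self hδ, by rw [mem_ball, dist_eq_norm]; exact hζω⟩)).and (Ioo_mem_nhdsLT one_pos)
        obtain ⟨s, hs, hs'⟩ := hev.exists
        have hsR : (s:ℂ) * ζ ∈ ball (0:ℂ) R := by
          rw [mem_ball_zero_iff, norm_mul, (hs1 ζ hζ).2.2, Complex.norm_real, Real.norm_of_nonneg hs'.1.le]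
          nlinarith [hs'.2]
        refine ident (isOpen_ball.inter isOpen_ball) ((convex_ball ζ δ).inter (convex_ball ω δ)).isPreconnected
          ((hY ω hω).1.mono inter_subset_right) ((hY ζ hζ).1.mono inter_subset_left) hs ?_ ⟨hwm, hwω'⟩
        filter_upwards [(isOpen_ball.inter isOpen_ball).mem_nhds hs, isOpen_ball.mem_nhds hsR] with x hx hx'
        rw [(hY ω hω).2.2 x hx.2 hx', (hY ζ hζ).2.2 x hx.1 hx']
  · intro z hz
    have hzz : ‖z‖ < R + δ / 2 := lt_of_lt_of_le (by simpa using hz) (min_le_left _ _)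
    by_cases hzR : ‖z‖ < R
    · rw [hχ1 z hzR]; exact hl z (by simpa using hzR)
    · push Not at hzR
      rw [hχ2 z hzR]
      have hz0 : z ≠ 0 := by rintro rfl; simp at hzR; linarith
      apply (hY _ (hPs z hz0)).2.1
      rw [mem_ball, dist_eq_norm, hPd z hzR]; linarith

/-- Lift lemma on the unit disc. -/
theorem lift_disc {f Ψ φ₀ : ℂ → ℂ} (hf : Differentiable ℂ f) (hnc : ∀ z, ¬ ∀ᶠ w in nhds z, f w = f z)
    (hΨ : DifferentiableOn ℂ Ψ (ball 0 1)) {r : ℝ} (hr : 0 < r) (hr1 : r ≤ 1)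
    (hφ : DifferentiableOn ℂ φ₀ (ball 0 r)) (hl : ∀ z ∈ ball (0:ℂ) r, f (φ₀ z) = Ψ z)
    (hasy : ∀ ζ ∈ ball (0:ℂ) 1, ¬ AsymptoticValue f (Ψ ζ))
    (hcr : ∀ ζ ∈ ball (0:ℂ) 1, ζ ≠ 0 → ∀ c, f c = Ψ ζ → deriv f c ≠ 0) :
    ∃ φ, DifferentiableOn ℂ φ (ball 0 1) ∧ (∀ z ∈ ball (0:ℂ) 1, f (φ z) = Ψ z) ∧
      ∀ z ∈ ball (0:ℂ) r, φ z = φ₀ z := by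
  set S : Set ℝ := {R | r ≤ R ∧ R ≤ 1 ∧ ∃ φ, DifferentiableOn ℂ φ (ball 0 R) ∧ (∀ z ∈ ball (0:ℂ) R, f (φ z) = Ψ z) ∧
      ∀ z ∈ ball (0:ℂ) r, φ z = φ₀ z} with hS
  have hrS : r ∈ S := ⟨le_rfl, hr1, φ₀, hφ, hl, fun _ _ => rfl⟩
  have hbd : BddAbove S := ⟨1, fun R hR => hR.2.1⟩
  set s := sSup S with hs
  have hrs : r ≤ s := le_csSup hbd hrS
  have hs1 : s ≤ 1 := csSup_le ⟨r, hrS⟩ (fun R hR => hR.2.1)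
  have h1 : ∀ R ∈ S, ∃ φ, DifferentiableOn ℂ φ (ball 0 R) ∧ (∀ z ∈ ball (0:ℂ) R, f (φ z) = Ψ z) ∧
      ∀ z ∈ ball (0:ℂ) r, φ z = φ₀ z := fun R hR => hR.2.2
  choose! G hG using h1
  have hcons : ∀ R ∈ S, ∀ R' ∈ S, R ≤ R' → EqOn (G R') (G R) (ball 0 R) := by
    intro R hR R' hR' hle
    refine ident isOpen_ball (convex_ball _ _).isPreconnected ((hG R' hR').1.mono (ball_subset_ball hle)) (hG R hR).1
      (mem_ball_self (lt_of_lt_of_le hr hR.1)) ?_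
    filter_upwards [ball_mem_nhds (0:ℂ) hr] with w hw
    rw [(hG R hR).2.2 w hw, (hG R' hR').2.2 w hw]
  have h2 : ∀ z ∈ ball (0:ℂ) s, ∃ R ∈ S, ‖z‖ < R := by
    intro z hz
    obtain ⟨R, hR, h⟩ := exists_lt_of_lt_csSup ⟨r, hrS⟩ (show ‖z‖ < sSup S by simpa [hs] using hz)
    exact ⟨R, hR, h⟩
  choose! ρ hρ using h2
  have hkey : ∀ R ∈ S, ∀ z, ‖z‖ < R → G (ρ z) z = G R z := by
    intro R hR z hz
    have hzs : z ∈ ball (0:ℂ) s := by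
      rw [mem_ball_zero_iff]; exact lt_of_lt_of_le hz (le_csSup hbd hR)
    obtain ⟨a, b⟩ := hρ z hzs
    rcases le_total (ρ z) R with h | h
    · exact (hcons _ a _ hR h (by simpa using b)).symm
    · exact hcons _ hR _ a h (by simpa using hz)
  have hsS : s ∈ S := by
    refine ⟨hrs, hs1, fun z => G (ρ z) z, ?_, ?_, ?_⟩
    · intro z hz
      obtain ⟨a, b⟩ := hρ z hz
      have hm : z ∈ ball (0:ℂ) (ρ z) := by simpa using b
      refine (((hG _ a).1.differentiableAt (isOpen_ball.mem_nhds hm)).congr_of_eventuallyEq ?_).differentiableWithinAt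
      filter_upwards [isOpen_ball.mem_nhds hm] with w hw
      exact hkey _ a w (by simpa using hw)
    · intro z hz
      obtain ⟨a, b⟩ := hρ z hz
      exact (hG _ a).2.1 z (by simpa using b)
    · intro z hz
      simp only
      rw [hkey r hrS z (by simpa using hz)]
      exact (hG r hrS).2.2 z hz
  rcases hs1.lt_or_eq with hlt | heq
  · obtain ⟨φ, a, b, c⟩ := hsS.2.2
    obtain ⟨R', h1, h2, χ, h3, h4, h5⟩ := lift_ext hf hnc hΨ (lt_of_lt_of_le hr hrs) hlt a b hasy hcr
    have : R' ∈ S := ⟨hrs.trans h1.le, h2, χ, h3, h4, fun z hz => by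
      rw [h5 z (ball_subset_ball hrs hz), c z hz]⟩
    exact absurd (le_csSup hbd this) (not_le.2 h1)
  · rw [heq] at hsS
    exact hsS.2.2


theorem contains_of_proper {F Φ Q : ℂ → ℂ} {D : ℕ} (hF : Continuous F) {y : ℂ} {R : ℝ} (hR : 0 < R)
    (hΦ : DifferentiableOn ℂ Φ (ball 0 1)) (hi : InjOn Φ (ball 0 1)) (hQ : BL D Q)
    (hcomm : ∀ ζ ∈ ball (0:ℂ) 1, F (Φ ζ) = y + R * Q ζ) {A : Set ℂ} (hA : IsPreconnected A)
    (hAo : ∀ z ∈ A, F z ∈ ball y R) (hne : ∃ ζ ∈ ball (0:ℂ) 1, Φ ζ ∈ A) : A ⊆ Φ '' ball 0 1 := by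
  obtain ⟨hop, -⟩ := exists_inverse isOpen_ball hΦ hi
  have hcl : ∀ x ∈ A, x ∉ Φ '' ball 0 1 → x ∈ (closure (Φ '' ball 0 1))ᶜ := by
    intro x hx hxn hxc
    apply hxn
    have hFx := hAo x hx
    rw [mem_ball, dist_eq_norm] at hFx
    obtain ⟨K, hK1, hK2⟩ := exists_between hFx
    obtain ⟨t, ht, ht'⟩ := hQ.proper (K := K / R) (by rwa [div_lt_one hR])
    have hsub : {z | ‖F z - y‖ < K} ∩ Φ '' ball 0 1 ⊆ Φ '' closedBall 0 t := by
      rintro _ ⟨h1, ζ, hζ, rfl⟩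
      refine ⟨ζ, ?_, rfl⟩
      rw [mem_closedBall_zero_iff]
      apply ht' ζ hζ
      have h1' : ‖F (Φ ζ) - y‖ < K := h1
      rw [hcomm ζ hζ, add_sub_cancel_left, norm_mul, Complex.norm_real, Real.norm_of_nonneg hR.le] at h1'
      rw [le_div_iff₀ hR]; linarith
    have hcb : closedBall (0:ℂ) t ⊆ ball 0 1 := closedBall_subset_ball ht
    have hcpt : IsClosed (Φ '' closedBall 0 t) :=
      ((isCompact_closedBall _ _).image_of_continuousOn (hΦ.continuousOn.mono hcb)).isClosed
    have hopen : IsOpen {z | ‖F z - y‖ < K} := isOpen_lt (by fun_prop) continuous_const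
    have h3 : x ∈ closure ({z | ‖F z - y‖ < K} ∩ Φ '' ball 0 1) :=
      hopen.inter_closure ⟨hK1, hxc⟩
    exact image_mono hcb ((hcpt.closure_subset_iff.2 hsub) h3)
  refine hA.subset_left_of_subset_union (v := (closure (Φ '' ball 0 1))ᶜ) hop isClosed_closure.isOpen_compl ?_ ?_ ?_
  · exact disjoint_left.2 fun z hz hz' => hz' (subset_closure hz)
  · intro x hx
    by_cases h : x ∈ Φ '' ball 0 1
    · exact Or.inl h
    · exact Or.inr (hcl x hx h)
  · obtain ⟨ζ, h1, h2⟩ := hne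
    exact ⟨Φ ζ, h2, ζ, h1, rfl⟩

def LF (f : ℂ → ℂ) (c : ℂ) (m : ℕ) : Prop := 1 ≤ m ∧ ∃ ψ : ℂ → ℂ, AnalyticAt ℂ ψ c ∧ ψ c = 0 ∧ deriv ψ c ≠ 0 ∧
  ∀ᶠ z in nhds c, f z = f c + ψ z ^ m

open Classical in
noncomputable def mlt (f : ℂ → ℂ) (c : ℂ) : ℕ := if deriv f c ≠ 0 then 1 else
  if h : ∃ m, LF f c m then h.choose else 1

theorem mlt_spec {f : ℂ → ℂ} (hf : Differentiable ℂ f) (hnc : ∀ z, ¬ ∀ᶠ w in nhds z, f w = f z) (c : ℂ) :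
    LF f c (mlt f c) := by
  classical
  unfold mlt
  split_ifs with h1 h2
  · exact ⟨le_rfl, fun z => f z - f c, (hf.analyticAt c).sub analyticAt_const, by simp, by simpa using h1,
      Eventually.of_forall fun z => by simp⟩
  · exact h2.choose_spec
  · exact absurd (local_form (hf.analyticAt c) (hnc c)) h2

theorem mlt_one {f : ℂ → ℂ} {c : ℂ} (h : deriv f c ≠ 0) : mlt f c = 1 := by simp [mlt, h]

theorem germ_root {f Φ : ℂ → ℂ} {c : ℂ} {m : ℕ} (hlf : LF f c m) (hΦ : DifferentiableOn ℂ Φ (ball 0 1))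
    (hi : InjOn Φ (ball 0 1)) (h0 : Φ 0 = f c) : ∃ r > 0, r ≤ 1 ∧ ∃ φ, DifferentiableOn ℂ φ (ball 0 r) ∧
      InjOn φ (ball 0 r) ∧ φ 0 = c ∧ ∀ ζ ∈ ball (0:ℂ) r, f (φ ζ) = Φ (ζ ^ m) := by
  obtain ⟨hm, ψ, hψ, hψ0, hψd, hev⟩ := hlf
  have hm0 : m ≠ 0 := by omega
  have hmem0 : (0:ℂ) ∈ ball (0:ℂ) 1 := mem_ball_self one_pos
  have hk : DifferentiableOn ℂ (dslope Φ 0) (ball 0 1) :=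
    (Complex.differentiableOn_dslope (isOpen_ball.mem_nhds hmem0)).2 hΦ
  have hk0 : ∀ z ∈ ball (0:ℂ) 1, dslope Φ 0 z ≠ 0 := by
    intro z hz
    by_cases h : z = 0
    · rw [h, dslope_same]; exact deriv_ne_zero_of_injOn isOpen_ball hΦ hi hmem0
    · rw [dslope_of_ne _ h, slope_def_field]
      exact div_ne_zero (sub_ne_zero.2 fun h' => h (hi hz hmem0 h')) (by simpa using h)
  obtain ⟨L, hL, -, hLe⟩ := exists_log_ball one_pos hk hk0
  have hΦL : ∀ z ∈ ball (0:ℂ) 1, Φ z = f c + z * Complex.exp (L z) := by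
    intro z hz
    rw [hLe z hz, ← h0]
    have := sub_smul_dslope Φ 0 z
    simp only [sub_zero, smul_eq_mul] at this
    rw [this]; ring
  have hpw : ∀ z ∈ ball (0:ℂ) 1, z ^ m ∈ ball (0:ℂ) 1 := fun z hz => (BL.pow hm).1 hz
  set η : ℂ → ℂ := fun ζ => ζ * Complex.exp (L (ζ ^ m) / m) with hη
  have hηd : DifferentiableOn ℂ η (ball 0 1) := by
    refine differentiableOn_id.mul (DifferentiableOn.cexp (DifferentiableOn.div_const (hL.comp (by fun_prop) hpw) _))
  have hηm : ∀ z ∈ ball (0:ℂ) 1, f c + η z ^ m = Φ (z ^ m) := by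
    intro z hz
    rw [hΦL _ (hpw z hz)]
    simp only [hη]
    rw [mul_pow, ← Complex.exp_nat_mul]
    congr 3
    field_simp
  have hη0 : η 0 = 0 := by simp [hη]
  have hηa : AnalyticAt ℂ η 0 := hηd.analyticAt (isOpen_ball.mem_nhds hmem0)
  have hη' : deriv η 0 ≠ 0 := by
    have hd : DifferentiableAt ℂ (fun ζ => Complex.exp (L (ζ ^ m) / m)) 0 := by
      refine DifferentiableAt.cexp (DifferentiableAt.div_const ?_ _)
      exact (hL.comp (s := ball 0 1) (f := fun ζ : ℂ => ζ ^ m) (by fun_prop) hpw).differentiableAt (isOpen_ball.mem_nhds hmem0)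
    have := (hasDerivAt_id (0:ℂ)).fun_mul hd.hasDerivAt
    simp only [id_eq, zero_mul, add_zero, one_mul] at this
    rw [hη, this.deriv]
    exact Complex.exp_ne_zero _
  obtain ⟨r1, hr1, hd1, hi1⟩ := exists_injOn_ball hηa hη'
  obtain ⟨r2, hr2, hd2, hi2⟩ := exists_injOn_ball hψ hψd
  obtain ⟨r3, hr3, hr3'⟩ := Metric.eventually_nhds_iff_ball.1 hev
  set r4 := min r2 r3 with hr4
  have hr40 : 0 < r4 := by positivity
  have hs2 : ball c r4 ⊆ ball c r2 := ball_subset_ball (min_le_left _ _)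
  have hs3 : ball c r4 ⊆ ball c r3 := ball_subset_ball (min_le_right _ _)
  obtain ⟨hop, g, hg, hgl, -⟩ := exists_inverse isOpen_ball (hd2.mono hs2) (hi2.mono hs2)
  have hmm : ∀ᶠ z in nhds (0:ℂ), η z ∈ ψ '' ball c r4 :=
    hηa.continuousAt.eventually (hop.mem_nhds ⟨c, mem_ball_self hr40, by rw [hψ0, hη0]⟩)
  obtain ⟨r5, hr5, hr5'⟩ := Metric.eventually_nhds_iff_ball.1 hmm
  have hb1 : ball (0:ℂ) (min (min r1 r5) 1) ⊆ ball 0 r1 := ball_subset_ball (by simp)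
  have hb5 : ball (0:ℂ) (min (min r1 r5) 1) ⊆ ball 0 r5 := ball_subset_ball (by simp)
  have hb : ball (0:ℂ) (min (min r1 r5) 1) ⊆ ball 0 1 := ball_subset_ball (by simp)
  have hψg : ∀ z ∈ ball (0:ℂ) r5, ψ (g (η z)) = η z ∧ g (η z) ∈ ball c r4 := by
    intro z hz
    obtain ⟨u, hu, hu'⟩ := hr5' z hz
    rw [← hu', hgl u hu]; exact ⟨rfl, hu⟩
  refine ⟨min (min r1 r5) 1, by positivity, min_le_right _ _, fun z => g (η z), ?_, ?_, ?_, ?_⟩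
  · exact hg.comp (hd1.mono hb1) (fun z hz => hr5' z (hb5 hz))
  · intro z hz w hw h
    apply hi1 (hb1 hz) (hb1 hw)
    rw [← (hψg z (hb5 hz)).1, ← (hψg w (hb5 hw)).1]
    simp only at h
    rw [h]
  · simp only [hη0]
    rw [← hψ0, hgl c (mem_ball_self hr40)]
  · intro z hz
    have h1 := hψg z (hb5 hz)
    simp only
    rw [hr3' _ (hs3 h1.2), h1.1, hηm z (hb hz)]

theorem one_step {f Φ : ℂ → ℂ} {c : ℂ} (hf : Differentiable ℂ f) (hnc : ∀ z, ¬ ∀ᶠ w in nhds z, f w = f z)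
    (hΦ : DifferentiableOn ℂ Φ (ball 0 1))
    (hi : InjOn Φ (ball 0 1)) (h0 : Φ 0 = f c) (hasy : ∀ ζ ∈ ball (0:ℂ) 1, ¬ AsymptoticValue f (Φ ζ))
    (hcr : ∀ ζ ∈ ball (0:ℂ) 1, ζ ≠ 0 → ∀ c, f c = Φ ζ → deriv f c ≠ 0) :
    ∃ Φ2, DifferentiableOn ℂ Φ2 (ball 0 1) ∧ InjOn Φ2 (ball 0 1) ∧ Φ2 0 = c ∧
      ∀ ζ ∈ ball (0:ℂ) 1, f (Φ2 ζ) = Φ (ζ ^ mlt f c) := by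
  have hlf := mlt_spec hf hnc c
  set m := mlt f c
  have hm := hlf.1
  have hm0 : m ≠ 0 := by omega
  obtain ⟨r, hr, hr1, φ, hφ, hφi, hφ0, hφl⟩ := germ_root hlf hΦ hi h0
  have hpw : ∀ z ∈ ball (0:ℂ) 1, z ^ m ∈ ball (0:ℂ) 1 := fun z hz => (BL.pow hm).1 hz
  obtain ⟨Φ2, h1, h2, h3⟩ := lift_disc hf hnc (Ψ := fun ζ => Φ (ζ ^ m)) (hΦ.comp (by fun_prop) hpw) hr hr1 hφ hφl
    (fun ζ hζ => hasy _ (hpw ζ hζ)) (fun ζ hζ hne => hcr _ (hpw ζ hζ) (pow_ne_zero _ hne))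
  refine ⟨Φ2, h1, ?_, by rw [h3 0 (mem_ball_self hr), hφ0], h2⟩
  intro z hz w hw heq
  have hzw : z ^ m = w ^ m := by
    apply hi (hpw z hz) (hpw w hw)
    have e1 := h2 z hz
    have e2 := h2 w hw
    rw [← e1, ← e2, heq]
  by_cases hz0 : z = 0
  · subst hz0
    rw [zero_pow hm0] at hzw
    exact (pow_eq_zero_iff hm0).1 hzw.symm |>.symm
  set ω := w / z with hω
  have hwz : w = ω * z := by rw [hω]; field_simp
  have hωm : ω ^ m = 1 := by rw [hω, div_pow, ← hzw]; exact div_self (pow_ne_zero _ hz0)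
  have hωn : ‖ω‖ = 1 := by
    have : ‖ω‖ ^ m = 1 := by rw [← norm_pow, hωm, norm_one]
    exact (pow_eq_one_iff_of_nonneg (norm_nonneg _) hm0).1 this
  have hωb : ∀ s : ℝ, ∀ x ∈ ball (0:ℂ) s, ω * x ∈ ball (0:ℂ) s := by
    intro s x hx; rw [mem_ball_zero_iff] at *; rw [norm_mul, hωn, one_mul]; exact hx
  have hd2 : DifferentiableOn ℂ (fun x => Φ2 (ω * x)) (ball 0 1) := h1.comp (by fun_prop) (hωb 1)
  have heq' : Φ2 z = (fun x => Φ2 (ω * x)) z := by simp only; rw [← hwz, heq]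
  have hall : EqOn Φ2 (fun x => Φ2 (ω * x)) (ball 0 1) := by
    refine ident isOpen_ball (convex_ball _ _).isPreconnected h1 hd2 hz ?_
    refine lifts_eventuallyEq hf (h1.differentiableAt (isOpen_ball.mem_nhds hz)).continuousAt
      (hd2.differentiableAt (isOpen_ball.mem_nhds hz)).continuousAt heq'
      (hcr _ (hpw z hz) (pow_ne_zero _ hz0) _ (h2 z hz)) ?_
    filter_upwards [isOpen_ball.mem_nhds hz] with x hx
    have e1 := h2 x hx
    have e2 := h2 (ω * x) (hωb 1 x hx)
    show f (Φ2 x) = f (Φ2 (ω * x))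
    rw [e1, e2, mul_pow, hωm, one_mul]
  have hx : ((r/2 : ℝ) : ℂ) ∈ ball (0:ℂ) r := by
    rw [mem_ball_zero_iff, Complex.norm_real, Real.norm_of_nonneg (by linarith)]; linarith
  have e := hall (ball_subset_ball hr1 hx)
  simp only at e
  rw [h3 _ hx, h3 _ (hωb r _ hx)] at e
  have e2 := hφi hx (hωb r _ hx) e
  have hne : ((r/2 : ℝ) : ℂ) ≠ 0 := by exact_mod_cast (by linarith : (r/2:ℝ) ≠ 0)
  have : ω = 1 := by
    have : (ω - 1) * ((r/2 : ℝ) : ℂ) = 0 := by linear_combination -e2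
    rcases mul_eq_zero.1 this with h | h
    · linear_combination h
    · exact absurd h hne
  rw [hwz, this, one_mul]

theorem path_to {f Φ : ℂ → ℂ} {a ζ1 : ℂ} (hf : Differentiable ℂ f) (hnc : ∀ z, ¬ ∀ᶠ w in nhds z, f w = f z)
    (hΦ : DifferentiableOn ℂ Φ (ball 0 1))
    (hasy : ∀ ζ ∈ ball (0:ℂ) 1, ¬ AsymptoticValue f (Φ ζ))
    (hcr : ∀ ζ ∈ ball (0:ℂ) 1, ζ ≠ 0 → ∀ c, f c = Φ ζ → deriv f c ≠ 0) (hζ1 : ζ1 ∈ ball (0:ℂ) 1) (h10 : ζ1 ≠ 0)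
    (ha : f a = Φ ζ1) :
    ∃ c, f c = Φ 0 ∧ ∃ A, IsPreconnected A ∧ a ∈ A ∧ c ∈ A ∧ ∀ z ∈ A, f z ∈ Φ '' ball 0 1 := by
  have hz1 : ‖ζ1‖ < 1 := by simpa using hζ1
  have hz10 : 0 < ‖ζ1‖ := norm_pos_iff.2 h10
  set b : ℝ := 2 * ‖ζ1‖ - 1 with hb
  have hbn : ‖(b:ℂ)‖ < 1 := by rw [Complex.norm_real, Real.norm_eq_abs, abs_lt]; constructor <;> linarith
  set u : ℂ := ζ1 / ‖ζ1‖ with hu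
  have hnz : (‖ζ1‖ : ℂ) ≠ 0 := by exact_mod_cast hz10.ne'
  have hun : ‖u‖ = 1 := by rw [hu, norm_div, Complex.norm_real, norm_norm, div_self hz10.ne']
  set θ : ℂ → ℂ := fun z => u * (1 + mob b z) / 2 with hθ
  have hθ0 : θ 0 = ζ1 := by
    simp only [hθ, mob_zero, hb, hu]; push_cast; field_simp; ring
  have hθd : DifferentiableOn ℂ θ (ball 0 1) := by
    refine DifferentiableOn.div_const (DifferentiableOn.const_mul (DifferentiableOn.const_add _ (differentiableOn_mob hbn)) _) _
  have hθb : ∀ z ∈ ball (0:ℂ) 1, θ z ∈ ball (0:ℂ) 1 ∧ θ z ≠ 0 := by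
    intro z hz
    have h1 := norm_mob_lt hbn (mem_ball_zero_iff.1 hz)
    constructor
    · rw [mem_ball_zero_iff, hθ]
      simp only [norm_div, norm_mul, hun, one_mul]
      have := norm_add_le 1 (mob b z)
      simp at this ⊢
      linarith
    · simp only [hθ]
      apply div_ne_zero _ (by norm_num)
      apply mul_ne_zero
      · intro h; rw [h] at hun; simp at hun
      · intro h
        have : mob b z = -1 := by linear_combination h
        rw [this] at h1; simp at h1
  obtain ⟨r0, hr0, hfd, hfi⟩ := exists_injOn_ball (hf.analyticAt a) (hcr ζ1 hζ1 h10 a ha)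
  obtain ⟨hop, g, hg, hgl, -⟩ := exists_inverse isOpen_ball hfd hfi
  have hΨd : DifferentiableOn ℂ (fun z => Φ (θ z)) (ball 0 1) := hΦ.comp hθd (fun z hz => (hθb z hz).1)
  have hm0 : (0:ℂ) ∈ ball (0:ℂ) 1 := mem_ball_self one_pos
  have hev : ∀ᶠ z in nhds (0:ℂ), Φ (θ z) ∈ f '' ball a r0 := by
    refine (hΨd.differentiableAt (isOpen_ball.mem_nhds hm0)).continuousAt.eventually (hop.mem_nhds ?_)
    exact ⟨a, mem_ball_self hr0, by simp only [ha, hθ0]⟩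
  obtain ⟨r1, hr1, hr1'⟩ := Metric.eventually_nhds_iff_ball.1 hev
  have hs1 : ball (0:ℂ) (min r1 1) ⊆ ball 0 r1 := ball_subset_ball (min_le_left _ _)
  have hs2 : ball (0:ℂ) (min r1 1) ⊆ ball 0 1 := ball_subset_ball (min_le_right _ _)
  obtain ⟨χ, hχd, hχl, hχe⟩ := lift_disc hf hnc (Ψ := fun z => Φ (θ z)) hΨd (r := min r1 1) (by positivity) (min_le_right _ _)
    (φ₀ := fun z => g (Φ (θ z))) (hg.comp (hΨd.mono hs2) (fun z hz => hr1' z (hs1 hz)))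
    (fun z hz => by
      obtain ⟨w, hw, hw'⟩ := hr1' z (hs1 hz)
      rw [← hw', hgl w hw])
    (fun ζ hζ => hasy _ (hθb ζ hζ).1) (fun ζ hζ _ => hcr _ (hθb ζ hζ).1 (hθb ζ hζ).2)
  have hχ0 : χ 0 = a := by
    rw [hχe 0 (mem_ball_self (by positivity))]
    rw [hθ0, ← ha, hgl a (mem_ball_self hr0)]
  have hin : ∀ t ∈ Ico (0:ℝ) 1, -(t:ℂ) ∈ ball (0:ℂ) 1 := by
    intro t ht
    rw [mem_ball_zero_iff, norm_neg, Complex.norm_real, Real.norm_of_nonneg ht.1]; exact ht.2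
  have hσc : ContinuousOn (fun t : ℝ => χ (-t)) (Ico 0 1) := hχd.continuousOn.comp (by fun_prop) hin
  have hI : Ico (0:ℝ) 1 ∈ nhdsWithin (1:ℝ) (Iio 1) := mem_of_superset (Ioo_mem_nhdsLT (zero_lt_one' ℝ)) Ioo_subset_Ico_self
  have hθt : Tendsto (fun t : ℝ => θ (-t)) (nhdsWithin 1 (Iio 1)) (nhds 0) := by
    have : ContinuousAt (fun t : ℝ => θ (-t)) 1 := by
      simp only [hθ, mob]
      have : (1 : ℂ) + (starRingEnd ℂ) (b:ℂ) * -((1:ℝ):ℂ) ≠ 0 := one_add_ne (by simp) hbn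
      fun_prop (disch := assumption)
    have h := this.tendsto
    have e : θ (-((1:ℝ):ℂ)) = 0 := by
      have : (1 : ℂ) + (starRingEnd ℂ) (b:ℂ) * -((1:ℝ):ℂ) ≠ 0 := one_add_ne (by simp) hbn
      have e2 : mob b (-((1:ℝ):ℂ)) = -1 := by
        rw [mob, div_eq_iff this]
        simp
        ring
      simp only [hθ, e2]; ring
    rw [e] at h
    exact h.mono_left nhdsWithin_le_nhds
  obtain ⟨q, hq, hql⟩ := curve_lemma hf hnc hσc (hasy 0 hm0)
    ((((hΦ.differentiableAt (isOpen_ball.mem_nhds hm0)).continuousAt.tendsto.comp hθt)).congr' (by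
      filter_upwards [hI] with t ht
      exact (hχl _ (hin t ht)).symm))
  refine ⟨q, hq, insert q ((fun t : ℝ => χ (-t)) '' Ico 0 1), ?_, ?_, mem_insert _ _, ?_⟩
  · refine (isPreconnected_Ico.image _ hσc).subset_closure (subset_insert _ _) ?_
    apply insert_subset _ subset_closure
    refine mem_closure_of_tendsto hql ?_
    filter_upwards [hI] with t ht using ⟨t, ht, rfl⟩
  · right; exact ⟨0, by simp, by simp [hχ0]⟩
  · rintro z (rfl | ⟨t, ht, rfl⟩)
    · exact ⟨0, hm0, hq.symm⟩
    · exact ⟨_, (hθb _ (hin t ht)).1, (hχl _ (hin t ht)).symm⟩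


def Sm (M ε : ℝ) (A : Set ℂ) : Prop := ∀ a ∈ A, ∀ b ∈ A, ‖a‖ ≤ M → ‖a - b‖ < ε

theorem Sm.mono {M ε : ℝ} {A B : Set ℂ} (h : Sm M ε B) (hAB : A ⊆ B) : Sm M ε A :=
  fun a ha b hb => h a (hAB ha) b (hAB hb)

/-- all times `j < n` are good for the disc. -/
def Gd (f : ℂ → ℂ) (M ε : ℝ) (n : ℕ) (y : ℂ) (r : ℝ) : Prop :=
  ∀ j < n, ∀ A : Set ℂ, IsPreconnected A → (∀ z ∈ A, f^[j] z ∈ ball y r) → Sm M ε A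

theorem Gd.mono {f : ℂ → ℂ} {M ε : ℝ} {n n' : ℕ} {y y' : ℂ} {r r' : ℝ} (h : Gd f M ε n y r) (hn : n' ≤ n)
    (hb : ball y' r' ⊆ ball y r) : Gd f M ε n' y' r' :=
  fun j hj A hA hz => h j (by omega) A hA (fun z hz' => hb (hz z hz'))

structure Lf (f : ℂ → ℂ) (n : ℕ) (y : ℂ) (R : ℝ) (D : ℕ) (Φ Q : ℂ → ℂ) : Prop where
  d : DifferentiableOn ℂ Φ (ball 0 1)
  i : InjOn Φ (ball 0 1)
  bl : BL D Q
  comm : ∀ ζ ∈ ball (0:ℂ) 1, f^[n] (Φ ζ) = y + R * Q ζ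

structure Ctx (f : ℂ → ℂ) (z₀ : ℂ) (ρ M ε : ℝ) : Prop where
  hf : Differentiable ℂ f
  hnc : ∀ z, ¬ ∀ᶠ w in nhds z, f w = f z
  fin : {c | deriv f c = 0}.Finite
  hρ : 0 < ρ
  hε : 0 < ε
  hS1 : ∀ s, AsymptoticValue f s → ∀ k, f^[k] s ∈ ball z₀ ρ → f^[k] s = z₀
  hS2 : ∀ s, RecurrentCriticalPoint f s → ∀ k, f^[k] s ∈ ball z₀ ρ → f^[k] s = z₀
  hM : ∀ c, deriv f c = 0 → ‖c‖ ≤ M ∧ ‖f c‖ ≤ M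
  hz : ‖z₀‖ < M
  hκ : ∀ c, deriv f c = 0 → ¬ RecurrentCriticalPoint f c → ∀ k ≥ 1, ε ≤ ‖c - f^[k] c‖
  hv : ∀ c c', deriv f c = 0 → deriv f c' = 0 → f c ≠ f c' → ε ≤ ‖f c - f c'‖
  hcyc : ∀ k, f^[k] z₀ ∈ ball z₀ ρ → f^[k] z₀ = z₀

noncomputable def Ctx.Dm {f : ℂ → ℂ} {z₀ : ℂ} {ρ M ε : ℝ} (h : Ctx f z₀ ρ M ε) : ℕ := ∏ c ∈ h.fin.toFinset, mlt f c

theorem Lf.over {f : ℂ → ℂ} {n : ℕ} {y : ℂ} {R : ℝ} {D : ℕ} {Φ Q : ℂ → ℂ} (h : Lf f n y R D Φ Q) (hR : 0 < R)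
    {ζ : ℂ} (hζ : ζ ∈ ball (0:ℂ) 1) : f^[n] (Φ ζ) ∈ ball y R := by
  rw [h.comm ζ hζ, mem_ball, dist_eq_norm, add_sub_cancel_left, norm_mul, Complex.norm_real, Real.norm_of_nonneg hR.le]
  have : ‖Q ζ‖ < 1 := by simpa using h.bl.1 hζ
  nlinarith

theorem Lf.contains {f : ℂ → ℂ} {n : ℕ} {y : ℂ} {R : ℝ} {D : ℕ} {Φ Q : ℂ → ℂ} (h : Lf f n y R D Φ Q)
    (hf : Differentiable ℂ f) (hR : 0 < R) {A : Set ℂ} (hA : IsPreconnected A) (hA1 : ∀ z ∈ A, f^[n] z ∈ ball y R)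
    (hne : ∃ ζ ∈ ball (0:ℂ) 1, Φ ζ ∈ A) : A ⊆ Φ '' ball 0 1 :=
  contains_of_proper (hf.continuous.iterate n) hR h.d h.i h.bl h.comm hA hA1 hne

theorem Lf.preconn {f : ℂ → ℂ} {n : ℕ} {y : ℂ} {R : ℝ} {D : ℕ} {Φ Q : ℂ → ℂ} (h : Lf f n y R D Φ Q) :
    IsPreconnected (Φ '' ball 0 1) := (convex_ball _ _).isPreconnected.image _ h.d.continuousOn

theorem Lf.recentre {f : ℂ → ℂ} {n : ℕ} {y : ℂ} {R : ℝ} {D : ℕ} {Φ Q : ℂ → ℂ} (h : Lf f n y R D Φ Q) {b : ℂ}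
    (hb : b ∈ ball (0:ℂ) 1) : Lf f n y R D (fun z => Φ (mob b z)) (fun z => Q (mob b z)) := by
  have hb' : ‖b‖ < 1 := by simpa using hb
  have hm := (BL.mob hb').1
  refine ⟨h.d.comp (differentiableOn_mob hb') hm, h.i.comp (mob_injOn hb') hm, ?_, fun ζ hζ => h.comm _ (hm hζ)⟩
  simpa using h.bl.comp (BL.mob hb')

theorem struct_aux {f : ℂ → ℂ} {z₀ : ℂ} {ρ M ε : ℝ} (H : Ctx f z₀ ρ M ε) {y : ℂ} {R : ℝ} (hR : 0 < R)
    (hb : ball y R ⊆ ball z₀ ρ \ {z₀}) {N : ℕ} (hG : Gd f M ε N y R) :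
    ∀ n ≤ N, ∀ a, f^[n] a ∈ ball y R → ∃ Φ Q : ℂ → ℂ, ∃ U : Finset ℂ, U ⊆ H.fin.toFinset ∧
      Lf f n y R (∏ c ∈ U, mlt f c) Φ Q ∧ Φ 0 = a ∧ ∀ c ∈ U, ∃ k j : ℕ, ∃ A : Set ℂ, k + j = n ∧ IsPreconnected A ∧
        (∀ z ∈ A, f^[j] z ∈ ball y R) ∧ c ∈ A ∧ ∀ ζ ∈ ball (0:ℂ) 1, f^[k] (Φ ζ) ∈ A := by
  classical
  intro n
  induction n with
  | zero =>
    intro _ a ha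
    have hRc : (R:ℂ) ≠ 0 := by exact_mod_cast hR.ne'
    have hL : Lf f 0 y R (∏ c ∈ (∅ : Finset ℂ), mlt f c) (fun ζ => y + R * ζ) (fun ζ => ζ) := by
      refine ⟨by fun_prop, ?_, by simpa using BL.id, fun ζ _ => rfl⟩
      intro z _ w _ h
      simpa [hRc] using h
    have hb1 : (a - y) / R ∈ ball (0:ℂ) 1 := by
      rw [mem_ball_zero_iff, norm_div, Complex.norm_real, Real.norm_of_nonneg hR.le, div_lt_one hR, ← dist_eq_norm]
      exact ha
    refine ⟨_, _, ∅, by simp, hL.recentre hb1, ?_, by simp⟩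
    simp only [mob_zero]
    field_simp
    ring
  | succ n ih =>
    intro hn a ha
    have ha' : f^[n] (f a) ∈ ball y R := by simpa using ha
    obtain ⟨Φ, Q, U, hU, hL, h0, hUA⟩ := ih (by omega) (f a) ha'
    have hSm : Sm M ε (Φ '' ball 0 1) := hG n (by omega) _ hL.preconn (by
      rintro _ ⟨ζ, hζ, rfl⟩; exact hL.over hR hζ)
    have hPst : ∀ ζ ∈ ball (0:ℂ) 1, f^[n] (Φ ζ) ∈ ball z₀ ρ ∧ f^[n] (Φ ζ) ≠ z₀ := fun ζ hζ =>
      ⟨(hb (hL.over hR hζ)).1, fun h => (hb (hL.over hR hζ)).2 (by simpa using h)⟩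
    have hasy : ∀ ζ ∈ ball (0:ℂ) 1, ¬ AsymptoticValue f (Φ ζ) := fun ζ hζ h =>
      (hPst ζ hζ).2 (H.hS1 _ h n (hPst ζ hζ).1)
    have hcen : ∃ ζ0 ∈ ball (0:ℂ) 1, ∀ ζ ∈ ball (0:ℂ) 1, ζ ≠ ζ0 → ∀ c, f c = Φ ζ → deriv f c ≠ 0 := by
      by_cases hex : ∃ ζ ∈ ball (0:ℂ) 1, ∃ c, deriv f c = 0 ∧ f c = Φ ζ
      · obtain ⟨ζ0, hζ0, c0, hc0, hfc0⟩ := hex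
        refine ⟨ζ0, hζ0, fun ζ hζ hne c hc hd => hne ?_⟩
        apply hL.i hζ hζ0
        by_contra hcon
        have h1 := H.hv c c0 hd hc0 (by rwa [hc, hfc0])
        have h2 := hSm (f c) ⟨ζ, hζ, hc.symm⟩ (f c0) ⟨ζ0, hζ0, hfc0.symm⟩ (H.hM c hd).2
        linarith
      · push Not at hex
        exact ⟨0, mem_ball_self one_pos, fun ζ hζ _ c hc hd => hex ζ hζ c hd hc⟩
    obtain ⟨ζ0, hζ0, hcr⟩ := hcen
    have hζ0' : ‖ζ0‖ < 1 := by simpa using hζ0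
    have hL1 := hL.recentre hζ0
    set Φ1 : ℂ → ℂ := fun z => Φ (mob ζ0 z) with hΦ1
    have hmb : ∀ z ∈ ball (0:ℂ) 1, mob ζ0 z ∈ ball (0:ℂ) 1 := (BL.mob hζ0').1
    have hasy1 : ∀ ζ ∈ ball (0:ℂ) 1, ¬ AsymptoticValue f (Φ1 ζ) := fun ζ hζ => hasy _ (hmb ζ hζ)
    have hcr1 : ∀ ζ ∈ ball (0:ℂ) 1, ζ ≠ 0 → ∀ c, f c = Φ1 ζ → deriv f c ≠ 0 := by
      intro ζ hζ hne
      refine hcr _ (hmb ζ hζ) (fun h => hne ?_)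
      apply mob_injOn hζ0' hζ (mem_ball_self one_pos)
      rw [h, mob_zero]
    have hζ1 : mob (-ζ0) 0 ∈ ball (0:ℂ) 1 := by rw [mob_zero]; simpa using hζ0'
    have hfa : f a = Φ1 (mob (-ζ0) 0) := by
      simp only [hΦ1]; rw [mob_mob_neg hζ0' (by simp), h0]
    have hc : ∃ c, f c = Φ1 0 ∧ ∃ A, IsPreconnected A ∧ a ∈ A ∧ c ∈ A ∧ ∀ z ∈ A, f z ∈ Φ1 '' ball 0 1 := by
      by_cases h10 : mob (-ζ0) 0 = 0
      · rw [h10] at hfa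
        exact ⟨a, hfa, {a}, isPreconnected_singleton, rfl, rfl, by
          rintro z rfl; exact ⟨0, mem_ball_self one_pos, hfa.symm⟩⟩
      · exact path_to H.hf H.hnc hL1.d hasy1 hcr1 hζ1 h10 hfa
    obtain ⟨c, hfc, A, hA, haA, hcA, hAo⟩ := hc
    obtain ⟨Φ2, hd2, hi2, h02, hl2⟩ := one_step H.hf H.hnc hL1.d hL1.i hfc.symm hasy1 hcr1
    have hm := (mlt_spec H.hf H.hnc c).1
    have hpw : ∀ z ∈ ball (0:ℂ) 1, z ^ mlt f c ∈ ball (0:ℂ) 1 := fun z hz => (BL.pow hm).1 hz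
    have hL2 : Lf f (n+1) y R ((∏ c ∈ U, mlt f c) * mlt f c) Φ2 (fun z => Q (mob ζ0 (z ^ mlt f c))) := by
      refine ⟨hd2, hi2, hL1.bl.comp (BL.pow hm), fun ζ hζ => ?_⟩
      rw [iterate_succ_apply, hl2 ζ hζ]
      exact hL1.comm _ (hpw ζ hζ)
    have haΦ : a ∈ Φ2 '' ball 0 1 := by
      refine hL2.contains H.hf hR hA (fun z hz => ?_) ⟨0, mem_ball_self one_pos, by rwa [h02]⟩ haA
      obtain ⟨ζ, hζ, he⟩ := hAo z hz
      rw [iterate_succ_apply, ← he]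
      exact hL1.over hR hζ
    obtain ⟨ζ2, hζ2, hζaux⟩ := haΦ
    have hL3 := hL2.recentre hζ2
    have hmb2 : ∀ z ∈ ball (0:ℂ) 1, mob ζ2 z ∈ ball (0:ℂ) 1 := (BL.mob (by simpa using hζ2)).1
    have hold : ∀ c ∈ U, ∃ k j : ℕ, ∃ A : Set ℂ, 1 ≤ k ∧ k + j = n + 1 ∧ IsPreconnected A ∧
        (∀ z ∈ A, f^[j] z ∈ ball y R) ∧ c ∈ A ∧ ∀ ζ ∈ ball (0:ℂ) 1, f^[k] (Φ2 ζ) ∈ A := by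
      intro c hc
      obtain ⟨k, j, A, h1, h2, h3, h4, h5⟩ := hUA c hc
      refine ⟨k+1, j, A, by omega, by omega, h2, h3, h4, fun ζ hζ => ?_⟩
      rw [iterate_succ_apply, hl2 ζ hζ]
      exact h5 _ (hmb _ (hpw ζ hζ))
    by_cases hdc : deriv f c = 0
    · have hnrec : ¬ RecurrentCriticalPoint f c := by
        intro h
        have h3 : f^[n+1] c ∈ ball y R := by
          have := hL2.over hR (mem_ball_self (x := (0:ℂ)) one_pos)
          rwa [h02] at this
        exact (hb h3).2 (H.hS2 c h (n+1) (hb h3).1)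
      have hcU : c ∉ U := by
        intro h
        obtain ⟨k, j, A', h1, h2, h3, h4, h5, h6⟩ := hold c h
        have := h6 0 (mem_ball_self one_pos)
        rw [h02] at this
        have h7 := hG j (by omega) A' h3 h4 c h5 _ this (H.hM c hdc).1
        have h8 := H.hκ c hdc hnrec k h1
        linarith
      refine ⟨_, _, insert c U, ?_, by rw [Finset.prod_insert hcU, mul_comm]; exact hL3, by simp only [mob_zero]; exact hζaux, ?_⟩
      · intro x hx
        rcases Finset.mem_insert.1 hx with rfl | h
        · simpa using hdc
        · exact hU h
      · intro x hx
        rcases Finset.mem_insert.1 hx with rfl | h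
        · refine ⟨0, n+1, Φ2 '' ball 0 1, by omega, hL2.preconn, ?_, ⟨0, mem_ball_self one_pos, h02⟩, fun ζ hζ => ⟨_, hmb2 ζ hζ, rfl⟩⟩
          rintro _ ⟨ζ, hζ, rfl⟩
          exact hL2.over hR hζ
        · obtain ⟨k, j, A', h1, h2, h3, h4, h5, h6⟩ := hold x h
          exact ⟨k, j, A', h2, h3, h4, h5, fun ζ hζ => h6 _ (hmb2 ζ hζ)⟩
    · rw [mlt_one hdc, mul_one] at hL3
      refine ⟨_, _, U, hU, hL3, by simp only [mob_zero]; exact hζaux, ?_⟩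
      intro x h
      obtain ⟨k, j, A', h1, h2, h3, h4, h5, h6⟩ := hold x h
      exact ⟨k, j, A', h2, h3, h4, h5, fun ζ hζ => h6 _ (hmb2 ζ hζ)⟩

theorem Ctx.struct {f : ℂ → ℂ} {z₀ : ℂ} {ρ M ε : ℝ} (H : Ctx f z₀ ρ M ε) {y : ℂ} {R : ℝ} (hR : 0 < R)
    (hb : ball y R ⊆ ball z₀ ρ \ {z₀}) {n : ℕ} (hG : Gd f M ε n y R) {a : ℂ} (ha : f^[n] a ∈ ball y R) :
    ∃ Φ Q : ℂ → ℂ, Lf f n y R H.Dm Φ Q ∧ Φ 0 = a := by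
  obtain ⟨Φ, Q, U, hU, hL, h0, -⟩ := struct_aux H hR hb hG n le_rfl a ha
  refine ⟨Φ, Q, ⟨hL.d, hL.i, hL.bl.mono ?_, hL.comm⟩, h0⟩
  exact Finset.prod_le_prod_of_subset_of_one_le' hU (fun c _ _ => (mlt_spec H.hf H.hnc c).1)

theorem Ctx.avoids {f : ℂ → ℂ} {z₀ : ℂ} {ρ M ε : ℝ} (H : Ctx f z₀ ρ M ε) {y : ℂ} {R : ℝ} (hR : 0 < R)
    (hb : ball y R ⊆ ball z₀ ρ \ {z₀}) {n D : ℕ} {Φ Q : ℂ → ℂ} (hL : Lf f n y R D Φ Q) :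
    ∀ ζ ∈ ball (0:ℂ) 1, Φ ζ ≠ z₀ := by
  intro ζ hζ h
  have := hL.over hR hζ
  rw [h] at this
  exact (hb this).2 (H.hcyc n (hb this).1)

theorem isOpenMap_of_hnc {f : ℂ → ℂ} (hf : Differentiable ℂ f) (hnc : ∀ z, ¬ ∀ᶠ w in nhds z, f w = f z) :
    IsOpenMap f := by
  rw [isOpenMap_iff_nhds_le]
  intro z
  exact ((hf.analyticAt z).eventually_constant_or_nhds_le_map_nhds).resolve_left (hnc z)

theorem isOpenMap_iter {f : ℂ → ℂ} (h : IsOpenMap f) (j : ℕ) : IsOpenMap (f^[j]) := by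
  induction j with
  | zero => exact IsOpenMap.id
  | succ j ih => rw [iterate_succ]; exact ih.comp h

theorem small3 {f : ℂ → ℂ} (hf : Differentiable ℂ f) (hnc : ∀ z, ¬ ∀ᶠ w in nhds z, f w = f z) (j : ℕ) (M : ℝ)
    {ε : ℝ} (hε : 0 < ε) : ∃ e > 0, ∀ a, ‖a‖ ≤ M → ∀ A : Set ℂ, IsPreconnected A → a ∈ A →
      (∀ z ∈ A, ‖f^[j] z - f^[j] a‖ < e) → ∀ z ∈ A, ‖z - a‖ < ε := by
  have hopen : IsOpenMap (f^[j]) := isOpenMap_iter (isOpenMap_of_hnc hf hnc) j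
  have hd : Differentiable ℂ (f^[j]) := hf.iterate j
  set g := f^[j] with hg
  have key : ∃ e > 0, ∀ a ∈ closedBall (0:ℂ) M, ∀ A : Set ℂ, IsPreconnected A → a ∈ A →
      (∀ z ∈ A, ‖g z - g a‖ < e) → ∀ z ∈ A, ‖z - a‖ < ε := by
    refine (isCompact_closedBall (0:ℂ) M).induction_on (p := fun S => ∃ e > 0, ∀ a ∈ S, ∀ A : Set ℂ, IsPreconnected A → a ∈ A →
      (∀ z ∈ A, ‖g z - g a‖ < e) → ∀ z ∈ A, ‖z - a‖ < ε) ⟨1, one_pos, by simp⟩ ?_ ?_ ?_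
    · rintro s t hst ⟨e, he, h⟩
      exact ⟨e, he, fun a ha => h a (hst ha)⟩
    · rintro s t ⟨e, he, h⟩ ⟨e', he', h'⟩
      refine ⟨min e e', lt_min he he', ?_⟩
      rintro a (ha | ha) A hA haA hz
      · exact h a ha A hA haA (fun z hz' => lt_of_lt_of_le (hz z hz') (min_le_left _ _))
      · exact h' a ha A hA haA (fun z hz' => lt_of_lt_of_le (hz z hz') (min_le_right _ _))
    · intro a ha
      have hiso : ∀ᶠ z in nhdsWithin a {a}ᶜ, g z ≠ g a := by
        rcases (hd.analyticAt a).eventually_eq_or_eventually_ne (analyticAt_const (v := g a)) with h | h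
        · exfalso
          obtain ⟨r, hr, hr'⟩ := Metric.eventually_nhds_iff_ball.1 h
          have h1 : IsOpen (g '' ball a r) := hopen _ isOpen_ball
          have h2 : g '' ball a r = {g a} := by
            apply subset_antisymm
            · rintro _ ⟨z, hz, rfl⟩; exact hr' z hz
            · rintro _ rfl; exact ⟨a, mem_ball_self hr, rfl⟩
          rw [h2] at h1
          exact not_isOpen_singleton _ h1
        · exact h
      rw [eventually_nhdsWithin_iff, Metric.eventually_nhds_iff] at hiso
      obtain ⟨e0, he0, hiso⟩ := hiso
      set r := min (ε/2) (e0/2) with hr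
      have hr0 : 0 < r := by positivity
      have hre : r ≤ ε/2 := min_le_left _ _
      have hre0 : r < e0 := lt_of_le_of_lt (min_le_right _ _) (by linarith)
      obtain ⟨m, hm0, hm⟩ : ∃ m > 0, ∀ z ∈ sphere a r, m ≤ ‖g z - g a‖ := by
        obtain ⟨x, hx, hmin⟩ := (isCompact_sphere a r).exists_isMinOn (NormedSpace.sphere_nonempty.2 hr0.le)
          (f := fun z => ‖g z - g a‖) (by have := hd.continuous; fun_prop)
        refine ⟨‖g x - g a‖, ?_, fun z hz => hmin hz⟩
        rw [gt_iff_lt, norm_pos_iff, sub_ne_zero]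
        have hx' : dist x a = r := hx
        refine hiso (by rw [hx']; exact hre0) ?_
        rintro rfl
        simp at hx'; linarith
      have hnb : ∀ᶠ z in nhds a, ‖g z - g a‖ < m / 2 ∧ ‖z - a‖ < r := by
        have h1 : Tendsto (fun z => ‖g z - g a‖) (nhds a) (nhds ‖g a - g a‖) :=
          (hd.continuous.sub continuous_const).norm.tendsto a
        have h2 : Tendsto (fun z => ‖z - a‖) (nhds a) (nhds ‖a - a‖) :=
          (continuous_id.sub continuous_const).norm.tendsto a
        simp only [sub_self, norm_zero] at h1 h2
        exact (h1.eventually (gt_mem_nhds (by linarith))).and (h2.eventually (gt_mem_nhds hr0))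
      refine ⟨_, mem_nhdsWithin_of_mem_nhds hnb, m/2, by linarith, ?_⟩
      rintro b ⟨hb1, hb2⟩ A hA hbA hAz
      have hin : A ⊆ ball a r := by
        apply hA.subset_left_of_subset_union isOpen_ball (isClosed_closedBall (x := a) (ε := r)).isOpen_compl
        · exact disjoint_left.2 fun z hz hz' => hz' (ball_subset_closedBall hz)
        · intro z hz
          rcases lt_trichotomy (dist z a) r with h | h | h
          · left; exact h
          · have h1 := hm z h
            have h2 := hAz z hz
            have h3 := norm_add_le (g z - g b) (g b - g a)
            simp only [sub_add_sub_cancel] at h3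
            linarith
          · right; simpa using h
        · exact ⟨b, hbA, by rw [mem_ball, dist_eq_norm]; exact hb2⟩
      intro z hz
      have h1 := hin hz
      rw [mem_ball, dist_eq_norm] at h1
      have h3 := norm_add_le (z - a) (a - b)
      simp only [sub_add_sub_cancel] at h3
      rw [norm_sub_rev a b] at h3
      linarith
  obtain ⟨e, he, h⟩ := key
  exact ⟨e, he, fun a ha => h a (by simpa using ha)⟩

theorem gd_near {f : ℂ → ℂ} (hf : Differentiable ℂ f) (hnc : ∀ z, ¬ ∀ᶠ w in nhds z, f w = f z) (M : ℝ)
    {ε : ℝ} (hε : 0 < ε) (z₀ : ℂ) (N : ℕ) : ∃ r0 > 0, ∀ y r, ball y r ⊆ ball z₀ r0 → Gd f M ε N y r := by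
  induction N with
  | zero => exact ⟨1, one_pos, fun y r _ j hj => absurd hj (by omega)⟩
  | succ N ih =>
    obtain ⟨r0, hr0, h0⟩ := ih
    obtain ⟨e, he, h1⟩ := small3 hf hnc N M hε
    refine ⟨min r0 (e/2), by positivity, fun y r hb j hj A hA hAz => ?_⟩
    rcases Nat.lt_succ_iff_lt_or_eq.1 hj with h | rfl
    · exact h0 y r (hb.trans (ball_subset_ball (min_le_left _ _))) j h A hA hAz
    · intro a ha b hbA hM
      rw [norm_sub_rev]
      refine h1 a hM A hA ha (fun z hz => ?_) b hbA
      have e1 := hb (hAz z hz)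
      have e2 := hb (hAz a ha)
      rw [mem_ball, dist_eq_norm] at e1 e2
      have h3 := norm_add_le (f^[j] z - z₀) (z₀ - f^[j] a)
      simp only [sub_add_sub_cancel] at h3
      rw [norm_sub_rev z₀] at h3
      have := min_le_right r0 (e/2)
      linarith


theorem Lf.hol {f : ℂ → ℂ} {n : ℕ} {y : ℂ} {R : ℝ} {D : ℕ} {Φ Q : ℂ → ℂ} (h : Lf f n y R D Φ Q)
    (hf : Differentiable ℂ f) (hR : 0 < R) : DifferentiableOn ℂ Q (ball 0 1) := by
  have h1 : DifferentiableOn ℂ (fun ζ => (f^[n] (Φ ζ) - y) / R) (ball 0 1) := by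
    have : DifferentiableOn ℂ (fun ζ => f^[n] (Φ ζ)) (ball 0 1) := (hf.iterate n).comp_differentiableOn h.d
    exact (this.sub_const y).div_const _
  refine h1.congr fun ζ hζ => ?_
  have : (R:ℂ) ≠ 0 := by exact_mod_cast hR.ne'
  rw [h.comm ζ hζ]; field_simp; ring

theorem Lf.pull {f : ℂ → ℂ} {n : ℕ} {y : ℂ} {R : ℝ} {D : ℕ} {Φ Q : ℂ → ℂ} (h : Lf f n y R D Φ Q)
    (hf : Differentiable ℂ f) (hR : 0 < R) {Z : Set ℂ} (hZ : IsPreconnected Z) (h0 : Φ 0 ∈ Z)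
    (hz : ∀ z ∈ Z, f^[n] z ∈ ball y R) : ∃ Y : Set ℂ, IsPreconnected Y ∧ (0:ℂ) ∈ Y ∧ Y ⊆ ball 0 1 ∧ Φ '' Y = Z := by
  have hc := h.contains hf hR hZ hz ⟨0, by simp, h0⟩
  obtain ⟨-, g, hg, hgl, -⟩ := exists_inverse isOpen_ball h.d h.i
  refine ⟨g '' Z, hZ.image _ (hg.continuousOn.mono hc), ⟨_, h0, hgl 0 (by simp)⟩, ?_, ?_⟩
  · rintro _ ⟨z, hz', rfl⟩
    obtain ⟨ζ, hζ, rfl⟩ := hc hz'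
    rwa [hgl ζ hζ]
  · rw [image_image]
    have : ∀ z ∈ Z, Φ (g z) = z := by
      intro z hz'
      obtain ⟨ζ, hζ, rfl⟩ := hc hz'
      rw [hgl ζ hζ]
    rw [image_congr this, image_id']

theorem Lf.normQ {f : ℂ → ℂ} {n : ℕ} {y : ℂ} {R : ℝ} {D : ℕ} {Φ Q : ℂ → ℂ} (h : Lf f n y R D Φ Q)
    (hR : 0 < R) {ζ : ℂ} (hζ : ζ ∈ ball (0:ℂ) 1) {σ : ℝ} (hs : f^[n] (Φ ζ) ∈ ball y (σ * R)) : ‖Q ζ‖ ≤ σ := by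
  rw [h.comm ζ hζ, mem_ball, dist_eq_norm, add_sub_cancel_left, norm_mul, Complex.norm_real, Real.norm_of_nonneg hR.le] at hs
  have : ‖Q ζ‖ * R < σ * R := by linarith
  exact (lt_of_mul_lt_mul_right this hR.le).le

theorem Lf.near (D : ℕ) : ∃ C : ℝ, 1 ≤ C ∧ ∀ (f : ℂ → ℂ) (n : ℕ) (y : ℂ) (R : ℝ) (Φ Q : ℂ → ℂ), Lf f n y R D Φ Q →
    Differentiable ℂ f → 0 < R → ∀ Z : Set ℂ, IsPreconnected Z → Φ 0 ∈ Z → (∀ z ∈ Z, f^[n] z ∈ ball y (3/4 * R)) →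
    ∀ b ∈ Z, ‖b - Φ 0‖ ≤ C * ‖deriv Φ 0‖ := by
  obtain ⟨t, ht0, ht1, ht⟩ := BL.compact D (σ := 3/4) (by norm_num)
  refine ⟨max 1 (KC t), le_max_left _ _, fun f n y R Φ Q h hf hR Z hZ h0 hz b hb => ?_⟩
  obtain ⟨Y, hY, hY0, hY1, rfl⟩ := h.pull hf hR hZ h0 (fun z hz' => ball_subset_ball (by linarith) (hz z hz'))
  obtain ⟨ζ, hζ, rfl⟩ := hb
  have h1 := ht Q h.bl Y hY hY0 hY1 (fun z hz' => h.normQ hR (hY1 hz') (hz _ ⟨z, hz', rfl⟩)) ζ hζ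
  have h2 := koebe_growth one_pos h.d h.i ht0.le ht1 (z := ζ) (by simpa using h1.le)
  rw [mul_one] at h2
  exact h2.trans (mul_le_mul_of_nonneg_right (le_max_right _ _) (norm_nonneg _))

theorem Lf.cmp (D : ℕ) : ∃ C : ℝ, 1 ≤ C ∧ ∀ (f : ℂ → ℂ) (n : ℕ) (y : ℂ) (R : ℝ) (Φ Q : ℂ → ℂ) (Ψ P : ℂ → ℂ),
    Lf f n y R D Φ Q → Lf f n (f^[n] (Ψ 0)) R D Ψ P →
    Differentiable ℂ f → 0 < R → ∀ Z : Set ℂ, IsPreconnected Z → Φ 0 ∈ Z → (∀ z ∈ Z, f^[n] z ∈ ball y (1/2 * R)) →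
    Ψ 0 ∈ Z → ‖deriv Ψ 0‖ ≤ C * ‖deriv Φ 0‖ := by
  obtain ⟨C, hC, h⟩ := Lf.near D
  refine ⟨3072 * C, by linarith, fun f n y R Φ Q Ψ P hΦ hΨ hf hR Z hZ h0 hz h1 => ?_⟩
  have hRc : (R:ℂ) ≠ 0 := by exact_mod_cast hR.ne'
  have hP0 : P 0 = 0 := by
    have := hΨ.comm 0 (by simp)
    simpa [hRc] using this
  have hsch : ∀ ζ ∈ ball (0:ℂ) 1, ‖P ζ‖ ≤ ‖ζ‖ := by
    intro ζ hζ
    have hd := hΨ.hol hf hR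
    exact Complex.norm_le_norm_of_mapsTo_ball hd (hΨ.bl.1.mono_right ball_subset_closedBall) hP0 (by simpa using hζ)
  have hb4 : ball (0:ℂ) (1/4) ⊆ ball 0 1 := ball_subset_ball (by norm_num)
  set W := Ψ '' ball 0 (1/4) with hW
  have hWc : IsPreconnected W := (convex_ball _ _).isPreconnected.image _ (hΨ.d.continuousOn.mono hb4)
  have hW0 : Ψ 0 ∈ W := ⟨0, by simp, rfl⟩
  have hU : IsPreconnected (Z ∪ W) := hZ.union _ h1 hW0 hWc
  have hUo : ∀ z ∈ Z ∪ W, f^[n] z ∈ ball y (3/4 * R) := by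
    rintro z (hz' | ⟨ζ, hζ, rfl⟩)
    · exact ball_subset_ball (by linarith) (hz z hz')
    · have h2 := hz _ h1
      rw [hΨ.comm ζ (hb4 hζ)]
      rw [mem_ball, dist_eq_norm] at h2 ⊢
      have h3 := hsch ζ (hb4 hζ)
      have h4 : ‖ζ‖ < 1/4 := by simpa using hζ
      calc ‖f^[n] (Ψ 0) + R * P ζ - y‖ = ‖(f^[n] (Ψ 0) - y) + R * P ζ‖ := by ring_nf
        _ ≤ ‖f^[n] (Ψ 0) - y‖ + ‖R * P ζ‖ := norm_add_le _ _
        _ = ‖f^[n] (Ψ 0) - y‖ + R * ‖P ζ‖ := by rw [norm_mul, Complex.norm_real, Real.norm_of_nonneg hR.le]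
        _ < 3/4 * R := by nlinarith
  have hall := h f n y R Φ Q hΦ hf hR _ hU (Or.inl h0) hUo
  have hq := koebe_quarter (R := 1/4) (by norm_num) (hΨ.d.mono hb4) (hΨ.i.mono hb4)
  by_contra hcon
  push Not at hcon
  have hpos : 0 < ‖deriv Ψ 0‖ := lt_of_le_of_lt (by positivity) hcon
  have hmem : Ψ 0 + ((‖deriv Ψ 0‖ * (1/4) / 192 / 2 : ℝ) : ℂ) ∈ W := by
    apply hq
    rw [mem_ball, dist_eq_norm, add_sub_cancel_left, Complex.norm_real, Real.norm_of_nonneg (by positivity)]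
    linarith
  have e1 := hall _ (Or.inr hmem)
  have e2 := hall _ (Or.inl h1)
  have e3 := norm_sub_le (Ψ 0 + ((‖deriv Ψ 0‖ * (1/4) / 192 / 2 : ℝ) : ℂ) - Φ 0) (Ψ 0 - Φ 0)
  rw [show Ψ 0 + ((‖deriv Ψ 0‖ * (1/4) / 192 / 2 : ℝ) : ℂ) - Φ 0 - (Ψ 0 - Φ 0) = ((‖deriv Ψ 0‖ * (1/4) / 192 / 2 : ℝ) : ℂ) by ring,
    Complex.norm_real, Real.norm_of_nonneg (by positivity)] at e3
  nlinarith

theorem comp_onto {f : ℂ → ℂ} {n : ℕ} {y : ℂ} {R : ℝ} {D : ℕ} {Φ Q : ℂ → ℂ} (h : Lf f n y R D Φ Q)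
    (hf : Differentiable ℂ f) (hop : IsOpenMap f) (hR : 0 < R) {V : Set ℂ} (hV : IsOpen V) (hVc : IsPreconnected V)
    (hVb : V ⊆ ball y R) {p : ℂ} (hp : p ∈ Φ '' ball 0 1) (hpV : f^[n] p ∈ V) {w : ℂ} (hw : w ∈ V) :
    ∃ Z : Set ℂ, IsPreconnected Z ∧ p ∈ Z ∧ (∀ z ∈ Z, f^[n] z ∈ V) ∧ ∃ q ∈ Z, f^[n] q = w := by
  obtain ⟨hopn, -⟩ := exists_inverse isOpen_ball h.d h.i
  have hF : Continuous (f^[n]) := hf.continuous.iterate n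
  set U := Φ '' ball 0 1 ∩ f^[n] ⁻¹' V with hU
  have hUo : IsOpen U := hopn.inter (hV.preimage hF)
  have hpU : p ∈ U := ⟨hp, hpV⟩
  set Z := connectedComponentIn U p with hZ
  have hZc : IsPreconnected Z := isPreconnected_connectedComponentIn
  have hpZ : p ∈ Z := mem_connectedComponentIn hpU
  have hZU : Z ⊆ U := connectedComponentIn_subset _ _
  have hZo : IsOpen Z := hUo.connectedComponentIn
  have hIo : IsOpen (f^[n] '' Z) := isOpenMap_iter hop n _ hZo
  refine ⟨Z, hZc, hpZ, fun z hz => (hZU hz).2, ?_⟩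
  have hcl : ∀ x ∈ V, x ∈ closure (f^[n] '' Z) → x ∈ f^[n] '' Z := by
    intro x hx hxc
    have hFx := hVb hx
    rw [mem_ball, dist_eq_norm] at hFx
    obtain ⟨K, hK1, hK2⟩ := exists_between hFx
    obtain ⟨t, ht, ht'⟩ := h.bl.proper (K := K / R) (by rwa [div_lt_one hR])
    have hcb : closedBall (0:ℂ) t ⊆ ball 0 1 := closedBall_subset_ball ht
    have hcpt : IsCompact (Φ '' closedBall 0 t) :=
      (isCompact_closedBall _ _).image_of_continuousOn (h.d.continuousOn.mono hcb)
    set Z' := Z ∩ Φ '' closedBall 0 t with hZ'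
    have hsub : {v | ‖v - y‖ < K} ∩ f^[n] '' Z ⊆ f^[n] '' Z' := by
      rintro _ ⟨h1, z, hz, rfl⟩
      obtain ⟨ζ, hζ, rfl⟩ := (hZU hz).1
      refine ⟨_, ⟨hz, ζ, ?_, rfl⟩, rfl⟩
      rw [mem_closedBall_zero_iff]
      apply ht' ζ hζ
      have h1' : ‖f^[n] (Φ ζ) - y‖ < K := h1
      rw [h.comm ζ hζ, add_sub_cancel_left, norm_mul, Complex.norm_real, Real.norm_of_nonneg hR.le] at h1'
      rw [le_div_iff₀ hR]; linarith
    have hopen : IsOpen {v : ℂ | ‖v - y‖ < K} := isOpen_lt (by fun_prop) continuous_const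
    have h3 : x ∈ closure ({v | ‖v - y‖ < K} ∩ f^[n] '' Z) := hopen.inter_closure ⟨hK1, hxc⟩
    have hcc : IsCompact (closure Z') := hcpt.of_isClosed_subset isClosed_closure
      (hcpt.isClosed.closure_subset_iff.2 inter_subset_right)
    have h4 : x ∈ f^[n] '' closure Z' := by
      have h5 : IsClosed (f^[n] '' closure Z') := (hcc.image hF).isClosed
      exact (h5.closure_subset_iff.2 (hsub.trans (image_mono subset_closure))) h3
    obtain ⟨z, hz, rfl⟩ := h4
    have hzΦ : z ∈ Φ '' ball 0 1 := image_mono hcb ((hcpt.isClosed.closure_subset_iff.2 inter_subset_right) hz)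
    have hzcl : z ∈ closure Z := closure_mono inter_subset_left hz
    have hzU : z ∈ U := ⟨hzΦ, hx⟩
    refine ⟨z, ?_, rfl⟩
    have h6 : IsPreconnected (insert z Z) :=
      hZc.subset_closure (subset_insert _ _) (insert_subset hzcl subset_closure)
    exact (h6.subset_connectedComponentIn (Or.inr hpZ) (insert_subset hzU hZU)) (Or.inl rfl)
  have hfin : V ⊆ f^[n] '' Z := by
    refine hVc.subset_left_of_subset_union (v := (closure (f^[n] '' Z))ᶜ) hIo isClosed_closure.isOpen_compl ?_ ?_ ?_
    · exact disjoint_left.2 fun z hz hz' => hz' (subset_closure hz)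
    · intro x hx
      by_cases h : x ∈ closure (f^[n] '' Z)
      · exact Or.inl (hcl x hx h)
      · exact Or.inr h
    · exact ⟨f^[n] p, hpV, p, hpZ, rfl⟩
  exact hfin hw

theorem Ctx.Mpos {f : ℂ → ℂ} {z₀ : ℂ} {ρ M ε : ℝ} (H : Ctx f z₀ ρ M ε) : 0 < M := lt_of_le_of_lt (norm_nonneg _) H.hz

theorem Ctx.step {f : ℂ → ℂ} {z₀ : ℂ} {ρ M ε : ℝ} (H : Ctx f z₀ ρ M ε) : ∃ C : ℝ, 1 ≤ C ∧ ∀ y r n, 0 < r →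
    ball y (C * r) ⊆ ball z₀ ρ \ {z₀} → Gd f M ε n y (C * r) → Gd f M ε (n+1) y r := by
  have hM := H.Mpos
  obtain ⟨t, ht0, ht1, ht⟩ : ∃ t : ℝ, 0 < t ∧ t < 1 ∧ 2 * M * (Real.exp (192 * t / (1 - t)) - 1) < ε := by
    have hc : ContinuousAt (fun t : ℝ => 2 * M * (Real.exp (192 * t / (1 - t)) - 1)) 0 := by
      refine ContinuousAt.mul continuousAt_const (ContinuousAt.sub (Real.continuous_exp.continuousAt.comp ?_) continuousAt_const)
      exact ContinuousAt.div (by fun_prop) (by fun_prop) (by norm_num)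
    have h1 := hc.tendsto.eventually (gt_mem_nhds (show _ < ε by simpa using H.hε))
    have h2 : ∀ᶠ t : ℝ in nhds 0, t < 1 := gt_mem_nhds one_pos
    obtain ⟨t, ht⟩ := (((h1.and h2).filter_mono nhdsWithin_le_nhds).and (self_mem_nhdsWithin (s := Ioi (0:ℝ)))).exists
    exact ⟨t, ht.2, ht.1.2, ht.1.1⟩
  obtain ⟨σ, hσ, hs⟩ := BL.small H.Dm ht0 ht1
  refine ⟨max 1 σ⁻¹, le_max_left _ _, fun y r n hr hb hG j hj A hA hz => ?_⟩
  set C := max 1 σ⁻¹ with hC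
  have hC1 : 1 ≤ C := le_max_left _ _
  have hCr : 0 < C * r := by positivity
  have hbb : ball y r ⊆ ball y (C * r) := ball_subset_ball (by nlinarith)
  rcases Nat.lt_succ_iff_lt_or_eq.1 hj with h | rfl
  · exact hG j h A hA (fun z hz' => hbb (hz z hz'))
  intro a ha b hbA haM
  obtain ⟨Φ, Q, hL, h0⟩ := H.struct hCr hb hG (hbb (hz a ha))
  have hom := H.avoids hCr hb hL
  obtain ⟨Y, hY, hY0, hY1, rfl⟩ := hL.pull H.hf hCr hA (by rwa [h0]) (fun z hz' => hbb (hz z hz'))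
  obtain ⟨ζ, hζ, rfl⟩ := hbA
  have h1 := hs Q hL.bl Y hY hY0 hY1 (fun z hz' => by
    apply hL.normQ hCr (hY1 hz')
    refine ball_subset_ball ?_ (hz _ ⟨z, hz', rfl⟩)
    have : 1 ≤ σ * C := by
      have : σ⁻¹ ≤ C := le_max_right _ _
      calc 1 = σ * σ⁻¹ := by field_simp
        _ ≤ σ * C := by gcongr
    nlinarith) ζ hζ
  have h2 := (koebe_growth_avoid one_pos hL.d hL.i hom ht0.le ht1 (z := ζ) (by simpa using h1.le)).2
  rw [h0] at h2
  rw [norm_sub_rev]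
  have h3 : ‖a - z₀‖ ≤ 2 * M := (norm_sub_le _ _).trans (by linarith [H.hz])
  have h4 : (1:ℝ) ≤ Real.exp (192 * t / (1 - t)) := Real.one_le_exp (by have : 0 < 1 - t := by linarith
                                                                        positivity)
  calc _ ≤ _ := h2
    _ ≤ 2 * M * (Real.exp (192 * t / (1 - t)) - 1) := mul_le_mul_of_nonneg_right h3 (by linarith)
    _ < ε := ht


/-- a linked connected set over `O` starting from `α` with scale `s`, scale ratio at most `C`. -/
def Linked (f : ℂ → ℂ) (n D : ℕ) (r : ℝ) (O : Set ℂ) (α : ℂ) (s C : ℝ) (Z : Set ℂ) : Prop :=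
  IsPreconnected Z ∧ α ∈ Z ∧ (∀ z ∈ Z, f^[n] z ∈ O) ∧ ∀ p ∈ Z, ‖p - α‖ ≤ C * s ∧
    ∃ Φ Q, Lf f n (f^[n] p) r D Φ Q ∧ Φ 0 = p ∧ ‖deriv Φ 0‖ ≤ C * s ∧ s ≤ C * ‖deriv Φ 0‖

theorem Ctx.link {f : ℂ → ℂ} {z₀ : ℂ} {ρ M ε : ℝ} (H : Ctx f z₀ ρ M ε) : ∃ C : ℝ, 1 ≤ C ∧ ∀ n r O, 0 < r → IsOpen O →
    Convex ℝ O → (∀ x ∈ O, Gd f M ε n x r ∧ ball x r ⊆ ball z₀ ρ \ {z₀}) → ∀ Φ Q, Lf f n (f^[n] (Φ 0)) r H.Dm Φ Q →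
    f^[n] (Φ 0) ∈ O → ∀ x ∈ O, ‖x - f^[n] (Φ 0)‖ < r / 8 →
    ∃ Z, Linked f n H.Dm r O (Φ 0) ‖deriv Φ 0‖ C Z ∧ ∃ b ∈ Z, f^[n] b = x := by
  obtain ⟨C1, hC1, h1⟩ := Lf.near H.Dm
  obtain ⟨C2, hC2, h2⟩ := Lf.cmp H.Dm
  have hop := isOpenMap_of_hnc H.hf H.hnc
  refine ⟨max C1 C2, hC1.trans (le_max_left _ _), fun n r O hr hO hOc hG Φ Q hL h0 x hx hxr => ?_⟩
  set V := O ∩ ball (f^[n] (Φ 0)) (r/8) with hV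
  have hVo : IsOpen V := hO.inter isOpen_ball
  have hVc : IsPreconnected V := (hOc.inter (convex_ball _ _)).isPreconnected
  obtain ⟨Z, hZ, hZ0, hZV, b, hbZ, hb⟩ := comp_onto hL H.hf hop hr hVo hVc
    (inter_subset_right.trans (ball_subset_ball (by linarith))) (p := Φ 0) ⟨0, by simp, rfl⟩
    ⟨h0, mem_ball_self (by linarith)⟩ (w := x) ⟨hx, by rwa [mem_ball, dist_eq_norm]⟩
  refine ⟨Z, ⟨hZ, hZ0, fun z hz => (hZV z hz).1, fun p hp => ?_⟩, b, hbZ, hb⟩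
  have hpO := (hZV p hp).1
  obtain ⟨Ψ, P, hΨ, hΨ0⟩ := H.struct hr (hG _ hpO).2 (hG _ hpO).1 (a := p) (mem_ball_self hr)
  have hpp := (hZV p hp).2
  have m1 := le_max_left C1 C2
  have m2 := le_max_right C1 C2
  refine ⟨?_, Ψ, P, hΨ, hΨ0, ?_, ?_⟩
  · exact (h1 f n _ r Φ Q hL H.hf hr Z hZ hZ0 (fun z hz => ball_subset_ball (by linarith) (hZV z hz).2) p hp).trans
      (mul_le_mul_of_nonneg_right m1 (norm_nonneg _))
  · refine (h2 f n _ r Φ Q Ψ P hL (by rwa [hΨ0]) H.hf hr Z hZ hZ0 (fun z hz => ball_subset_ball (by linarith) (hZV z hz).2) (by rwa [hΨ0])).trans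
      (mul_le_mul_of_nonneg_right m2 (norm_nonneg _))
  · refine (h2 f n _ r Ψ P Φ Q hΨ hL H.hf hr Z hZ (by rwa [hΨ0]) (fun z hz => ?_) hZ0).trans
      (mul_le_mul_of_nonneg_right m2 (norm_nonneg _))
    have e1 := (hZV z hz).2
    rw [mem_ball] at e1 hpp ⊢
    rw [dist_comm] at hpp
    have := dist_triangle (f^[n] z) (f^[n] (Φ 0)) (f^[n] p)
    linarith

theorem Ctx.chain {f : ℂ → ℂ} {z₀ : ℂ} {ρ M ε : ℝ} (H : Ctx f z₀ ρ M ε) (L : ℕ) : ∃ C : ℝ, 1 ≤ C ∧ ∀ n r O, 0 < r → IsOpen O →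
    Convex ℝ O → (∀ x ∈ O, Gd f M ε n x r ∧ ball x r ⊆ ball z₀ ρ \ {z₀}) → ∀ Φ Q, Lf f n (f^[n] (Φ 0)) r H.Dm Φ Q →
    f^[n] (Φ 0) ∈ O → ∀ x ∈ O, ‖x - f^[n] (Φ 0)‖ ≤ L * (r / 16) →
    ∃ Z, Linked f n H.Dm r O (Φ 0) ‖deriv Φ 0‖ C Z ∧ ∃ b ∈ Z, f^[n] b = x := by
  induction L with
  | zero =>
    refine ⟨1, le_rfl, fun n r O hr hO hOc hG Φ Q hL h0 x hx hxr => ?_⟩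
    have : x = f^[n] (Φ 0) := by simpa [sub_eq_zero] using hxr
    subst this
    refine ⟨{Φ 0}, ⟨isPreconnected_singleton, rfl, ?_, ?_⟩, Φ 0, rfl, rfl⟩
    · rintro z rfl; exact h0
    · rintro p rfl
      exact ⟨by simp, Φ, Q, hL, rfl, by simp, by simp⟩
  | succ L ih =>
    obtain ⟨C, hC, h⟩ := ih
    obtain ⟨C1, hC1, h1⟩ := H.link
    refine ⟨2 * C1 * C, by nlinarith, fun n r O hr hO hOc hG Φ Q hL h0 x hx hxr => ?_⟩
    set x0 := f^[n] (Φ 0) with hx0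
    set τ : ℝ := L / (L + 1) with hτ
    have hL1 : (0:ℝ) < L + 1 := by positivity
    have hτ0 : 0 ≤ τ := by positivity
    have hτ1 : τ ≤ 1 := by rw [hτ, div_le_one hL1]; linarith
    set x1 : ℂ := x0 + (τ:ℂ) * (x - x0) with hx1
    have hx1O : x1 ∈ O := by
      have := hOc.add_smul_sub_mem h0 hx (t := τ) ⟨hτ0, hτ1⟩
      simpa [hx1] using this
    have hn1 : ‖x1 - x0‖ ≤ L * (r/16) := by
      rw [hx1, add_sub_cancel_left, norm_mul, Complex.norm_real, Real.norm_of_nonneg hτ0, hτ, div_mul_eq_mul_div,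
        div_le_iff₀ hL1]
      push_cast at hxr
      calc (L:ℝ) * ‖x - x0‖ ≤ L * ((L+1) * (r/16)) := by gcongr
        _ = _ := by ring
    have hn2 : ‖x - x1‖ < r/8 := by
      have e : x - x1 = ((1 - τ : ℝ) : ℂ) * (x - x0) := by rw [hx1]; push_cast; ring
      rw [e, norm_mul, Complex.norm_real, Real.norm_of_nonneg (by linarith)]
      have e2 : 1 - τ = 1 / (L+1) := by rw [hτ]; field_simp; ring
      rw [e2, div_mul_eq_mul_div, div_lt_iff₀ hL1]
      push_cast at hxr
      nlinarith
    obtain ⟨Z1, hZ1, b1, hb1, hb1x⟩ := h n r O hr hO hOc hG Φ Q hL h0 x1 hx1O hn1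
    obtain ⟨hd1, Ψ, P, hΨ, hΨ0, hs1, hs2⟩ := hZ1.2.2.2 b1 hb1
    obtain ⟨Z2, hZ2, b2, hb2, hb2x⟩ := h1 n r O hr hO hOc hG Ψ P (by rwa [hΨ0]) (by rw [hΨ0, hb1x]; exact hx1O) x hx
      (by rw [hΨ0, hb1x]; exact hn2)
    have hs := norm_nonneg (deriv Φ 0)
    set s := ‖deriv Φ 0‖
    set s1 := ‖deriv Ψ 0‖
    have hs1' : 0 ≤ s1 := norm_nonneg _
    have hm : ∀ u : ℝ, u ≤ C * s → u ≤ 2 * C1 * C * s := fun u hu => hu.trans (by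
      have : 0 ≤ C * s := by positivity
      nlinarith)
    refine ⟨Z1 ∪ Z2, ⟨hZ1.1.union b1 hb1 (by rw [← hΨ0]; exact hZ2.2.1) hZ2.1, Or.inl hZ1.2.1, ?_, ?_⟩, b2, Or.inr hb2, hb2x⟩
    · rintro z (hz | hz)
      · exact hZ1.2.2.1 z hz
      · exact hZ2.2.2.1 z hz
    · rintro p (hp | hp)
      · obtain ⟨e1, Θ, R, e2, e3, e4, e5⟩ := hZ1.2.2.2 p hp
        refine ⟨hm _ e1, Θ, R, e2, e3, hm _ e4, e5.trans ?_⟩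
        have : 0 ≤ C * ‖deriv Θ 0‖ := by positivity
        nlinarith
      · obtain ⟨e1, Θ, R, e2, e3, e4, e5⟩ := hZ2.2.2.2 p hp
        have h3 : C1 * s1 ≤ C1 * (C * s) := by gcongr
        have h4 : 0 ≤ C1 * (C * s) := by positivity
        refine ⟨?_, Θ, R, e2, e3, by nlinarith, ?_⟩
        · rw [hΨ0] at e1
          have := norm_add_le (p - b1) (b1 - Φ 0)
          rw [sub_add_sub_cancel] at this
          have : C * s ≤ C1 * (C * s) := le_mul_of_one_le_left (by positivity) hC1
          nlinarith
        · have : C * s1 ≤ C * (C1 * ‖deriv Θ 0‖) := by gcongr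
          have : 0 ≤ C * (C1 * ‖deriv Θ 0‖) := by positivity
          nlinarith

def Bad (f : ℂ → ℂ) (M ε : ℝ) (n : ℕ) (y : ℂ) (r : ℝ) : Prop :=
  ∃ A : Set ℂ, IsPreconnected A ∧ (∀ z ∈ A, f^[n] z ∈ ball y r) ∧ ¬ Sm M ε A

theorem Ctx.base {f : ℂ → ℂ} {z₀ : ℂ} {ρ M ε : ℝ} (H : Ctx f z₀ ρ M ε) : ∃ η : ℝ, 0 < η ∧ ∀ n y r, 0 < r →
    ball y (2 * r) ⊆ ball z₀ ρ \ {z₀} → Bad f M ε n y r → Gd f M ε n y r → (∀ x ∈ ball y r, Gd f M ε n x (r/2)) →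
    ∃ Φ Q, Lf f n (f^[n] (Φ 0)) (r/2) H.Dm Φ Q ∧ ‖Φ 0‖ ≤ M + ε ∧ f^[n] (Φ 0) ∈ ball y r ∧ η ≤ ‖deriv Φ 0‖ := by
  obtain ⟨C, hC, hch⟩ := H.chain 32
  set D := H.Dm with hD
  have hε := H.hε
  refine ⟨ε / (4 * (D + 1) * C), by positivity, fun n y r hr hb hBad hGd hG2 => ?_⟩
  by_contra hcon
  obtain ⟨A, hA, hAo, hAs⟩ := hBad
  unfold Sm at hAs
  push Not at hAs
  obtain ⟨a, ha, b, hbA, haM, hab⟩ := hAs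
  have hbr : ball y r ⊆ ball z₀ ρ \ {z₀} := (ball_subset_ball (by linarith)).trans hb
  obtain ⟨ΦA, QA, hLA, hA0⟩ := H.struct hr hbr hGd (hAo a ha)
  have hAin := hLA.contains H.hf hr hA hAo ⟨0, by simp, by rwa [hA0]⟩
  obtain ⟨S, hScard, hS⟩ := hLA.bl.zeros (w := 0) (by simp)
  have hr2 : 0 < r/2 := by linarith
  have hbx : ∀ x ∈ ball y r, ball x (r/2) ⊆ ball z₀ ρ \ {z₀} := fun x hx =>
    (ball_subset_ball' (by rw [mem_ball] at hx; linarith)).trans hb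
  -- every point of A close to a is close to a zero
  have hclose : ∀ p ∈ A, ‖p - a‖ ≤ ε → ∃ ζ ∈ S, ‖ΦA ζ - p‖ ≤ ε / (4 * (D + 1)) := by
    intro p hp hpa
    have hpO := hAo p hp
    obtain ⟨Φ, Q, hL, h0⟩ := H.struct hr2 (hbx _ hpO) (hG2 _ hpO) (a := p) (mem_ball_self hr2)
    rw [← h0] at hL
    obtain ⟨Z, hZ, w, hwZ, hw⟩ := hch n (r/2) (ball y r) hr2 isOpen_ball (convex_ball _ _)
      (fun x hx => ⟨hG2 x hx, hbx x hx⟩) Φ Q hL (by rw [h0]; exact hpO) y (mem_ball_self hr) (by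
        rw [h0, ← dist_eq_norm, dist_comm]; rw [mem_ball] at hpO; push_cast; linarith)
    have hZin := hLA.contains H.hf hr hZ.1 hZ.2.2.1 (by
      obtain ⟨ζ, hζ, e⟩ := hAin hp
      exact ⟨ζ, hζ, by rw [e, ← h0]; exact hZ.2.1⟩)
    obtain ⟨ζ, hζ, e⟩ := hZin hwZ
    refine ⟨ζ, hS ζ hζ ?_, ?_⟩
    · have := hLA.comm ζ hζ
      rw [e, hw] at this
      have hRc : (r:ℂ) ≠ 0 := by exact_mod_cast hr.ne'
      simpa [hRc] using this
    · rw [e]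
      have h1 := (hZ.2.2.2 w hwZ).1
      rw [h0] at h1
      have h2 : ‖deriv Φ 0‖ < ε / (4 * (D + 1) * C) := by
        by_contra h
        push Not at h
        refine hcon ⟨Φ, Q, hL, ?_, by rw [h0]; exact hpO, h⟩
        rw [h0]
        have := norm_add_le (p - a) a
        rw [sub_add_cancel] at this
        linarith
      refine h1.trans ?_
      calc C * ‖deriv Φ 0‖ ≤ C * (ε / (4 * (D + 1) * C)) := by gcongr
        _ = _ := by field_simp
  have hcirc : ∀ k : Fin (D+1), ∃ p ∈ A, ‖p - a‖ = ε * k / (D+1) := by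
    intro k
    have hk : (k:ℝ) < D + 1 := by exact_mod_cast k.2
    have hle : ε * k / (D+1) ≤ ε := by rw [div_le_iff₀ (by positivity)]; nlinarith
    obtain ⟨w, hw, hw'⟩ := exists_on_circle (Z := (fun z => z - a) '' A) (z := b - a) (r := ε * k / (D+1))
      (hA.image _ (by fun_prop)) ⟨a, ha, by simp⟩ ⟨b, hbA, rfl⟩ (by positivity) (by rw [norm_sub_rev]; linarith)
    obtain ⟨p, hp, rfl⟩ := hw
    exact ⟨p, hp, hw'⟩
  choose p hpA hp using hcirc
  have hle : ∀ k : Fin (D+1), ε * k / (D+1) ≤ ε := by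
    intro k
    have hk : (k:ℝ) < D + 1 := by exact_mod_cast k.2
    rw [div_le_iff₀ (by positivity)]; nlinarith
  choose ζ hζS hζ using fun k => hclose (p k) (hpA k) (by rw [hp k]; exact hle k)
  obtain ⟨k, -, l, -, hkl, he⟩ := Finset.exists_ne_map_eq_of_card_lt_of_maps_to (s := (Finset.univ : Finset (Fin (D+1)))) (t := S)
    (by simp; omega) (f := ζ) (fun k _ => hζS k)
  have h1 := hζ k
  have h2 := hζ l
  rw [he] at h1
  have h3 : ‖p k - p l‖ ≤ 2 * (ε / (4 * (D+1))) := by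
    have := norm_sub_le (ΦA (ζ l) - p l) (ΦA (ζ l) - p k)
    rw [sub_sub_sub_cancel_left] at this
    linarith
  have h4 := abs_norm_sub_norm_le (p k - a) (p l - a)
  rw [hp, hp, sub_sub_sub_cancel_right] at h4
  have h5 : (1:ℝ) ≤ |(k:ℝ) - l| := by
    have : (1:ℤ) ≤ |(k:ℤ) - l| := Int.one_le_abs (by
      intro h; apply hkl; ext; omega)
    exact_mod_cast this
  have h6 : |ε * k / (D+1) - ε * l / (D+1)| = ε / (D+1) * |(k:ℝ) - l| := by
    rw [show ε * k / (D+1) - ε * l / (D+1) = ε / (D+1) * ((k:ℝ) - l) by ring, abs_mul, abs_of_pos (by positivity)]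
  rw [h6] at h4
  have h7 : 0 < ε / (D+1) := by positivity
  have h8 : 2 * (ε / (4 * (D+1))) = ε / (D+1) / 2 := by field_simp; norm_num
  nlinarith

/-- core data. -/
def Core (f : ℂ → ℂ) (M ε : ℝ) (n : ℕ) (y : ℂ) (r T η₀ η₁ M₁ : ℝ) : Prop :=
  ∃ a : ℂ, ‖a‖ ≤ M + ε ∧ f^[n] a ∈ ball y r ∧ (∀ j ≤ n, Sm M ε (f^[j] '' ball a η₀)) ∧
    f^[n] '' ball a η₀ ⊆ ball y (2 * r) ∧
    ∀ x ∈ ball y (T * r), ∃ Z : Set ℂ, IsPreconnected Z ∧ a ∈ Z ∧ Z ⊆ ball 0 M₁ ∧ (∃ p ∈ Z, f^[n] p = x) ∧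
      ∀ p ∈ Z, ∀ j ≤ n, Sm M ε (f^[j] '' ball p η₁)

theorem sm_of_lf {f : ℂ → ℂ} {M ε : ℝ} (hf : Differentiable ℂ f) {n D : ℕ} {y : ℂ} {r η : ℝ} {Φ Q : ℂ → ℂ}
    (hr : 0 < r) (hG : Gd f M ε n y r) (hL : Lf f n y r D Φ Q) (hη : η ≤ ‖deriv Φ 0‖ / 192) (hη2 : 2 * η < ε) :
    ∀ j ≤ n, Sm M ε (f^[j] '' ball (Φ 0) η) := by
  intro j hj
  have hsub : ball (Φ 0) η ⊆ Φ '' ball 0 1 :=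
    (ball_subset_ball (by simpa using hη)).trans (koebe_quarter one_pos hL.d hL.i)
  rcases Nat.eq_zero_or_pos j with rfl | hj0
  · rintro _ ⟨u, hu, rfl⟩ _ ⟨v, hv, rfl⟩ -
    simp only [iterate_zero, id]
    rw [mem_ball, dist_eq_norm] at hu hv
    have := norm_sub_le (u - Φ 0) (v - Φ 0)
    rw [sub_sub_sub_cancel_right] at this
    linarith
  · apply hG (n - j) (by omega)
    · exact (convex_ball _ _).isPreconnected.image _ (hf.continuous.iterate j).continuousOn
    · rintro _ ⟨u, hu, rfl⟩
      rw [← iterate_add_apply, Nat.sub_add_cancel hj]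
      obtain ⟨ζ, hζ, rfl⟩ := hsub hu
      exact hL.over hr hζ

theorem Ctx.core {f : ℂ → ℂ} {z₀ : ℂ} {ρ M ε : ℝ} (H : Ctx f z₀ ρ M ε) : ∃ η₀ : ℝ, 0 < η₀ ∧ ∀ T : ℝ, 1 ≤ T → ∃ η₁ > 0, ∃ M₁,
    ∀ n y r, 0 < r → ball y ((T + 1) * r) ⊆ ball z₀ ρ \ {z₀} → Bad f M ε n y r → Gd f M ε n y r →
    (∀ x ∈ ball y (T * r), Gd f M ε n x (r/2)) → Core f M ε n y r T η₀ η₁ M₁ := by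
  obtain ⟨η, hη, hbase⟩ := H.base
  have hε := H.hε
  have hM := H.Mpos
  refine ⟨min (η / 192) (ε / 4), by positivity, fun T hT => ?_⟩
  obtain ⟨L, hL⟩ := exists_nat_ge (64 * T)
  obtain ⟨C, hC, hch⟩ := H.chain L
  refine ⟨min (η / (192 * C)) (ε / 4), by positivity, (M + ε) + C * (192 * (2 * M + ε)) + 1,
    fun n y r hr hb hBad hGd hG2 => ?_⟩
  have hr2 : 0 < r/2 := by linarith
  have hTb : ball y r ⊆ ball y (T * r) := ball_subset_ball (by nlinarith)
  have hbx : ∀ x ∈ ball y (T * r), ball x (r/2) ⊆ ball z₀ ρ \ {z₀} := fun x hx =>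
    (ball_subset_ball' (by rw [mem_ball] at hx; linarith)).trans hb
  obtain ⟨Φ, Q, hLf, hn0, hov, hs⟩ := hbase n y r hr ((ball_subset_ball (by nlinarith)).trans hb) hBad hGd
    (fun x hx => hG2 x (hTb hx))
  have hovT := hTb hov
  refine ⟨Φ 0, hn0, hov, ?_, ?_, ?_⟩
  · apply sm_of_lf H.hf hr2 (hG2 _ hovT) hLf
    · exact (min_le_left _ _).trans (by gcongr)
    · have := min_le_right (η/192) (ε/4); linarith
  · rintro _ ⟨u, hu, rfl⟩
    have hsub := (koebe_quarter one_pos hLf.d hLf.i)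
    have hu2 := hsub (ball_subset_ball ((min_le_left (η/192) (ε/4)).trans (by rw [mul_one]; gcongr)) hu)
    obtain ⟨ζ, hζ, rfl⟩ := hu2
    have h1 := hLf.over hr2 hζ
    refine ball_subset_ball' ?_ h1
    rw [mem_ball] at hov; linarith
  · intro x hx
    have hlen : ‖x - f^[n] (Φ 0)‖ ≤ L * (r/2/16) := by
      rw [← dist_eq_norm]
      have h1 := dist_triangle_right x (f^[n] (Φ 0)) y
      rw [mem_ball] at hx hovT
      nlinarith
    obtain ⟨Z, hZ, b, hb1, hb2⟩ := hch n (r/2) (ball y (T*r)) hr2 isOpen_ball (convex_ball _ _)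
      (fun x hx => ⟨hG2 x hx, hbx x hx⟩) Φ Q hLf hovT x hx hlen
    have hup : ‖deriv Φ 0‖ ≤ 192 * (2 * M + ε) := by
      have h1 := koebe_avoid one_pos hLf.d hLf.i (H.avoids hr2 (hbx _ hovT) hLf)
      have h2 := norm_sub_le (Φ 0) z₀
      have := H.hz
      linarith
    refine ⟨Z, hZ.1, hZ.2.1, ?_, ⟨b, hb1, hb2⟩, ?_⟩
    · intro p hp
      rw [mem_ball_zero_iff]
      have h1 := (hZ.2.2.2 p hp).1
      have h2 := norm_add_le (p - Φ 0) (Φ 0)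
      rw [sub_add_cancel] at h2
      have : C * ‖deriv Φ 0‖ ≤ C * (192 * (2 * M + ε)) := by gcongr
      linarith
    · intro p hp
      obtain ⟨-, Ψ, P, hΨ, hΨ0, -, hs2⟩ := hZ.2.2.2 p hp
      have := hZ.2.2.1 p hp
      rw [← hΨ0]
      apply sm_of_lf H.hf hr2 (hG2 _ this) hΨ
      · refine (min_le_left _ _).trans ?_
        rw [div_le_div_iff₀ (by positivity) (by positivity)]
        nlinarith
      · have := min_le_right (η/(192 * C)) (ε/4); linarith


theorem not_gd {f : ℂ → ℂ} {M ε : ℝ} {n : ℕ} {y : ℂ} {r : ℝ} (h : ¬ Gd f M ε n y r) : ∃ j < n, Bad f M ε j y r := by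
  unfold Gd at h
  push Not at h
  obtain ⟨j, hj, A, h1, h2, h3⟩ := h
  exact ⟨j, hj, A, h1, h2, h3⟩

theorem Bad.not_gd {f : ℂ → ℂ} {M ε : ℝ} {n : ℕ} {y : ℂ} {r : ℝ} (h : Bad f M ε n y r) {N : ℕ} (hG : Gd f M ε N y r) :
    N ≤ n := by
  by_contra hlt
  push Not at hlt
  obtain ⟨A, h1, h2, h3⟩ := h
  exact h3 (hG n hlt A h1 h2)

theorem regress {f : ℂ → ℂ} {M ε T : ℝ} (hT : 1 ≤ T) (n : ℕ) : ∀ y r, 0 < r → Bad f M ε n y r →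
    ∃ n' ≤ n, ∃ y' r', 0 < r' ∧ r' ≤ r ∧ dist y' y ≤ 2 * T * r ∧ Bad f M ε n' y' r' ∧ Gd f M ε n' y' r' ∧
      ∀ x ∈ ball y' (T * r'), Gd f M ε n' x (r' / 2) := by
  induction n using Nat.strong_induction_on with
  | _ n ih =>
    intro y r hr hB
    by_cases h1 : Gd f M ε n y r
    · by_cases h2 : ∀ x ∈ ball y (T * r), Gd f M ε n x (r/2)
      · exact ⟨n, le_rfl, y, r, hr, le_rfl, by rw [dist_self]; positivity, hB, h1, h2⟩
      · push Not at h2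
        obtain ⟨x, hx, hx2⟩ := h2
        obtain ⟨j, hj, hjB⟩ := _root_.not_gd hx2
        obtain ⟨n', hn', y', r', h3, h4, h5, h6⟩ := ih j hj x (r/2) (by linarith) hjB
        refine ⟨n', by omega, y', r', h3, by linarith, ?_, h6⟩
        rw [mem_ball] at hx
        have := dist_triangle y' x y
        linarith
    · obtain ⟨j, hj, hjB⟩ := _root_.not_gd h1
      obtain ⟨n', hn', h⟩ := ih j hj y r hr hjB
      exact ⟨n', by omega, h⟩

theorem Ctx.cores {f : ℂ → ℂ} {z₀ : ℂ} {ρ M ε : ℝ} (H : Ctx f z₀ ρ M ε) : ∃ η₀ : ℝ, 0 < η₀ ∧ ∃ η₁ M₁ : ℝ → ℝ,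
    (∀ T, 1 ≤ T → 0 < η₁ T) ∧ ∀ K : ℕ, ∃ (Ts : ℕ → ℝ) (Λ : ℝ), 1 ≤ Λ ∧ (∀ k, 1 ≤ Ts k) ∧
    ∀ y r n, 0 < r → Bad f M ε n y r → ball y (Λ * r) ⊆ ball z₀ ρ \ {z₀} → ∃ (Y : ℕ → ℂ) (R : ℕ → ℝ) (N : ℕ → ℕ),
      (∀ k < K, 0 < R k ∧ N k ≤ n ∧ Bad f M ε (N k) (Y k) (R k) ∧ ball (Y k) (2 * R k) ⊆ ball y (Λ * r) ∧
        Core f M ε (N k) (Y k) (R k) (Ts k) η₀ (η₁ (Ts k)) (M₁ (Ts k))) ∧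
      ∀ k l, k < l → l < K → N l < N k ∧ ball (Y l) (R l) ⊆ ball (Y k) (Ts k * R k) := by
  obtain ⟨η₀, hη₀, hcore⟩ := H.core
  have hcore' : ∀ T : ℝ, ∃ η₁ M₁ : ℝ, 1 ≤ T → 0 < η₁ ∧
    ∀ n y r, 0 < r → ball y ((T + 1) * r) ⊆ ball z₀ ρ \ {z₀} → Bad f M ε n y r → Gd f M ε n y r →
    (∀ x ∈ ball y (T * r), Gd f M ε n x (r/2)) → Core f M ε n y r T η₀ η₁ M₁ := by
    intro T
    by_cases hT : 1 ≤ T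
    · obtain ⟨a, b, c, d⟩ := hcore T hT
      exact ⟨a, c, fun _ => ⟨b, d⟩⟩
    · exact ⟨0, 0, fun h => absurd h hT⟩
  choose η₁ M₁ hc using hcore'
  obtain ⟨C, hC, hstep⟩ := H.step
  refine ⟨η₀, hη₀, η₁, M₁, fun T hT => (hc T hT).1, fun K => ?_⟩
  induction K with
  | zero => exact ⟨fun _ => 1, 1, le_rfl, fun _ => le_rfl, fun y r n _ _ _ => ⟨fun _ => 0, fun _ => 0, fun _ => 0, by simp, by simp⟩⟩
  | succ K ih =>
    obtain ⟨Ts, Λ, hΛ, hTs, hK⟩ := ih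
    set T := C * Λ with hT
    have hT1 : 1 ≤ T := by rw [hT]; nlinarith
    refine ⟨fun k => Nat.casesOn k T Ts, 3 * T + 2, by linarith, fun k => by cases k with
      | zero => exact hT1
      | succ k => exact hTs k, fun y r n hr hB hb => ?_⟩
    obtain ⟨n0, hn0, y0, r0, hr0, hr0r, hd, hB0, hG0, hG2⟩ := regress hT1 n y r hr hB
    have hTr : T * r0 ≤ T * r := by gcongr
    have hb1 : ball y0 ((T + 1) * r0) ⊆ ball y ((3 * T + 2) * r) := ball_subset_ball' (by nlinarith)
    have hb2 : ball y0 (T * r0) ⊆ ball y0 ((T + 1) * r0) := ball_subset_ball (by nlinarith)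
    have hb3 : ball y0 (C * r0) ⊆ ball y0 (T * r0) := ball_subset_ball (by rw [hT]; gcongr; nlinarith)
    have hCore0 := (hc T hT1).2 n0 y0 r0 hr0 (hb1.trans hb) hB0 hG0 hG2
    obtain ⟨n', hn', hB'⟩ : ∃ n' < n0, Bad f M ε n' y0 (C * r0) := by
      apply _root_.not_gd
      intro hG
      have := hB0.not_gd (hstep y0 r0 n0 hr0 (hb3.trans (hb2.trans (hb1.trans hb))) hG)
      omega
    have hTe : Λ * (C * r0) = T * r0 := by rw [hT]; ring
    obtain ⟨Y, R, N, h1, h2⟩ := hK y0 (C * r0) n' (by positivity) hB' (by rw [hTe]; exact hb2.trans (hb1.trans hb))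
    rw [hTe] at h1
    refine ⟨fun k => Nat.casesOn k y0 Y, fun k => Nat.casesOn k r0 R, fun k => Nat.casesOn k n0 N, ?_, ?_⟩
    · intro k hk
      cases k with
      | zero =>
        refine ⟨hr0, hn0, hB0, ?_, hCore0⟩
        exact (ball_subset_ball (show 2 * r0 ≤ (T+1) * r0 by nlinarith)).trans hb1
      | succ k =>
        obtain ⟨e1, e2, e3, e4, e5⟩ := h1 k (by omega)
        exact ⟨e1, by dsimp only; omega, e3, e4.trans (hb2.trans hb1), e5⟩
    · intro k l hkl hl
      cases l with
      | zero => omega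
      | succ l =>
        cases k with
        | zero =>
          obtain ⟨e1, e2, e3, e4, e5⟩ := h1 l (by omega)
          exact ⟨show N l < n0 by omega, (ball_subset_ball (by linarith)).trans e4⟩
        | succ k => exact h2 k l (by omega) (by omega)

/-- the per-scale outcome if Claim M fails. -/
theorem Ctx.percore {f : ℂ → ℂ} {z₀ : ℂ} {ρ M ε : ℝ} (H : Ctx f z₀ ρ M ε)
    (hfail : ∀ C ρ' : ℝ, 1 ≤ C → 0 < ρ' → ∃ y n, y ∈ ball z₀ ρ' ∧ y ≠ z₀ ∧ ¬ Gd f M ε n y (dist y z₀ / C)) :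
    ∃ (E : Finset ℂ) (η η₁ M₁ : ℝ), 0 < η ∧ 0 < η₁ ∧ ∀ τ > 0, ∀ N₀ : ℕ, ∃ e ∈ E, ∃ n n' : ℕ, N₀ ≤ n ∧ n < n' ∧
      f^[n] '' ball e η ⊆ ball z₀ τ ∧ (∀ j ≤ n', Sm M ε (f^[j] '' ball e η)) ∧ ∃ Z : Set ℂ, IsPreconnected Z ∧ Z ⊆ ball 0 M₁ ∧
      (Z ∩ ball e η).Nonempty ∧ (∀ p ∈ Z, ∀ j ≤ n', Sm M ε (f^[j] '' ball p η₁)) ∧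
      ∃ u ∈ Z, ∃ v ∈ ball e η, f^[n'] u = f^[n] v := by
  obtain ⟨η₀, hη₀, η₁, M₁, hη₁, hcores⟩ := H.cores
  obtain ⟨E, -, hE⟩ := (isCompact_closedBall (0:ℂ) (M + ε)).elim_finite_subcover_image (b := univ) (c := fun e => ball e (η₀/2))
    (fun _ _ => isOpen_ball) (fun z _ => mem_biUnion (mem_univ z) (mem_ball_self (by positivity)))
  obtain ⟨hEf, hE⟩ := hE
  set K := hEf.toFinset.card + 1 with hKdef
  obtain ⟨Ts, Λ, hΛ, hTs, hK⟩ := hcores K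
  have hne : (Finset.range K).Nonempty := ⟨0, by simp [hKdef]⟩
  refine ⟨hEf.toFinset, η₀/2, (Finset.range K).inf' hne (fun k => η₁ (Ts k)), (Finset.range K).sup' hne (fun k => M₁ (Ts k)),
    by positivity, ?_, fun τ hτ N₀ => ?_⟩
  · rw [Finset.lt_inf'_iff]; exact fun k _ => hη₁ _ (hTs k)
  obtain ⟨r0, hr0, hnear⟩ := gd_near H.hf H.hnc M H.hε z₀ N₀
  set τ' := min (min τ r0) ρ with hτ'
  have hρ := H.hρ
  have hτ0 : 0 < τ' := by positivity
  obtain ⟨y, n, hy, hyz, hnG⟩ := hfail Λ (τ'/2) hΛ (by positivity)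
  obtain ⟨j, -, hB⟩ := _root_.not_gd hnG
  have hd : 0 < dist y z₀ := dist_pos.2 hyz
  have hΛd : Λ * (dist y z₀ / Λ) = dist y z₀ := by field_simp
  rw [mem_ball] at hy
  have hbb : ball y (dist y z₀) ⊆ ball z₀ τ' := ball_subset_ball' (by linarith)
  have hb1 : ball y (dist y z₀) ⊆ ball z₀ ρ \ {z₀} := by
    intro w hw
    refine ⟨ball_subset_ball (min_le_right _ _) (hbb hw), ?_⟩
    rintro rfl
    rw [mem_ball, dist_comm] at hw
    exact lt_irrefl _ hw
  obtain ⟨Y, R, N, h1, h2⟩ := hK y (dist y z₀ / Λ) j (by positivity) hB (by rw [hΛd]; exact hb1)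
  rw [hΛd] at h1
  have h1' : ∀ k : ℕ, ∃ a : ℂ, k < K → ‖a‖ ≤ M + ε ∧ f^[N k] a ∈ ball (Y k) (R k) ∧ (∀ j ≤ N k, Sm M ε (f^[j] '' ball a η₀)) ∧
    f^[N k] '' ball a η₀ ⊆ ball (Y k) (2 * R k) ∧
    ∀ x ∈ ball (Y k) (Ts k * R k), ∃ Z : Set ℂ, IsPreconnected Z ∧ a ∈ Z ∧ Z ⊆ ball 0 (M₁ (Ts k)) ∧ (∃ p ∈ Z, f^[N k] p = x) ∧
      ∀ p ∈ Z, ∀ j ≤ N k, Sm M ε (f^[j] '' ball p (η₁ (Ts k))) := by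
    intro k
    by_cases hk : k < K
    · obtain ⟨a, ha⟩ := (h1 k hk).2.2.2.2
      exact ⟨a, fun _ => ha⟩
    · exact ⟨0, fun h => absurd h hk⟩
  choose a ha using h1'
  have hnet : ∀ k : ℕ, ∃ e, k < K → e ∈ E ∧ a k ∈ ball e (η₀/2) := by
    intro k
    by_cases hk : k < K
    · obtain ⟨e, he, he'⟩ := mem_iUnion₂.1 (hE (mem_closedBall_zero_iff.2 (ha k hk).1))
      exact ⟨e, fun _ => ⟨he, he'⟩⟩
    · exact ⟨0, fun h => absurd h hk⟩
  choose e he using hnet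
  obtain ⟨k, l, hkl, hl, hel⟩ : ∃ k l, k < l ∧ l < K ∧ e k = e l := by
    obtain ⟨k, hk, l, hl, hkl, h⟩ := Finset.exists_ne_map_eq_of_card_lt_of_maps_to (s := Finset.range K) (t := hEf.toFinset)
      (by simp [hKdef]) (f := e) (fun k hk => by
        have := (he k (by simpa using hk)).1
        simpa using this)
    have hk' : k < K := by simpa using hk
    have hl' : l < K := by simpa using hl
    rcases lt_or_gt_of_ne hkl with h' | h'
    · exact ⟨k, l, h', hl', h⟩
    · exact ⟨l, k, h', hk', h.symm⟩
  have hk : k < K := hkl.trans hl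
  obtain ⟨a1, a2, a3, a4, a5⟩ := ha k hk
  obtain ⟨b1, b2, b3, b4, b5⟩ := ha l hl
  obtain ⟨c1, c2⟩ := he k hk
  obtain ⟨d1, d2⟩ := he l hl
  obtain ⟨g1, g2⟩ := h2 k l hkl hl
  obtain ⟨Z, z1, z2, z3, ⟨p, z4, z5⟩, z6⟩ := a5 _ (g2 b2)
  rw [← hel] at d2
  have hsk : ball (e k) (η₀/2) ⊆ ball (a k) η₀ := ball_subset_ball' (by rw [mem_ball, dist_comm] at c2; linarith)
  have hsl : ball (e k) (η₀/2) ⊆ ball (a l) η₀ := ball_subset_ball' (by rw [mem_ball, dist_comm] at d2; linarith)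
  obtain ⟨q1, q2, q3, q4, q5⟩ := h1 l hl
  refine ⟨e k, by simpa using c1, N l, N k, ?_, g1, ?_, fun j hj => (a3 j hj).mono (image_mono hsk), Z, z1, ?_, ⟨a k, z2, c2⟩, ?_,
    p, z4, a l, d2, z5⟩
  · apply q3.not_gd
    apply hnear
    refine (ball_subset_ball (by linarith)).trans (q4.trans (hbb.trans (ball_subset_ball ?_)))
    exact (min_le_left _ _).trans (min_le_right _ _)
  · refine (image_mono hsl).trans (b4.trans (q4.trans (hbb.trans (ball_subset_ball ?_))))
    exact (min_le_left _ _).trans (min_le_left _ _)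
  · exact z3.trans (ball_subset_ball (Finset.le_sup' (fun k => M₁ (Ts k)) (by simpa using hk)))
  · intro p hp j hj
    exact (z6 p hp j hj).mono (image_mono (ball_subset_ball (Finset.inf'_le (fun k => η₁ (Ts k)) (by simpa using hk))))


def Fs (f : ℂ → ℂ) (M ε : ℝ) : Set ℂ := {p | ∃ η > 0, ∀ j, Sm M ε (f^[j] '' ball p η)}

theorem Fs_open (f : ℂ → ℂ) (M ε : ℝ) : IsOpen (Fs f M ε) := by
  rw [Metric.isOpen_iff]
  rintro p ⟨η, hη, h⟩
  refine ⟨η/2, by positivity, fun q hq => ⟨η/2, by positivity, fun j => (h j).mono (image_mono (ball_subset_ball' ?_))⟩⟩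
  rw [mem_ball] at hq; linarith

theorem Fs_map {f : ℂ → ℂ} {M ε : ℝ} (hop : IsOpenMap f) : MapsTo f (Fs f M ε) (Fs f M ε) := by
  rintro p ⟨η, hη, h⟩
  obtain ⟨δ, hδ, hs⟩ := Metric.isOpen_iff.1 (hop _ (isOpen_ball (x := p) (ε := η))) (f p) ⟨p, mem_ball_self hη, rfl⟩
  refine ⟨δ, hδ, fun j => (h (j+1)).mono ?_⟩
  rintro _ ⟨w, hw, rfl⟩
  obtain ⟨z, hz, rfl⟩ := hs hw
  exact ⟨z, hz, by rw [iterate_succ_apply]⟩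

theorem Ctx.fatou {f : ℂ → ℂ} {z₀ : ℂ} {ρ M ε : ℝ} (H : Ctx f z₀ ρ M ε)
    (hfail : ∀ C ρ' : ℝ, 1 ≤ C → 0 < ρ' → ∃ y n, y ∈ ball z₀ ρ' ∧ y ≠ z₀ ∧ ¬ Gd f M ε n y (dist y z₀ / C)) :
    ∃ U : Set ℂ, IsOpen U ∧ IsPreconnected U ∧ U ⊆ Fs f M ε ∧ ∃ e η, 0 < η ∧ ball e η ⊆ U ∧
      ∀ τ > 0, ∀ N₀ : ℕ, ∃ n n' : ℕ, N₀ ≤ n ∧ n < n' ∧ f^[n] '' ball e η ⊆ ball z₀ τ ∧ ∃ u ∈ U, ∃ v ∈ U, f^[n'] u = f^[n] v := by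
  classical
  obtain ⟨E, η, η₁, M₁, hη, hη₁, hpc⟩ := H.percore hfail
  obtain ⟨Y, -, hYf, hY⟩ := (isCompact_closedBall (0:ℂ) M₁).elim_finite_subcover_image (b := univ) (c := fun e => ball e (η₁/4))
    (fun _ _ => isOpen_ball) (fun z _ => mem_biUnion (mem_univ z) (mem_ball_self (by positivity)))
  have hpc' : ∀ i : ℕ, _ := fun i => hpc (1/(i+1)) (by positivity) i
  choose e heE n n' hn hnn hne hse Z hZ hZM hZe hsZ u hu v hv huv using hpc'
  have : Finite Y := hYf
  let col : ℕ → E × Set Y := fun i => (⟨e i, heE i⟩, {y | ∃ z ∈ Z i, dist z y < η₁/4})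
  obtain ⟨⟨e0, G⟩, hinf⟩ := Finite.exists_infinite_fiber col
  have hI : ∀ N, ∃ i ≥ N, e i = e0 ∧ ∀ y : Y, y ∈ G ↔ ∃ z ∈ Z i, dist z (y:ℂ) < η₁/4 := by
    intro N
    have h1 : (col ⁻¹' {(e0, G)}).Infinite := Set.infinite_coe_iff.1 hinf
    obtain ⟨i, hi, hiN⟩ := h1.exists_gt N
    have hi' : col i = (e0, G) := hi
    simp only [col, Prod.mk.injEq] at hi'
    refine ⟨i, hiN.le, ?_, fun y => ?_⟩
    · rw [← hi'.1]
    · rw [← hi'.2]; rfl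
  set U : Set ℂ := ball (e0:ℂ) η ∪ ⋃ y ∈ G, ball (y:ℂ) (η₁/4) with hU
  have hZU : ∀ i, (∀ y : Y, y ∈ G ↔ ∃ z ∈ Z i, dist z (y:ℂ) < η₁/4) → Z i ⊆ U := by
    intro i hi z hz
    obtain ⟨y, hy, hzy⟩ := mem_iUnion₂.1 (hY (ball_subset_closedBall (hZM i hz)))
    right
    exact mem_biUnion (show (⟨y, hy⟩ : Y) ∈ G from (hi _).2 ⟨z, hz, hzy⟩) hzy
  refine ⟨U, isOpen_ball.union (isOpen_biUnion fun _ _ => isOpen_ball), ?_, ?_, e0, η, hη, subset_union_left, ?_⟩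
  · obtain ⟨i, -, hie, hi⟩ := hI 0
    obtain ⟨x, hxZ, hxe⟩ := hZe i
    rw [hie] at hxe
    set c : Set (Set ℂ) := {S | S = Z i ∪ ball (e0:ℂ) η ∨ ∃ y ∈ G, S = Z i ∪ ball (y:ℂ) (η₁/4)} with hc
    have h1 : IsPreconnected (⋃₀ c) := by
      apply isPreconnected_sUnion x
      · rintro S (rfl | ⟨y, -, rfl⟩)
        · exact Or.inl hxZ
        · exact Or.inl hxZ
      · rintro S (rfl | ⟨y, hy, rfl⟩)
        · exact (hZ i).union x hxZ hxe (convex_ball _ _).isPreconnected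
        · obtain ⟨z, hz, hzy⟩ := (hi y).1 hy
          exact (hZ i).union z hz hzy (convex_ball _ _).isPreconnected
    have h2 : ⋃₀ c = U := by
      apply subset_antisymm
      · rintro w ⟨S, (rfl | ⟨y, hy, rfl⟩), hw | hw⟩
        · exact hZU i hi hw
        · exact Or.inl hw
        · exact hZU i hi hw
        · exact Or.inr (mem_biUnion hy hw)
      · rintro w (hw | hw)
        · exact ⟨_, Or.inl rfl, Or.inr hw⟩
        · obtain ⟨y, hy, hw⟩ := mem_iUnion₂.1 hw
          exact ⟨_, Or.inr ⟨y, hy, rfl⟩, Or.inr hw⟩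
    rwa [h2] at h1
  · rintro p (hp | hp)
    · obtain ⟨δ, hδ, hs⟩ := Metric.isOpen_iff.1 isOpen_ball p hp
      refine ⟨δ, hδ, fun j => ?_⟩
      obtain ⟨i, hij, hie, -⟩ := hI j
      have := hse i j (by have := hn i; have := hnn i; omega)
      rw [hie] at this
      exact this.mono (image_mono hs)
    · obtain ⟨y, hy, hp⟩ := mem_iUnion₂.1 hp
      refine ⟨η₁/2, by positivity, fun j => ?_⟩
      obtain ⟨i, hij, -, hi⟩ := hI j
      obtain ⟨z, hz, hzy⟩ := (hi y).1 hy
      refine (hsZ i z hz j (by have := hn i; have := hnn i; omega)).mono (image_mono (ball_subset_ball' ?_))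
      rw [mem_ball] at hp
      have := dist_triangle_right p z y
      linarith
  · intro τ hτ N₀
    obtain ⟨k, hk⟩ := exists_nat_one_div_lt hτ
    obtain ⟨i, hiN, hie, hi⟩ := hI (max N₀ k)
    have hin : N₀ ≤ n i := (le_max_left _ _).trans (hiN.trans (hn i))
    refine ⟨n i, n' i, hin, hnn i, ?_, u i, hZU i hi (hu i), v i, Or.inl (by rw [← hie]; exact hv i), huv i⟩
    have h1 := hne i
    rw [hie] at h1
    refine h1.trans (ball_subset_ball ?_)
    have : (k:ℝ) ≤ i := by exact_mod_cast (le_max_right _ _).trans hiN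
    have : (1:ℝ) / (i + 1) ≤ 1 / (k + 1) := by gcongr
    linarith

theorem Ctx.basin {f : ℂ → ℂ} {z₀ : ℂ} {ρ M ε : ℝ} (H : Ctx f z₀ ρ M ε)
    (hfail : ∀ C ρ' : ℝ, 1 ≤ C → 0 < ρ' → ∃ y n, y ∈ ball z₀ ρ' ∧ y ≠ z₀ ∧ ¬ Gd f M ε n y (dist y z₀ / C))
    {q : ℕ} (hq : 1 ≤ q) :
    ∃ (W : Set ℂ) (m : ℕ), 1 ≤ m ∧ IsOpen W ∧ IsPreconnected W ∧ W ⊆ Fs f M ε ∧ MapsTo (f^[q * m]) W W ∧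
      ∃ x η, 0 < η ∧ ball x η ⊆ W ∧ ∀ τ > 0, ∀ N₀ : ℕ, ∃ k ≥ N₀, (f^[q * m])^[k] '' ball x η ⊆ ball z₀ τ := by
  obtain ⟨U, hUo, hUc, hUF, e, η, hη, heU, hseq⟩ := H.fatou hfail
  have hop := isOpenMap_of_hnc H.hf H.hnc
  have hcont := H.hf.continuous
  have hFm : ∀ j, MapsTo (f^[j]) (Fs f M ε) (Fs f M ε) := fun j => (Fs_map hop).iterate j
  obtain ⟨n, n', -, hnn, -, u, hu, v, hv, huv⟩ := hseq 1 one_pos 0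
  have heU' : e ∈ U := heU (mem_ball_self hη)
  set m := n' - n with hm
  set Ω := connectedComponentIn (Fs f M ε) (f^[n] e) with hΩ
  have hneF : f^[n] e ∈ Fs f M ε := hFm n (hUF heU')
  have hUΩ : f^[n] '' U ⊆ Ω := (hUc.image _ (hcont.iterate n).continuousOn).subset_connectedComponentIn
    ⟨e, heU', rfl⟩ (by rintro _ ⟨w, hw, rfl⟩; exact hFm n (hUF hw))
  have hΩF : Ω ⊆ Fs f M ε := connectedComponentIn_subset _ _
  have hΩc : IsPreconnected Ω := isPreconnected_connectedComponentIn
  have hmΩ : MapsTo (f^[m]) Ω Ω := by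
    have h1 : f^[m] (f^[n] u) ∈ Ω := by
      rw [← iterate_add_apply, show m + n = n' by omega, huv]
      exact hUΩ ⟨v, hv, rfl⟩
    have h2 : f^[m] '' Ω ⊆ connectedComponentIn (Fs f M ε) (f^[m] (f^[n] u)) :=
      (hΩc.image _ (hcont.iterate m).continuousOn).subset_connectedComponentIn ⟨_, hUΩ ⟨u, hu, rfl⟩, rfl⟩
        (by rintro _ ⟨w, hw, rfl⟩; exact hFm m (hΩF hw))
    rw [← connectedComponentIn_eq h1] at h2
    exact mapsTo_iff_image_subset.2 h2
  set P := q * m with hP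
  have hm1 : 1 ≤ m := by omega
  have hP1 : 1 ≤ P := Nat.one_le_iff_ne_zero.2 (Nat.mul_ne_zero (by omega) (by omega))
  have hPΩ : MapsTo (f^[P]) Ω Ω := by
    rw [hP, mul_comm, iterate_mul]; exact hmΩ.iterate q
  -- residue classes
  have hseq' : ∀ i : ℕ, ∃ n1 : ℕ, n + P * i ≤ n1 ∧ f^[n1] '' ball e η ⊆ ball z₀ (1/(i+1)) := by
    intro i
    obtain ⟨n1, -, h1, -, h2, -⟩ := hseq (1/(i+1)) (by positivity) (n + P * i)
    exact ⟨n1, h1, h2⟩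
  choose n1 hn1 hn1b using hseq'
  let col : ℕ → Fin P := fun i => ⟨(n1 i - n) % P, Nat.mod_lt _ (by omega)⟩
  obtain ⟨s, hinf⟩ := Finite.exists_infinite_fiber col
  have hinf' : (col ⁻¹' {s}).Infinite := Set.infinite_coe_iff.1 hinf
  set x0 := f^[s.1] (f^[n] e) with hx0
  have hx0F : x0 ∈ Fs f M ε := hFm _ hneF
  set W := connectedComponentIn (Fs f M ε) x0 with hW
  have hWF : W ⊆ Fs f M ε := connectedComponentIn_subset _ _
  have hWc : IsPreconnected W := isPreconnected_connectedComponentIn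
  have hWo : IsOpen W := (Fs_open f M ε).connectedComponentIn
  have hΩW : f^[s.1] '' Ω ⊆ W := (hΩc.image _ (hcont.iterate _).continuousOn).subset_connectedComponentIn
    ⟨_, mem_connectedComponentIn hneF, rfl⟩ (by rintro _ ⟨w, hw, rfl⟩; exact hFm _ (hΩF hw))
  have hPW : MapsTo (f^[P]) W W := by
    have h1 : f^[P] x0 ∈ W := by
      rw [hx0, ← iterate_add_apply, add_comm, iterate_add_apply]
      exact hΩW ⟨_, hPΩ (mem_connectedComponentIn hneF), rfl⟩
    have h2 : f^[P] '' W ⊆ connectedComponentIn (Fs f M ε) (f^[P] x0) :=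
      (hWc.image _ (hcont.iterate _).continuousOn).subset_connectedComponentIn ⟨_, mem_connectedComponentIn hx0F, rfl⟩
        (by rintro _ ⟨w, hw, rfl⟩; exact hFm _ (hWF hw))
    rw [← connectedComponentIn_eq h1] at h2
    exact mapsTo_iff_image_subset.2 h2
  have hopI : IsOpen (f^[s.1] '' (f^[n] '' ball e η)) := isOpenMap_iter hop _ _ (isOpenMap_iter hop _ _ isOpen_ball)
  obtain ⟨δ, hδ, hδs⟩ := Metric.isOpen_iff.1 hopI x0 ⟨_, ⟨e, mem_ball_self hη, rfl⟩, rfl⟩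
  refine ⟨W, m, hm1, hWo, hWc, hWF, hPW, x0, δ, hδ, ?_, fun τ hτ N₀ => ?_⟩
  · exact hδs.trans ((image_mono ((image_mono heU).trans hUΩ)).trans hΩW)
  · obtain ⟨k, hk⟩ := exists_nat_one_div_lt hτ
    obtain ⟨i, hi, hiN⟩ := hinf'.exists_gt (max N₀ k)
    have hi' : (n1 i - n) % P = s.1 := congrArg Fin.val (show col i = s from hi)
    have hdm := Nat.div_add_mod (n1 i - n) P
    rw [hi'] at hdm
    have hge : i ≤ (n1 i - n) / P := by
      rw [Nat.le_div_iff_mul_le (by omega)]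
      have := hn1 i
      rw [mul_comm]; omega
    refine ⟨(n1 i - n) / P, ?_, ?_⟩
    · have := le_max_left N₀ k
      omega
    · rintro _ ⟨w, hw, rfl⟩
      obtain ⟨_, ⟨w, hw1, rfl⟩, rfl⟩ := hδs hw
      rw [← iterate_mul, ← iterate_add_apply, ← iterate_add_apply]
      have h3 : P * ((n1 i - n) / P) + s.1 + n = n1 i := by
        have h4 : n ≤ n1 i := le_trans (Nat.le_add_right _ _) (hn1 i)
        omega
      change f^[P * ((n1 i - n) / P) + s.1 + n] w ∈ _
      rw [h3]
      refine ball_subset_ball ?_ (hn1b i ⟨w, hw1, rfl⟩)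
      have : (k:ℝ) ≤ i := by exact_mod_cast ((le_max_right _ _).trans hiN.le)
      have : (1:ℝ) / (i + 1) ≤ 1 / (k + 1) := by gcongr
      linarith


/-- Montel's theorem along an ultrafilter. -/
theorem montel_um {ι : Type} (V : Ultrafilter ι) (g : ι → ℂ → ℂ) (U : Set ℂ) (hU : IsOpen U)
    (h : ∀ x ∈ U, ∃ r > 0, ∃ B, ∀ᶠ i in (V : Filter ι), DifferentiableOn ℂ (g i) (ball x r) ∧
      ∀ z ∈ ball x r, ‖g i z‖ ≤ B) :
    ∃ G, TendstoLocallyUniformlyOn g G V U ∧ DifferentiableOn ℂ G U := by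
  have h1 : ∀ x, ∃ l, x ∈ U → Tendsto (fun i => g i x) V (nhds l) := by
    intro x
    by_cases hx : x ∈ U
    · obtain ⟨r, hr, B, hB⟩ := h x hx
      have hc : IsCompact (closedBall (0:ℂ) B) := isCompact_closedBall _ _
      obtain ⟨l, -, hl⟩ := hc.ultrafilter_le_nhds (V.map (fun i => g i x)) (by
        rw [le_principal_iff]
        refine Ultrafilter.mem_map.2 (hB.mono fun i hi => ?_)
        simpa using hi.2 x (mem_ball_self hr))
      exact ⟨l, fun _ => hl⟩
    · exact ⟨0, fun h => absurd h hx⟩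
  choose G hG using h1
  have hT : TendstoLocallyUniformlyOn g G V U := by
    rw [Metric.tendstoLocallyUniformlyOn_iff]
    intro e he x hx
    obtain ⟨r, hr, B, hB⟩ := h x hx
    have hBp : 0 ≤ B := by
      obtain ⟨i, hi⟩ := hB.exists
      exact (norm_nonneg _).trans (hi.2 x (mem_ball_self hr))
    set K := (2 * B + 1) / r with hK
    have hKp : 0 < K := by positivity
    obtain ⟨t, ht0, ht⟩ : ∃ t > 0, K * t < e / 3 :=
      ⟨e / (6 * K), by positivity, by field_simp; norm_num⟩
    have hL : ∀ᶠ i in (V : Filter ι), ∀ y ∈ ball x (min r t), dist (g i y) (g i x) ≤ e / 3 := by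
      filter_upwards [hB] with i hi y hy
      have hy1 : y ∈ ball x r := ball_subset_ball (min_le_left _ _) hy
      have hy2 : dist y x < t := lt_of_lt_of_le hy (min_le_right _ _)
      have := Complex.dist_le_div_mul_dist_of_mapsTo_ball (R₂ := 2 * B + 1) hi.1 (by
        intro z hz
        have h1 := hi.2 z hz
        have h2 := hi.2 x (mem_ball_self hr)
        rw [mem_closedBall, dist_eq_norm]
        linarith [norm_sub_le (g i z) (g i x)]) hy1
      calc _ ≤ K * dist y x := this
        _ ≤ K * t := by gcongr
        _ ≤ _ := ht.le
    refine ⟨U ∩ ball x (min r t), inter_mem self_mem_nhdsWithin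
      (mem_nhdsWithin_of_mem_nhds (ball_mem_nhds _ (by positivity))), ?_⟩
    have hx3 := (Metric.tendsto_nhds.1 (hG x hx)) (e / 3) (by positivity)
    filter_upwards [hL, hx3] with i hi hi3 y hy
    have h5 : dist (G y) (G x) ≤ e / 3 := by
      refine le_of_tendsto ((hG y hy.1).dist (hG x hx)) ?_
      filter_upwards [hL] with j hj
      exact hj y hy.2
    have h6 := hi y hy.2
    rw [dist_comm] at hi3
    rw [dist_comm] at h6
    calc dist (G y) (g i y) ≤ dist (G y) (G x) + dist (G x) (g i x) + dist (g i x) (g i y) :=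
          dist_triangle4 _ _ _ _
      _ < e := by linarith
  refine ⟨G, hT, ?_⟩
  intro x hx
  obtain ⟨r, hr, B, hB⟩ := h x hx
  have h1 : IsOpen (U ∩ ball x r) := hU.inter isOpen_ball
  have := (hT.mono (inter_subset_left (t := ball x r))).differentiableOn
    (hB.mono fun i hi => hi.1.mono inter_subset_right) h1
  exact (this.differentiableAt (h1.mem_nhds ⟨hx, mem_ball_self hr⟩)).differentiableWithinAt

theorem tlu_tendsto {ι : Type} {V : Filter ι} {g : ι → ℂ → ℂ} {G : ℂ → ℂ} {U : Set ℂ}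
    (h : TendstoLocallyUniformlyOn g G V U) {x : ℂ} (hx : x ∈ U) :
    Tendsto (fun i => g i x) V (nhds (G x)) := h.tendsto_at hx

/-- Propagation of convergence to `z₀` in a component of the Fatou-type set. -/
theorem basin_prop {f : ℂ → ℂ} {M ε : ℝ} {z₀ : ℂ} (hf : Differentiable ℂ f) (hz : ‖z₀‖ < M)
    {W : Set ℂ} (hW : IsOpen W) (hWc : IsPreconnected W) (hWF : W ⊆ Fs f M ε)
    {ι : Type} (V : Ultrafilter ι) (a : ι → ℕ) {x : ℂ} (hx : x ∈ W)
    (hx1 : ∀ᶠ y in nhds x, Tendsto (fun i => f^[a i] y) V (nhds z₀)) :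
    TendstoLocallyUniformlyOn (fun i => f^[a i]) (fun _ => z₀) V W := by
  set W1 : Set ℂ := {p | ∀ᶠ y in nhds p, Tendsto (fun i => f^[a i] y) V (nhds z₀)} with hW1
  have ho : IsOpen W1 := isOpen_setOfPred_eventually_nhds
  have key : ∀ p ∈ W, ∀ η > 0, (∀ j, Sm M ε (f^[j] '' ball p η)) → ball p η ⊆ W →
      ∀ p' ∈ ball p η, p' ∈ W1 → ball p η ⊆ W1 ∧
      TendstoLocallyUniformlyOn (fun i => f^[a i]) (fun _ => z₀) V (ball p η) := by
    intro p hp η hη hS hbW p' hp' hp1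
    have hB : ∀ᶠ i in (V : Filter ι), ∀ z ∈ ball p η, ‖f^[a i] z‖ ≤ M + ε := by
      have h1 : Tendsto (fun i => f^[a i] p') V (nhds z₀) := hp1.self_of_nhds
      filter_upwards [h1.norm.eventually (gt_mem_nhds hz)] with i hi z hzz
      have := hS (a i) _ ⟨p', hp', rfl⟩ _ ⟨z, hzz, rfl⟩ hi.le
      have h3 := norm_sub_norm_le (f^[a i] z) (f^[a i] p')
      rw [norm_sub_rev] at h3
      linarith
    obtain ⟨G, hG, hGd⟩ := montel_um V (fun i => f^[a i]) (ball p η) isOpen_ball (by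
      intro y hy
      obtain ⟨r, hr, hr2⟩ := Metric.isOpen_iff.1 isOpen_ball y hy
      refine ⟨r, hr, M + ε, ?_⟩
      filter_upwards [hB] with i hi
      exact ⟨(hf.iterate _).differentiableOn, fun z hz => hi z (hr2 hz)⟩)
    have he : EqOn G (fun _ => z₀) (ball p η) := by
      refine ident isOpen_ball (convex_ball _ _).isPreconnected hGd
        (differentiableOn_const _) hp' ?_
      filter_upwards [hp1, isOpen_ball.mem_nhds hp'] with w hw hw2
      exact tendsto_nhds_unique (hG.tendsto_at hw2) hw
    have hG2 := hG.congr_right he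
    refine ⟨?_, hG2⟩
    intro y hy
    filter_upwards [isOpen_ball.mem_nhds hy] with w hw
    exact hG2.tendsto_at hw
  have key2 : ∀ p ∈ W, ∃ η > 0, (∀ j, Sm M ε (f^[j] '' ball p η)) ∧ ball p η ⊆ W := by
    intro p hp
    obtain ⟨η, hη, hS⟩ := hWF hp
    obtain ⟨r, hr, hr2⟩ := Metric.isOpen_iff.1 hW p hp
    refine ⟨min η r, by positivity, fun j => (hS j).mono (image_mono (ball_subset_ball (min_le_left _ _))), 
      (ball_subset_ball (min_le_right _ _)).trans hr2⟩
  have hsub : W ⊆ W1 := by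
    refine hWc.subset_of_closure_inter_subset ho ⟨x, hx, hx1⟩ ?_
    rintro p ⟨hp, hpW⟩
    obtain ⟨η, hη, hS, hb⟩ := key2 p hpW
    obtain ⟨p', hp1, hp2⟩ := Metric.mem_closure_iff.1 hp η hη
    rw [dist_comm] at hp2
    exact (key p hpW η hη hS hb p' hp2 hp1).1 (mem_ball_self hη)
  rw [tendstoLocallyUniformlyOn_iff_forall_tendsto] at *
  intro p hp
  obtain ⟨η, hη, hS, hb⟩ := key2 p hp
  have := (key p hp η hη hS hb p (mem_ball_self hη) (hsub hp)).2
  rw [tendstoLocallyUniformlyOn_iff_forall_tendsto] at this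
  have := this p (mem_ball_self hη)
  rwa [(isOpen_ball).nhdsWithin_eq (mem_ball_self hη), ← hW.nhdsWithin_eq hp] at this

/-- Return times of a rotation are syndetic. -/
theorem syndetic {μ : ℂ} (hμ : ‖μ‖ = 1) {ξ : ℝ} (hξ : 0 < ξ) :
    ∃ L : ℕ, ∀ l : ℕ, ∃ g ≤ L, ‖μ ^ (l + g) - 1‖ < ξ := by
  have hμ0 : μ ≠ 0 := by rintro rfl; simp at hμ
  have hb : TotallyBounded (range fun l : ℕ => (μ⁻¹) ^ l) := by
    refine (isCompact_closedBall (0:ℂ) 1).totallyBounded.subset ?_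
    rintro _ ⟨l, rfl⟩
    simp [hμ]
  obtain ⟨t, htA, htf, ht⟩ := Metric.totallyBounded_iff.1 hb |> fun _ =>
    (Metric.finite_approx_of_totallyBounded hb) ξ hξ
  have : ∀ y ∈ t, ∃ l : ℕ, (μ⁻¹) ^ l = y := fun y hy => htA hy
  choose! j hj using this
  obtain ⟨L, hL⟩ := (htf.image j).bddAbove
  refine ⟨L, fun l => ?_⟩
  have h1 := ht ⟨l + L, rfl⟩
  rw [mem_iUnion₂] at h1
  obtain ⟨y, hy, hy2⟩ := h1
  have hjL : j y ≤ L := hL ⟨y, hy, rfl⟩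
  refine ⟨L - j y, Nat.sub_le _ _, ?_⟩
  rw [mem_ball, dist_eq_norm, ← hj y hy] at hy2
  have e1 : μ ^ (l + (L - j y)) - 1 = -μ ^ (l + L) * ((μ⁻¹) ^ (l + L) - (μ⁻¹) ^ (j y)) := by
    have : l + L = (l + (L - j y)) + j y := by omega
    have e2 : μ ^ (l + L) * (μ⁻¹) ^ (l + L) = 1 := by
      rw [← mul_pow, mul_inv_cancel₀ hμ0, one_pow]
    have e3 : μ ^ (l + L) * (μ⁻¹) ^ (j y) = μ ^ (l + (L - j y)) := by
      rw [this, pow_add _ _ (j y), mul_assoc, ← mul_pow, mul_inv_cancel₀ hμ0, one_pow, mul_one]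
    linear_combination -e3 + e2
  rw [e1, norm_mul, norm_neg, norm_pow, hμ, one_pow, one_mul]
  exact hy2

/-- An injective self-map of a domain cannot have an orbit accumulating at an
indifferent fixed point. -/
theorem no_univ_accum {N : Set ℂ} {b : ℂ → ℂ} {z₀ μ u : ℂ} (hN : IsOpen N) (hNc : IsPreconnected N)
    (hd : DifferentiableOn ℂ b N) (hi : InjOn b N) (hm : MapsTo b N N) (hz : b z₀ = z₀)
    (hb : HasDerivAt b μ z₀) (hμ : ‖μ‖ = 1) (hμ1 : μ ≠ 1) (hu : u ∈ N) (hu0 : u ≠ z₀)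
    (hacc : ∀ τ > 0, ∃ l, b^[l] u ∈ ball z₀ τ) : False := by
  have hdl : ∀ l, DifferentiableOn ℂ (b^[l]) N := by
    intro l
    induction l with
    | zero => exact differentiableOn_id
    | succ l ih => rw [iterate_succ]; exact ih.comp hd hm
  have hil : ∀ l, InjOn (b^[l]) N := fun l => hi.iterate hm l
  have hml : ∀ l, MapsTo (b^[l]) N N := fun l => hm.iterate l
  by_cases hzN : z₀ ∈ N
  · obtain ⟨r, hr, hr2⟩ := Metric.isOpen_iff.1 hN z₀ hzN
    have hd0 : 0 < dist u z₀ := dist_pos.2 hu0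
    set R := min r (dist u z₀) with hR
    have hRp : 0 < R := by positivity
    obtain ⟨l, hl⟩ := hacc (R / 192) (by positivity)
    have hbR : ball z₀ R ⊆ N := (ball_subset_ball (min_le_left _ _)).trans hr2
    have h1 := koebe_quarter hRp ((hdl l).mono hbR) ((hil l).mono hbR)
    rw [(HasDerivAt.iterate _ hb hz l).deriv, norm_pow, hμ, one_pow, one_mul, iterate_fixed hz] at h1
    obtain ⟨w, hw, hw2⟩ := h1 hl
    have : w = u := hil l (hbR hw) hu hw2
    subst this
    have h3 : dist w z₀ < R := hw
    exact absurd (min_le_right r (dist w z₀)) (not_le.2 h3)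
  · obtain ⟨C, hC, hch⟩ := koebe_chain hN hNc hu (hm hu)
    obtain ⟨r0, hr0, hr02⟩ := Metric.isOpen_iff.1 hN u hu
    have hd0 : 0 < dist u z₀ := dist_pos.2 hu0
    set r := min r0 (dist u z₀ / 2) with hr
    have hrp : 0 < r := by positivity
    have hbr : ball u r ⊆ N := (ball_subset_ball (min_le_left _ _)).trans hr02
    have hm1 : 0 < ‖μ - 1‖ := norm_pos_iff.2 (sub_ne_zero.2 hμ1)
    set c0 := ‖μ - 1‖ / (2 * C) with hc0
    have hc0p : 0 < c0 := by positivity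
    set ξ := c0 * r / 192 with hξ
    have hξp : 0 < ξ := by positivity
    -- slope limits
    have hsl : ∀ q : ℕ, ∀ e > 0, ∃ τ > 0, ∀ v ∈ ball z₀ τ, v ≠ z₀ →
        ‖(b^[q] v - z₀) / (v - z₀) - μ ^ q‖ < e := by
      intro q e he
      have h1 := (HasDerivAt.iterate _ hb hz q).tendsto_slope
      have h2 := (Metric.tendsto_nhds.1 h1) e he
      rw [eventually_nhdsWithin_iff, Metric.eventually_nhds_iff] at h2
      obtain ⟨τ, hτ, h2⟩ := h2
      refine ⟨τ, hτ, fun v hv hv0 => ?_⟩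
      have := h2 hv hv0
      rw [slope_def_field, iterate_fixed hz, dist_eq_norm] at this
      exact this
    have hret : ∀ q : ℕ, ‖μ ^ q - 1‖ < ξ → b^[q] u ∈ ball u r := by
      intro q hq
      obtain ⟨τ1, hτ1, h1⟩ := hsl 1 (‖μ - 1‖ / 2) (by positivity)
      obtain ⟨τ2, hτ2, h2⟩ := hsl q (ξ - ‖μ ^ q - 1‖) (by linarith)
      obtain ⟨l, hl⟩ := hacc (min τ1 τ2) (by positivity)
      set v := b^[l] u with hv
      have hvN : v ∈ N := hml l hu
      have hv0 : v ≠ z₀ := fun h => hzN (h ▸ hvN)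
      have hv0' : v - z₀ ≠ 0 := sub_ne_zero.2 hv0
      have h1 := h1 v (ball_subset_ball (min_le_left _ _) hl) hv0
      have h2 := h2 v (ball_subset_ball (min_le_right _ _) hl) hv0
      set φ : ℂ → ℂ := fun w => (b^[l] w - z₀) / (v - z₀) with hφ
      have hφd : DifferentiableOn ℂ φ N := ((hdl l).sub_const _).div_const _
      have hφi : InjOn φ N := by
        intro w hw w' hw' h
        have : b^[l] w - z₀ = b^[l] w' - z₀ := by
          simpa [hφ, div_left_inj' hv0'] using h
        exact hil l hw hw' (sub_left_injective this)
      have hφu : φ u = 1 := div_self hv0'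
      have hφq : ∀ q, φ (b^[q] u) = (b^[q] v - z₀) / (v - z₀) := by
        intro q
        simp only [hφ, hv]
        rw [← iterate_add_apply, ← iterate_add_apply, add_comm]
      have hφ1 := (hch φ hφd hφi).2
      have h3 : ‖μ - 1‖ / 2 ≤ ‖φ (b u) - φ u‖ := by
        have h4 := hφq 1
        rw [iterate_one] at h4
        rw [hφu, h4]
        simp only [iterate_one, pow_one] at h1
        have h5 := norm_sub_le_norm_sub_add_norm_sub μ ((b v - z₀) / (v - z₀)) 1
        rw [norm_sub_rev μ ((b v - z₀) / (v - z₀))] at h5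
        linarith
      have h4 : c0 ≤ ‖deriv φ u‖ := by
        rw [hc0, div_le_iff₀ (by positivity)]
        nlinarith
      have h5 := koebe_quarter hrp (hφd.mono hbr) (hφi.mono hbr)
      rw [hφu] at h5
      have h6 : φ (b^[q] u) ∈ ball (1:ℂ) (‖deriv φ u‖ * r / 192) := by
        rw [mem_ball, dist_eq_norm, hφq]
        have h7 := norm_sub_le_norm_sub_add_norm_sub ((b^[q] v - z₀) / (v - z₀)) (μ ^ q) 1
        have h8 : ξ ≤ ‖deriv φ u‖ * r / 192 := by rw [hξ]; gcongr
        linarith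
      obtain ⟨w, hw, hw2⟩ := h5 h6
      rw [← hφi (hbr hw) (hml q hu) hw2]
      exact hw
    obtain ⟨L, hL⟩ := syndetic hμ hξp
    have hcont : ∃ τ > 0, ∀ v ∈ ball z₀ τ, ∀ g ≤ L, b^[g] v ∈ ball z₀ (dist u z₀ / 2) := by
      have : ∀ᶠ v in nhds z₀, ∀ g ∈ Iic L, b^[g] v ∈ ball z₀ (dist u z₀ / 2) := by
        rw [(finite_Iic L).eventually_all]
        intro g _
        have h1 := (HasDerivAt.iterate _ hb hz g).continuousAt
        refine h1.eventually_mem ?_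
        rw [iterate_fixed hz]
        exact ball_mem_nhds _ (by positivity)
      obtain ⟨τ, hτ, h⟩ := Metric.eventually_nhds_iff.1 this
      exact ⟨τ, hτ, fun v hv g hg => h hv g hg⟩
    obtain ⟨τ, hτ, hcont⟩ := hcont
    obtain ⟨l, hl⟩ := hacc τ hτ
    obtain ⟨g, hg, hg2⟩ := hL l
    have h1 := hcont _ hl g hg
    rw [← iterate_add_apply, add_comm] at h1
    have h2 := hret _ hg2
    have h3 : dist u z₀ ≤ dist u (b^[l+g] u) + dist (b^[l+g] u) z₀ := dist_triangle _ _ _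
    rw [mem_ball] at h1 h2
    rw [dist_comm] at h2
    have h4 : r ≤ dist u z₀ / 2 := min_le_right _ _
    linarith


theorem exists_nbhd_path {W : Set ℂ} (hW : IsOpen W) (hWc : IsPreconnected W) {x y : ℂ}
    (hx : x ∈ W) (hy : y ∈ W) :
    ∃ O K : Set ℂ, IsOpen O ∧ IsPreconnected O ∧ IsCompact K ∧ O ⊆ K ∧ K ⊆ W ∧ x ∈ O ∧ y ∈ O ∧
      K ⊆ closure O := by
  have hc : IsConnected W := ⟨⟨x, hx⟩, hWc⟩
  have hp := hW.isConnected_iff_isPathConnected.1 hc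
  obtain ⟨γ, hγ⟩ := hp.joinedIn x hx y hy
  have hγW : range γ ⊆ W := by rintro _ ⟨t, rfl⟩; exact hγ t
  have hcomp : IsCompact (range γ) := isCompact_range γ.continuous
  obtain ⟨τ, hτ, hτW⟩ := hcomp.exists_cthickening_subset_open hW hγW
  have hτ2 : 0 < τ / 2 := by positivity
  refine ⟨thickening τ (range γ), closure (thickening τ (range γ)), isOpen_thickening, ?_, ?_, subset_closure, ?_, ?_, ?_,
    subset_rfl⟩
  · rw [thickening_eq_biUnion_ball]
    have : (⋃ p ∈ range γ, ball p τ) = ⋃ t, ball (γ t) τ := biUnion_range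
    rw [this]
    have h2 : (⋃ t, ball (γ t) τ) = ⋃ t, (range γ ∪ ball (γ t) τ) := by
      apply subset_antisymm
      · exact iUnion_mono fun t => subset_union_right
      · rintro w hw
        obtain ⟨t, ht⟩ := mem_iUnion.1 hw
        rcases ht with ⟨s, rfl⟩ | ht
        · exact mem_iUnion.2 ⟨s, mem_ball_self hτ⟩
        · exact mem_iUnion.2 ⟨t, ht⟩
    rw [h2]
    refine isPreconnected_iUnion ⟨γ 0, mem_iInter.2 fun t => Or.inl ⟨0, rfl⟩⟩ fun t => ?_
    exact (isPreconnected_range γ.continuous).union (γ t) ⟨t, rfl⟩ (mem_ball_self hτ)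
      (convex_ball _ _).isPreconnected
  · exact hcomp.cthickening.of_isClosed_subset isClosed_closure (closure_thickening_subset_cthickening _ _)
  · exact (closure_thickening_subset_cthickening _ _).trans hτW
  · exact self_subset_thickening hτ _ ⟨0, γ.source⟩
  · exact self_subset_thickening hτ _ ⟨1, γ.target⟩

theorem snail {f : ℂ → ℂ} {M ε : ℝ} {z₀ μ : ℂ} (hf : Differentiable ℂ f) (hop : IsOpenMap f)
    (hzM : ‖z₀‖ < M) (P : ℕ) (h : ℂ → ℂ) (hh : h = f^[P])
    {W : Set ℂ} (hW : IsOpen W) (hWc : IsPreconnected W) (hWF : W ⊆ Fs f M ε)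
    (hWm : MapsTo h W W) {x : ℂ} {η : ℝ} (hη : 0 < η) (hxW : ball x η ⊆ W)
    (hbas : ∀ τ > 0, ∀ N₀ : ℕ, ∃ k ≥ N₀, h^[k] '' ball x η ⊆ ball z₀ τ)
    (hz : h z₀ = z₀) (hder : deriv h z₀ = μ) (hμ : ‖μ‖ = 1) (hμ1 : μ ≠ 1) : False := by
  have hhd : Differentiable ℂ h := hh ▸ hf.iterate P
  have hhc : Continuous h := hhd.continuous
  have hho : IsOpenMap h := by
    rw [hh]; exact isOpenMap_iter hop P
  have hhol : ∀ k, IsOpenMap (h^[k]) := fun k => isOpenMap_iter hho k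
  have hμ0 : μ ≠ 0 := by rintro rfl; simp at hμ
  have hHD : HasDerivAt h μ z₀ := hder ▸ (hhd z₀).hasDerivAt
  have hxx : x ∈ W := hxW (mem_ball_self hη)
  -- small disc
  obtain ⟨r1, hr1, -, hi1⟩ := exists_injOn_ball (hhd.analyticAt z₀) (by rw [hder]; exact hμ0)
  have hHD2 : HasDerivAt (fun z => h z - z) (μ - 1) z₀ := hHD.sub (hasDerivAt_id z₀)
  obtain ⟨r2, hr2, -, hi2⟩ := exists_injOn_ball (f := fun z => h z - z)
    ((hhd.sub differentiable_id).analyticAt z₀) (by rw [hHD2.deriv]; exact sub_ne_zero.2 hμ1)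
  set δ0 := min (min r1 r2) (M - ‖z₀‖) with hδ0
  have hδzpos : 0 < δ0 := lt_min (by positivity) (by linarith)
  have hδzM : δ0 ≤ M - ‖z₀‖ := min_le_right _ _
  have hinj : InjOn h (ball z₀ δ0) := hi1.mono (ball_subset_ball ((min_le_left _ _).trans (min_le_left _ _)))
  have hfix : ∀ ζ ∈ ball z₀ δ0, h ζ = ζ → ζ = z₀ := by
    intro ζ hζ e
    refine hi2 (ball_subset_ball ((min_le_left _ _).trans (min_le_right _ _)) hζ) (mem_ball_self hr2) ?_
    simp [e, hz]
  set δ := δ0 / 2 with hδ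
  have hδp : 0 < δ := by positivity
  have hδδ : closedBall z₀ δ ⊆ ball z₀ δ0 := closedBall_subset_ball (by rw [hδ]; linarith)
  obtain ⟨hVo, b, hbd, hbi, hbder⟩ := exists_inverse (Φ := h) isOpen_ball hhd.differentiableOn hinj
  -- ultrafilter
  have hVex : ∃ V : Ultrafilter ℕ, (V : Filter ℕ) ≤ atTop ∧
      ∀ y ∈ ball x η, Tendsto (fun k => h^[k] y) V (nhds z₀) := by
    choose k hk1 hk2 using fun i : ℕ => hbas (1 / ((i:ℝ) + 1)) (by positivity) i
    refine ⟨(hyperfilter ℕ).map k, ?_, ?_⟩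
    · have : Tendsto k (hyperfilter ℕ : Filter ℕ) atTop :=
        (tendsto_atTop_mono hk1 tendsto_id).mono_left Nat.hyperfilter_le_atTop
      exact this
    · intro y hy
      have : Tendsto (fun i => h^[k i] y) (hyperfilter ℕ : Filter ℕ) (nhds z₀) := by
        refine Tendsto.mono_left ?_ Nat.hyperfilter_le_atTop
        rw [tendsto_iff_dist_tendsto_zero]
        refine squeeze_zero (fun _ => dist_nonneg) (fun i => ?_) tendsto_one_div_add_atTop_nhds_zero_nat
        exact (mem_ball.1 (hk2 i ⟨y, hy, rfl⟩)).le
      rwa [Ultrafilter.coe_map, tendsto_map'_iff]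
  obtain ⟨V, hVat, hVx⟩ := hVex
  have hhk : ∀ k, h^[k] = f^[P * k] := fun k => by rw [hh, iterate_mul]
  have hT : TendstoLocallyUniformlyOn (fun k => h^[k]) (fun _ => z₀) V W := by
    simp only [hhk] at hVx ⊢
    refine basin_prop hf hzM hW hWc hWF V (fun k => P * k) hxx ?_
    filter_upwards [ball_mem_nhds x hη] with y hy using hVx y hy
  obtain ⟨O, K, hO, hOc, hK, hOK, hKW, hxO, hhxO, hKcl⟩ := exists_nbhd_path hW hWc hxx (hWm hxx)
  have hTK : ∀ τ > 0, ∀ᶠ k in (V : Filter ℕ), ∀ p ∈ K, h^[k] p ∈ ball z₀ τ := by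
    have h1 := (tendstoLocallyUniformlyOn_iff_tendstoUniformlyOn_of_compact hK).1 (hT.mono hKW)
    intro τ hτ
    filter_upwards [Metric.tendstoUniformlyOn_iff.1 h1 τ hτ] with k hk p hp
    rw [mem_ball, dist_comm]; exact hk p hp
  have hTp : ∀ p ∈ K, Tendsto (fun k => h^[k] p) V (nhds z₀) := fun p hp => hT.tendsto_at (hKW hp)
  by_cases hA : ∃ k, ∀ l, ∀ p ∈ K, h^[k + l] p ∈ ball z₀ δ
  · obtain ⟨k, hk⟩ := hA
    set N := ⋃ l : ℕ, h^[k + l] '' O with hNdef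
    have hNo : IsOpen N := isOpen_iUnion fun l => hhol _ _ hO
    have hNc : IsPreconnected N := by
      refine IsPreconnected.iUnion_of_chain (fun l => hOc.image _ (hhc.iterate _).continuousOn) ?_
      intro l
      refine ⟨h^[k + l] (h x), ⟨h x, hhxO, rfl⟩, ⟨x, hxO, ?_⟩⟩
      rw [← iterate_succ_apply]; rfl
    have hND : N ⊆ ball z₀ δ := by
      refine iUnion_subset fun l => ?_
      rintro _ ⟨p, hp, rfl⟩
      exact hk l p (hOK hp)
    have hNm : MapsTo h N N := by
      intro w hw
      obtain ⟨l, p, hp, rfl⟩ := mem_iUnion.1 hw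
      refine mem_iUnion.2 ⟨l + 1, p, hp, ?_⟩
      rw [← add_assoc, iterate_succ_apply']
    have hu : ∃ p ∈ O, h^[k] p ≠ z₀ := by
      by_contra! hcon
      have h1 : IsOpen ({z₀} : Set ℂ) := by
        have h2 := hhol k _ hO
        have h3 : h^[k] '' O = {z₀} := by
          apply subset_antisymm
          · rintro _ ⟨p, hp, rfl⟩; exact hcon p hp
          · rintro _ rfl; exact ⟨x, hxO, hcon x hxO⟩
        rwa [h3] at h2
      exact not_isOpen_singleton z₀ h1
    obtain ⟨p, hp, hp0⟩ := hu
    refine no_univ_accum hNo hNc hhd.differentiableOn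
      (hinj.mono (hND.trans (ball_subset_closedBall.trans hδδ))) hNm hz hHD hμ hμ1
      (u := h^[k] p) (mem_iUnion.2 ⟨0, p, hp, rfl⟩) hp0 ?_
    intro τ hτ
    obtain ⟨i, hi1, hi2⟩ := ((hTK τ hτ).and (hVat (eventually_ge_atTop k))).exists
    refine ⟨i - k, ?_⟩
    rw [← iterate_add_apply, Nat.sub_add_cancel hi2]
    exact hi1 p (hOK hp)
  · push Not at hA
    have hA' : ∀ k, ∃ l, ∃ p ∈ K, h^[k + l] p ∉ ball z₀ δ := hA
    classical
    set e : ℕ → ℕ := fun k => Nat.find (hA' k) with he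
    have he1 : ∀ k, ∃ p ∈ K, h^[k + e k] p ∉ ball z₀ δ := fun k => Nat.find_spec (hA' k)
    have he2 : ∀ k l, l < e k → ∀ p ∈ K, h^[k + l] p ∈ ball z₀ δ := by
      intro k l hl p hp
      have := Nat.find_min (hA' k) hl
      push Not at this
      exact this p hp
    have heT : ∀ L : ℕ, ∀ᶠ k in (V : Filter ℕ), L < e k := by
      intro L
      have h1 : ∃ τ > 0, ∀ v ∈ ball z₀ τ, ∀ g ≤ L, h^[g] v ∈ ball z₀ δ := by
        have : ∀ᶠ v in nhds z₀, ∀ g ∈ Iic L, h^[g] v ∈ ball z₀ δ := by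
          rw [(finite_Iic L).eventually_all]
          intro g _
          have h1 := (hhc.iterate g).continuousAt (x := z₀)
          refine h1.eventually_mem ?_
          rw [iterate_fixed hz]
          exact ball_mem_nhds _ hδp
        obtain ⟨τ, hτ, h⟩ := Metric.eventually_nhds_iff.1 this
        exact ⟨τ, hτ, fun v hv g hg => h hv g hg⟩
      obtain ⟨τ, hτ, h1⟩ := h1
      filter_upwards [hTK τ hτ] with k hk
      by_contra hcon
      push Not at hcon
      obtain ⟨p, hp, hp2⟩ := he1 k
      apply hp2
      rw [add_comm, iterate_add_apply]
      exact h1 _ (hk p hp) _ hcon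
    -- the maps g_l
    have hlim : ∀ l : ℕ, ∀ p, ∃ ζ, p ∈ K →
        Tendsto (fun k => h^[k + (e k - 1 - l)] p) V (nhds ζ) ∧ ζ ∈ closedBall z₀ δ := by
      intro l p
      by_cases hp : p ∈ K
      · obtain ⟨ζ, hζ, hζ2⟩ := (isCompact_closedBall z₀ δ).ultrafilter_le_nhds
          (V.map fun k => h^[k + (e k - 1 - l)] p) (by
            rw [le_principal_iff]
            refine Ultrafilter.mem_map.2 ((heT 0).mono fun k hk => ?_)
            exact ball_subset_closedBall (he2 k _ (by omega) p hp))
        exact ⟨ζ, fun _ => ⟨hζ2, hζ⟩⟩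
      · exact ⟨0, fun h => absurd h hp⟩
    choose g hg using hlim
    have hgh : ∀ l, ∀ p ∈ K, h (g (l + 1) p) = g l p := by
      intro l p hp
      refine tendsto_nhds_unique ((hhc.tendsto _).comp (hg (l + 1) p hp).1) ?_
      refine (hg l p hp).1.congr' ?_
      filter_upwards [heT (l + 2)] with k hk
      simp only [comp_apply]
      rw [← iterate_succ_apply' h]
      congr 2
      omega
    have hgb : ∀ l, ∀ p ∈ K, b (g l p) = g (l + 1) p := by
      intro l p hp
      rw [← hgh l p hp]
      exact hbi _ (hδδ (hg (l + 1) p hp).2)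
    have hgl : ∀ l, ∀ p ∈ K, b^[l] (g 0 p) = g l p := by
      intro l p hp
      induction l with
      | zero => rfl
      | succ l ih => rw [iterate_succ_apply', ih, hgb l p hp]
    have hgx : ∀ l, g (l + 1) (h x) = g l x := by
      intro l
      refine tendsto_nhds_unique (hg (l + 1) _ (hOK hhxO)).1 ?_
      refine (hg l x (hOK hxO)).1.congr' ?_
      filter_upwards [heT (l + 2)] with k hk
      rw [← iterate_succ_apply h]
      congr 2
      omega
    -- Montel
    have hMon : ∃ U : Set ℂ, IsOpen U ∧ K ⊆ U ∧ ∃ G, TendstoLocallyUniformlyOn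
        (fun k => h^[k + (e k - 1)]) G V U ∧ DifferentiableOn ℂ G U := by
      have h1 : ∀ p, ∃ r, p ∈ K → 0 < r ∧ ∀ j, Sm M ε (f^[j] '' ball p r) := by
        intro p
        by_cases hp : p ∈ K
        · obtain ⟨r, hr, hr2⟩ := hWF (hKW hp)
          exact ⟨r, fun _ => ⟨hr, hr2⟩⟩
        · exact ⟨0, fun h => absurd h hp⟩
      choose r hr using h1
      refine ⟨⋃ p ∈ K, ball p (r p), isOpen_biUnion fun _ _ => isOpen_ball, ?_, ?_⟩
      · intro p hp
        exact mem_biUnion hp (mem_ball_self (hr p hp).1)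
      · refine montel_um V _ _ (isOpen_biUnion fun _ _ => isOpen_ball) ?_
        intro y hy
        obtain ⟨p, hp, hy⟩ := mem_iUnion₂.1 hy
        obtain ⟨s, hs, hs2⟩ := Metric.isOpen_iff.1 isOpen_ball y hy
        refine ⟨s, hs, M + ε, ?_⟩
        filter_upwards [heT 0] with k hk
        refine ⟨(hhd.iterate _).differentiableOn, fun z hz => ?_⟩
        have h1 := he2 k (e k - 1) (by omega) p hp
        rw [mem_ball, dist_eq_norm] at h1
        have h2 := norm_le_norm_add_norm_sub z₀ (h^[k + (e k - 1)] p)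
        have h2' := norm_sub_norm_le (h^[k + (e k - 1)] p) z₀
        have h3 := (hr p hp).2 (P * (k + (e k - 1))) _ ⟨p, mem_ball_self (hr p hp).1, rfl⟩ _
          ⟨z, hs2 hz, rfl⟩ (by rw [← hhk]; linarith)
        rw [← hhk] at h3
        have h4 := norm_sub_norm_le (h^[k + (e k - 1)] z) (h^[k + (e k - 1)] p)
        rw [norm_sub_rev] at h4
        linarith
    obtain ⟨U, hU, hKU, G, hG, hGd⟩ := hMon
    have hGg : ∀ p ∈ K, G p = g 0 p := by
      intro p hp
      refine tendsto_nhds_unique (hG.tendsto_at (hKU hp)) ?_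
      simpa using (hg 0 p hp).1
    have hOU : O ⊆ U := hOK.trans hKU
    -- nonconstant
    have hnc : ¬ ∃ ζ, ∀ p ∈ O, G p = ζ := by
      rintro ⟨ζ, hζ⟩
      have hζK : ∀ p ∈ K, G p = ζ := by
        intro p hp
        have hcl : IsClosed (U ∩ G ⁻¹' {ζ} ∪ Uᶜ) := by
          have : U ∩ G ⁻¹' {ζ} ∪ Uᶜ = (U ∩ G ⁻¹' {ζ}ᶜ)ᶜ := by
            ext w; simp; tauto
          rw [this, isClosed_compl_iff]
          exact hGd.continuousOn.isOpen_inter_preimage hU isOpen_compl_singleton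
        have := hcl.closure_subset_iff.2 (show O ⊆ _ from fun q hq => Or.inl ⟨hOU hq, hζ q hq⟩)
          (hKcl hp)
        rcases this with h | h
        · exact h.2
        · exact absurd (hKU hp) h
      have hζ0 : ζ = z₀ := by
        have h1 : g 0 x = ζ := by rw [← hGg x (hOK hxO), hζ x hxO]
        have h2 : g 0 (h x) = ζ := by rw [← hGg _ (hOK hhxO), hζ _ hhxO]
        have h3 : h (g 0 x) = g 0 (h x) := by
          refine tendsto_nhds_unique ((hhc.tendsto _).comp (hg 0 x (hOK hxO)).1) ?_
          refine (hg 0 _ (hOK hhxO)).1.congr fun k => ?_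
          simp only [comp_apply]
          rw [← iterate_succ_apply' h, ← iterate_succ_apply h]
        refine hfix ζ ?_ ?_
        · rw [← h1]; exact hδδ (hg 0 x (hOK hxO)).2
        · rw [h1, h2] at h3; exact h3
      have hu := (tendstoLocallyUniformlyOn_iff_tendstoUniformlyOn_of_compact hK).1 (hG.mono hKU)
      obtain ⟨τ, hτ, hτ2⟩ : ∃ τ > 0, ∀ v ∈ ball z₀ τ, h v ∈ ball z₀ δ := by
        have : ∀ᶠ v in nhds z₀, h v ∈ ball z₀ δ := by
          refine (hhc.continuousAt (x := z₀)).eventually_mem ?_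
          rw [hz]; exact ball_mem_nhds _ hδp
        obtain ⟨τ, hτ, h⟩ := Metric.eventually_nhds_iff.1 this
        exact ⟨τ, hτ, fun v hv => h hv⟩
      obtain ⟨k, hk, hk0⟩ := ((Metric.tendstoUniformlyOn_iff.1 hu τ hτ).and (heT 0)).exists
      obtain ⟨p, hp, hp2⟩ := he1 k
      apply hp2
      have := hτ2 (h^[k + (e k - 1)] p) (by
        rw [mem_ball, dist_comm, ← hζ0, ← hζK p hp]; exact hk p hp)
      rw [← iterate_succ_apply' h] at this
      convert this using 3
      omega
    have hGA : AnalyticOnNhd ℂ G O := (hGd.mono hOU).analyticOnNhd hO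
    have hEopen : IsOpen (G '' O) := by
      rcases hGA.is_constant_or_isOpen hOc with ⟨w, hw⟩ | h1
      · exact absurd ⟨w, hw⟩ hnc
      · exact h1 O subset_rfl hO
    have hEg : ∀ l, b^[l] '' (G '' O) = g l '' O := by
      intro l
      rw [image_image]
      refine image_congr fun p hp => ?_
      rw [hGg p (hOK hp), hgl l p (hOK hp)]
    have hgV : ∀ l, g l '' O ⊆ h '' ball z₀ δ0 := by
      rintro l _ ⟨p, hp, rfl⟩
      exact ⟨g (l + 1) p, hδδ (hg (l + 1) p (hOK hp)).2, hgh l p (hOK hp)⟩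
    have hbinj : InjOn b (h '' ball z₀ δ0) := by
      rintro _ ⟨p, hp, rfl⟩ _ ⟨q, hq, rfl⟩ e
      rw [hbi p hp, hbi q hq] at e
      rw [e]
    have hbg : ∀ l, b '' (g l '' O) = g (l + 1) '' O := by
      intro l
      rw [image_image]
      exact image_congr fun p hp => hgb l p (hOK hp)
    have hgo : ∀ l, IsOpen (g l '' O) ∧ IsPreconnected (g l '' O) := by
      intro l
      induction l with
      | zero =>
        have : g 0 '' O = G '' O := image_congr fun p hp => (hGg p (hOK hp)).symm
        rw [this]
        exact ⟨hEopen, hOc.image _ (hGd.continuousOn.mono hOU)⟩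
      | succ l ih =>
        rw [← hbg]
        exact ⟨(exists_inverse ih.1 (hbd.mono (hgV l)) (hbinj.mono (hgV l))).1,
          ih.2.image _ (hbd.continuousOn.mono (hgV l))⟩
    set N := ⋃ l : ℕ, g l '' O with hN
    have hNo : IsOpen N := isOpen_iUnion fun l => (hgo l).1
    have hNc : IsPreconnected N := by
      refine IsPreconnected.iUnion_of_chain (fun l => (hgo l).2) ?_
      intro l
      exact ⟨g l x, ⟨x, hxO, rfl⟩, ⟨h x, hhxO, hgx l⟩⟩
    have hNV : N ⊆ h '' ball z₀ δ0 := iUnion_subset hgV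
    have hNm : MapsTo b N N := by
      intro w hw
      obtain ⟨l, hl⟩ := mem_iUnion.1 hw
      refine mem_iUnion.2 ⟨l + 1, ?_⟩
      change b w ∈ g (l + 1) '' O
      rw [← hbg]; exact ⟨w, hl, rfl⟩
    have hbz : b z₀ = z₀ := by
      have := hbi z₀ (mem_ball_self hδzpos)
      rwa [hz] at this
    have hbz' : HasDerivAt b μ⁻¹ z₀ := by
      have := hbder z₀ (mem_ball_self hδzpos)
      rwa [hz, hder] at this
    obtain ⟨p, hp, hp0⟩ : ∃ p ∈ O, G p ≠ z₀ := by
      by_contra! hcon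
      exact hnc ⟨z₀, hcon⟩
    refine no_univ_accum hNo hNc (hbd.mono hNV) (hbinj.mono hNV) hNm hbz hbz' (by simp [hμ])
      (by simpa using hμ1) (u := G p)
      (mem_iUnion.2 ⟨0, p, hp, (hGg p (hOK hp)).symm⟩) hp0 ?_
    intro τ hτ
    -- equicontinuity
    obtain ⟨s, hs, hs2⟩ := Metric.isOpen_iff.1 hEopen (G p) ⟨p, hp, rfl⟩
    have hbl : ∀ l, DifferentiableOn ℂ (b^[l]) N := by
      intro l
      induction l with
      | zero => exact differentiableOn_id
      | succ l ih => rw [iterate_succ]; exact ih.comp (hbd.mono hNV) hNm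
    have hEN : G '' O ⊆ N := by
      rintro _ ⟨q, hq, rfl⟩
      exact mem_iUnion.2 ⟨0, q, hq, (hGg q (hOK hq)).symm⟩
    have heq : ∀ l, ∀ w ∈ ball (G p) s, dist (b^[l] w) (b^[l] (G p)) ≤ (2 * δ) / s * dist w (G p) := by
      intro l w hw
      refine Complex.dist_le_div_mul_dist_of_mapsTo_ball ((hbl l).mono (hs2.trans hEN)) ?_ hw
      have hin : ∀ w ∈ ball (G p) s, b^[l] w ∈ closedBall z₀ δ := by
        intro w hw
        have : b^[l] w ∈ g l '' O := by rw [← hEg]; exact ⟨w, hs2 hw, rfl⟩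
        obtain ⟨q, hq, hq2⟩ := this
        rw [← hq2]; exact (hg l q (hOK hq)).2
      intro w hw
      have h1 := hin w hw
      have h2 := hin (G p) (mem_ball_self hs)
      rw [mem_closedBall] at *
      linarith [dist_triangle_right (b^[l] w) (b^[l] (G p)) z₀]
    have hGp : Tendsto (fun k => h^[k + (e k - 1)] p) V (nhds (G p)) := hG.tendsto_at (hOU hp)
    obtain ⟨k, hk1, hk2, hk3⟩ := ((hTK (τ/2) (by positivity)).and ((heT 0).and
      ((Metric.tendsto_nhds.1 hGp) (min s (τ / 2 / (2 * δ / s + 1))) (by positivity)))).exists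
    refine ⟨e k - 1, ?_⟩
    have hpull : ∀ j ≤ e k - 1, b^[j] (h^[k + (e k - 1)] p) = h^[k + (e k - 1 - j)] p := by
      intro j hj
      induction j with
      | zero => rfl
      | succ j ih =>
        rw [iterate_succ_apply', ih (by omega)]
        have : k + (e k - 1 - j) = (k + (e k - 1 - (j + 1))) + 1 := by omega
        rw [this, iterate_succ_apply']
        exact hbi _ (hδδ (ball_subset_closedBall (he2 k _ (by omega) p (hOK hp))))
    have h1 := heq (e k - 1) _ (mem_ball.2 (lt_of_lt_of_le hk3 (min_le_left _ _)))
    rw [hpull _ le_rfl, Nat.sub_self, add_zero] at h1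
    have h2 := hk1 p (hOK hp)
    have h3 : dist (h^[k + (e k - 1)] p) (G p) < τ / 2 / (2 * δ / s + 1) :=
      lt_of_lt_of_le hk3 (min_le_right _ _)
    rw [lt_div_iff₀ (by positivity)] at h3
    have h4 : 0 ≤ dist (h^[k + (e k - 1)] p) (G p) := dist_nonneg
    rw [mem_ball] at h2 ⊢
    have h5 := dist_triangle (b^[e k - 1] (G p)) (h^[k] p) z₀
    rw [dist_comm] at h1
    nlinarith


theorem Ctx.claimM {f : ℂ → ℂ} {z₀ lam : ℂ} {ρ M ε : ℝ} (H : Ctx f z₀ ρ M ε) {q : ℕ} (hq : 1 ≤ q)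
    (hper : f^[q] z₀ = z₀) (hmult : deriv (f^[q]) z₀ = lam) (hl : ‖lam‖ = 1)
    (hl1 : ∀ m : ℕ, 1 ≤ m → lam ^ m ≠ 1) :
    ∃ C ρ' : ℝ, 1 ≤ C ∧ 0 < ρ' ∧ ∀ y ∈ ball z₀ ρ', y ≠ z₀ → ∀ n, Gd f M ε n y (dist y z₀ / C) := by
  by_contra hcon
  have hfail : ∀ C ρ' : ℝ, 1 ≤ C → 0 < ρ' →
      ∃ y n, y ∈ ball z₀ ρ' ∧ y ≠ z₀ ∧ ¬ Gd f M ε n y (dist y z₀ / C) := by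
    intro C ρ' hC hρ'
    by_contra hno
    push Not at hno
    exact hcon ⟨C, ρ', hC, hρ', fun y hy hy0 n => hno y n hy hy0⟩
  obtain ⟨W, m, hm, hW, hWc, hWF, hWm, x, η, hη, hxW, hbas⟩ := H.basin hfail hq
  have h1 : HasDerivAt (f^[q]) lam z₀ := hmult ▸ ((H.hf.iterate q) z₀).hasDerivAt
  have h2 : HasDerivAt (f^[q * m]) (lam ^ m) z₀ := by
    rw [iterate_mul]; exact HasDerivAt.iterate _ h1 hper m
  refine snail H.hf (isOpenMap_of_hnc H.hf H.hnc) H.hz (q * m) _ rfl hW hWc hWF hWm hη hxW hbas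
    ?_ h2.deriv (by rw [norm_pow, hl, one_pow]) (hl1 m hm)
  rw [iterate_mul]; exact iterate_fixed hper m

/-- A connected set lying over the domain of a holomorphic section and meeting its image is
contained in the image. -/
theorem subset_section {F G : ℂ → ℂ} {B Z : Set ℂ} (hF : Continuous F) 
    (hG : ContinuousOn G B) (hGo : IsOpen (G '' B)) (hs : ∀ w ∈ B, F (G w) = w)
    (hB : IsOpen B) (hZ : IsPreconnected Z) (hZB : ∀ z ∈ Z, F z ∈ B) {a : ℂ} (ha : a ∈ Z)
    (haG : a ∈ G '' B) : Z ⊆ G '' B := by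
  refine hZ.subset_of_closure_inter_subset hGo ⟨a, ha, haG⟩ ?_
  rintro p ⟨hp, hpZ⟩
  refine ⟨F p, hZB p hpZ, ?_⟩
  obtain ⟨u, hu, hup⟩ := mem_closure_iff_seq_limit.1 hp
  have h1 : Tendsto (fun i => F (u i)) atTop (nhds (F p)) := (hF.tendsto p).comp hup
  have h2 : Tendsto (fun i => G (F (u i))) atTop (nhds (G (F p))) :=
    (hG.continuousAt (hB.mem_nhds (hZB p hpZ))).tendsto.comp h1
  refine tendsto_nhds_unique h2 (hup.congr fun i => ?_)
  obtain ⟨w, hw, hw2⟩ := hu i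
  rw [← hw2, hs w hw]

/-- uniform bound for inverse branches -/
theorem Ctx.branch_bound {f : ℂ → ℂ} {z₀ : ℂ} {ρ M ε : ℝ} (H : Ctx f z₀ ρ M ε) {C ρ' : ℝ}
    (hC : 1 ≤ C) (hρ' : 0 < ρ')
    (hM : ∀ y ∈ ball z₀ ρ', y ≠ z₀ → ∀ n, Gd f M ε n y (dist y z₀ / C)) :
    ∃ C3 : ℝ, 1 ≤ C3 ∧ ∀ (δ : ℝ) (n : ℕ) (G : ℂ → ℂ), 0 < δ → δ ≤ ρ' → 2 * δ ≤ ρ →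
      DifferentiableOn ℂ G (ball z₀ δ) → InjOn G (ball z₀ δ) → G z₀ = z₀ → ‖deriv G z₀‖ = 1 →
      (∀ w ∈ ball z₀ δ, f^[n] (G w) = w) → ∀ y ∈ ball z₀ δ, ‖G y - z₀‖ ≤ C3 * δ := by
  obtain ⟨L, hL⟩ := exists_nat_ge (128 * C)
  obtain ⟨C1, hC1, hch⟩ := H.chain L
  have hK := KC_nonneg (t := 3/4) (by norm_num) (by norm_num)
  set K := KC (3/4) with hKdef
  refine ⟨K + C1 * (2 * K + 1) + 1, by nlinarith, ?_⟩
  intro δ n G hδ hδ1 hδ2 hGd hGi hG0 hG1 hGs y hy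
  have hin : ∀ z, ‖z - z₀‖ ≤ 3/4 * δ → ‖G z - z₀‖ ≤ K * δ := by
    intro z hz
    have := koebe_growth hδ hGd hGi (by norm_num) (by norm_num) hz
    rwa [hG0, hG1, one_mul] at this
  by_cases hy3 : ‖y - z₀‖ ≤ 3/4 * δ
  · have := hin y hy3
    nlinarith [mul_nonneg (mul_nonneg (by linarith : (0:ℝ) ≤ C1) hK) hδ.le, mul_pos (by linarith : (0:ℝ) < C1) hδ]
  push Not at hy3
  have hyδ : ‖y - z₀‖ < δ := by rw [← dist_eq_norm]; exact hy
  have hyp : 0 < ‖y - z₀‖ := by linarith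
  set d : ℂ := (y - z₀) / ‖y - z₀‖ with hd
  have hynz : (‖y - z₀‖ : ℂ) ≠ 0 := by exact_mod_cast hyp.ne'
  have hdn : ‖d‖ = 1 := by
    rw [hd, norm_div, Complex.norm_real, norm_norm, div_self hyp.ne']
  have hdd : d * (starRingEnd ℂ) d = 1 := by
    rw [Complex.mul_conj, Complex.normSq_eq_norm_sq, hdn]; norm_num
  set y1 : ℂ := z₀ + (δ / 2 : ℝ) * d with hy1
  have hy1n : ‖y1 - z₀‖ = δ / 2 := by
    rw [hy1, add_sub_cancel_left, norm_mul, hdn, mul_one, Complex.norm_real, Real.norm_of_nonneg (by positivity)]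
  set O : Set ℂ := ball z₀ δ ∩ {x | δ / 4 < ((x - z₀) * (starRingEnd ℂ) d).re} with hO
  have hOo : IsOpen O := by
    refine isOpen_ball.inter (isOpen_lt continuous_const ?_)
    fun_prop
  have hOc : Convex ℝ O := by
    refine (convex_ball _ _).inter ?_
    intro a ha b hb s t hs ht hst
    simp only [mem_ofPred_eq] at *
    have e : ((s • a + t • b - z₀) * (starRingEnd ℂ) d).re =
        s * ((a - z₀) * (starRingEnd ℂ) d).re + t * ((b - z₀) * (starRingEnd ℂ) d).re := by
      have : s • a + t • b - z₀ = (s:ℂ) * (a - z₀) + (t:ℂ) * (b - z₀) := by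
        have h : (s:ℂ) + t = 1 := by exact_mod_cast hst
        rw [Complex.real_smul, Complex.real_smul]
        linear_combination z₀ * h
      rw [this, add_mul, mul_assoc, mul_assoc, Complex.add_re, Complex.re_ofReal_mul, Complex.re_ofReal_mul]
    rw [e]
    rcases hs.eq_or_lt with rfl | hs'
    · have : t = 1 := by linarith
      subst this; linarith
    · nlinarith
  have hOn : ∀ x ∈ O, δ / 4 < ‖x - z₀‖ ∧ ‖x - z₀‖ < δ := by
    intro x hx
    refine ⟨lt_of_lt_of_le hx.2 ((Complex.re_le_norm _).trans ?_), by rw [← dist_eq_norm]; exact hx.1⟩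
    rw [norm_mul, RCLike.norm_conj, hdn, mul_one]
  have hyO : y ∈ O := by
    refine ⟨hy, ?_⟩
    have : (y - z₀) * (starRingEnd ℂ) d = ((‖y - z₀‖ : ℝ) : ℂ) := by
      have : y - z₀ = ‖y - z₀‖ * d := by rw [hd]; field_simp
      rw [this, mul_assoc, hdd, mul_one, norm_mul, hdn, mul_one, Complex.norm_real, norm_norm]
    rw [mem_ofPred_eq, this, Complex.ofReal_re]; linarith
  have hy1O : y1 ∈ O := by
    refine ⟨by rw [mem_ball, dist_eq_norm, hy1n]; linarith, ?_⟩
    rw [mem_ofPred_eq, hy1, add_sub_cancel_left, mul_assoc, hdd, mul_one, Complex.ofReal_re]; linarith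
  set r := δ / (4 * C) with hr
  have hrp : 0 < r := by positivity
  have hrδ : r ≤ δ / 4 := by
    rw [hr, div_le_div_iff₀ (by positivity) (by norm_num)]; nlinarith
  have hgood : ∀ x ∈ O, Gd f M ε n x r ∧ ball x r ⊆ ball z₀ ρ \ {z₀} := by
    intro x hx
    obtain ⟨h1, h2⟩ := hOn x hx
    constructor
    · refine (hM x (by rw [mem_ball, dist_eq_norm]; linarith) ?_ n).mono le_rfl (ball_subset_ball ?_)
      · rintro rfl; simp at h1; linarith
      · rw [hr, dist_eq_norm, div_le_div_iff₀ (by positivity) (by positivity)]; nlinarith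
    · intro w hw
      rw [mem_ball, dist_eq_norm] at hw
      refine ⟨?_, ?_⟩
      · rw [mem_ball, dist_eq_norm]
        linarith [norm_sub_le_norm_sub_add_norm_sub w x z₀]
      · rintro rfl
        rw [norm_sub_rev] at hw; linarith
  have hy1B : y1 ∈ ball z₀ δ := hy1O.1
  obtain ⟨Φ, Q, hLf, hΦ0⟩ := H.struct hrp (hgood y1 hy1O).2 (hgood y1 hy1O).1 (a := G y1)
    (by rw [hGs y1 hy1B]; exact mem_ball_self hrp)
  have hfΦ : f^[n] (Φ 0) = y1 := by rw [hΦ0, hGs y1 hy1B]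
  have hcont : Continuous (f^[n]) := (H.hf.iterate n).continuous
  have hdim : ‖deriv Φ 0‖ ≤ (2 * K + 1) * δ := by
    have hsub : ball z₀ (3/4 * δ) ⊆ ball z₀ δ := ball_subset_ball (by linarith)
    have hZ := subset_section (Z := Φ '' ball 0 1) (a := Φ 0) hcont (hGd.continuousOn.mono hsub)
      (exists_inverse isOpen_ball (hGd.mono hsub) (hGi.mono hsub)).1 (fun w hw => hGs w (hsub hw))
      isOpen_ball ((convex_ball (0:ℂ) 1).isPreconnected.image _ hLf.d.continuousOn) (by
        rintro _ ⟨ζ, hζ, rfl⟩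
        have := hLf.over hrp hζ
        rw [mem_ball, dist_eq_norm] at this ⊢
        linarith [norm_sub_le_norm_sub_add_norm_sub (f^[n] (Φ ζ)) y1 z₀]) 
      ⟨0, mem_ball_self one_pos, rfl⟩ ⟨y1, by rw [mem_ball, dist_eq_norm, hy1n]; linarith, hΦ0.symm⟩
    have hb : ∀ ζ ∈ ball (0:ℂ) 1, ‖Φ ζ - z₀‖ ≤ K * δ := by
      intro ζ hζ
      obtain ⟨w, hw, hw2⟩ := hZ ⟨ζ, hζ, rfl⟩
      rw [← hw2]
      rw [mem_ball, dist_eq_norm] at hw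
      exact hin w hw.le
    have := Complex.norm_deriv_le_div_of_mapsTo_ball (R₂ := (2 * K + 1) * δ) hLf.d (by
      intro ζ hζ
      rw [mem_closedBall, dist_eq_norm]
      have h1 := hb ζ hζ
      have h2 := hb 0 (mem_ball_self one_pos)
      have h3 := norm_sub_le_norm_sub_add_norm_sub (Φ ζ) z₀ (Φ 0)
      rw [norm_sub_rev z₀] at h3
      nlinarith) one_pos
    simpa using this
  obtain ⟨Z, ⟨hZc, hZ0, hZO, hZ⟩, b, hb, hby⟩ := hch n r O hrp hOo hOc hgood Φ Q (by rw [hfΦ]; exact hLf)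
    (by rw [hfΦ]; exact hy1O) y hyO (by
      rw [hfΦ]
      have h1 : ‖y - y1‖ ≤ 2 * δ := by
        have := norm_sub_le_norm_sub_add_norm_sub y z₀ y1
        rw [norm_sub_rev z₀ y1] at this; linarith
      refine h1.trans ?_
      have e : (128 * C) * (r / 16) = 2 * δ := by rw [hr]; field_simp; norm_num
      calc 2 * δ = (128 * C) * (r / 16) := e.symm
        _ ≤ _ := by gcongr)
  have hZG := subset_section hcont hGd.continuousOn (exists_inverse isOpen_ball hGd hGi).1 hGs isOpen_ball hZc
    (fun z hz => (hZO z hz).1) hZ0 ⟨y1, hy1B, hΦ0.symm⟩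
  obtain ⟨w, hw, hwb⟩ := hZG hb
  have hwy : w = y := by rw [← hGs w hw, hwb, hby]
  rw [hwy] at hwb
  have h1 := (hZ b hb).1
  rw [← hwb, hΦ0] at h1
  have h2 := hin y1 (by rw [hy1n]; linarith)
  have h3 := norm_sub_le_norm_sub_add_norm_sub (G y) (G y1) z₀
  have h4 : C1 * ‖deriv Φ 0‖ ≤ C1 * ((2 * K + 1) * δ) := by gcongr
  nlinarith

/-- bounded inverse iterates imply linearizability -/
theorem linearize {F b : ℂ → ℂ} {z₀ lam : ℂ} (hF : Differentiable ℂ F) (hz : F z₀ = z₀)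
    (hl : ‖lam‖ = 1) (hb0 : b z₀ = z₀) (hbder : HasDerivAt b lam⁻¹ z₀)
    (hbF : ∀ᶠ w in nhds z₀, b (F w) = w) {δ E : ℝ} (hδ : 0 < δ)
    (hd : ∀ k, DifferentiableOn ℂ (b^[k]) (ball z₀ δ))
    (hE : ∀ k, ∀ w ∈ ball z₀ δ, ‖b^[k] w - z₀‖ ≤ E) : LinearizableAt F z₀ lam := by
  have hl0 : lam ≠ 0 := by rintro rfl; simp at hl
  have hE0 : 0 ≤ E := (norm_nonneg _).trans (hE 0 z₀ (mem_ball_self hδ))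
  set A : ℕ → ℂ → ℂ := fun K w => ((K:ℂ) + 1)⁻¹ * ∑ k ∈ Finset.range (K + 1), lam ^ k * (b^[k] w - z₀) with hA
  have hK0 : ∀ K : ℕ, (K:ℂ) + 1 ≠ 0 := fun K => by exact_mod_cast (Nat.succ_ne_zero K)
  have hKn : ∀ K : ℕ, ‖((K:ℂ) + 1)⁻¹‖ = 1 / ((K:ℝ) + 1) := by
    intro K
    have : (K:ℂ) + 1 = ((K + 1 : ℝ) : ℂ) := by push_cast; rfl
    rw [norm_inv, this, Complex.norm_real, Real.norm_of_nonneg (by positivity), one_div]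
  have hAd : ∀ K, DifferentiableOn ℂ (A K) (ball z₀ δ) := by
    intro K
    refine DifferentiableOn.const_mul ?_ _
    refine DifferentiableOn.fun_sum fun k _ => ?_
    exact ((hd k).sub_const _).const_mul _
  have hAb : ∀ K, ∀ w ∈ ball z₀ δ, ‖A K w‖ ≤ E := by
    intro K w hw
    simp only [hA]
    rw [norm_mul, hKn]
    have : ‖∑ k ∈ Finset.range (K + 1), lam ^ k * (b^[k] w - z₀)‖ ≤ (K + 1 : ℝ) * E := by
      refine (norm_sum_le_of_le _ (n := fun _ => E) fun k _ => ?_).trans (by simp)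
      rw [norm_mul, norm_pow, hl, one_pow, one_mul]; exact hE k w hw
    rw [one_div, inv_mul_le_iff₀ (by positivity)]
    exact this
  set V := hyperfilter ℕ
  obtain ⟨H, hH, hHd⟩ := montel_um V A (ball z₀ δ) isOpen_ball (by
    intro x hx
    obtain ⟨r, hr, hr2⟩ := Metric.isOpen_iff.1 isOpen_ball x hx
    exact ⟨r, hr, E, Eventually.of_forall fun K => ⟨(hAd K).mono hr2, fun z hz => hAb K z (hr2 hz)⟩⟩)
  have hz0 : z₀ ∈ ball z₀ δ := mem_ball_self hδ
  have hHz : H z₀ = 0 := by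
    refine tendsto_nhds_unique (hH.tendsto_at hz0) ?_
    have : ∀ K, A K z₀ = 0 := by
      intro K
      simp [hA, iterate_fixed hb0]
    simp [this]
  have hH1 : deriv H z₀ = 1 := by
    have h1 := (hH.deriv (Eventually.of_forall hAd) isOpen_ball).tendsto_at hz0
    refine tendsto_nhds_unique h1 ?_
    have : ∀ K, deriv (A K) z₀ = 1 := by
      intro K
      have h2 : HasDerivAt (A K) (((K:ℂ) + 1)⁻¹ * ∑ k ∈ Finset.range (K + 1), lam ^ k * (lam⁻¹) ^ k) z₀ := by
        refine HasDerivAt.const_mul _ (HasDerivAt.fun_sum fun k _ => ?_)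
        exact ((HasDerivAt.iterate _ hbder hb0 k).sub_const _).const_mul _
      rw [h2.deriv]
      have : ∀ k, lam ^ k * (lam⁻¹) ^ k = 1 := fun k => by
        rw [← mul_pow, mul_inv_cancel₀ hl0, one_pow]
      simp only [this, Finset.sum_const, Finset.card_range, nsmul_eq_mul, mul_one]
      push_cast
      exact inv_mul_cancel₀ (hK0 K)
    simp [this]
  -- functional equation
  have hfe : ∀ w ∈ ball z₀ δ, b w ∈ ball z₀ δ → lam * H (b w) = H w := by
    intro w hw hbw
    have h1 : Tendsto (fun K => lam * A K (b w) - A K w) V (nhds (lam * H (b w) - H w)) :=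
      ((hH.tendsto_at hbw).const_mul _).sub (hH.tendsto_at hw)
    have h2 : Tendsto (fun K => lam * A K (b w) - A K w) V (nhds 0) := by
      refine Tendsto.mono_left ?_ Nat.hyperfilter_le_atTop
      have h3 : Tendsto (fun K : ℕ => (2 * E) * (1 / ((K:ℝ) + 1))) atTop (nhds 0) := by
        simpa using tendsto_one_div_add_atTop_nhds_zero_nat.const_mul (2 * E)
      refine squeeze_zero_norm (fun K => ?_) h3
      have e : lam * A K (b w) - A K w =
          ((K:ℂ) + 1)⁻¹ * (lam ^ (K + 1) * (b^[K + 1] w - z₀) - (w - z₀)) := by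
        simp only [hA]
        have h4 := Finset.sum_range_sub (fun k => lam ^ k * (b^[k] w - z₀)) (K + 1)
        simp only [pow_zero, iterate_zero, id_eq, one_mul] at h4
        rw [← h4, Finset.sum_sub_distrib]
        have h5 : ∑ k ∈ Finset.range (K + 1), lam ^ (k + 1) * (b^[k + 1] w - z₀) =
            lam * ∑ k ∈ Finset.range (K + 1), lam ^ k * (b^[k] (b w) - z₀) := by
          rw [Finset.mul_sum]
          refine Finset.sum_congr rfl fun k _ => ?_
          rw [iterate_succ_apply, pow_succ]; ring
        rw [h5]; ring
      rw [e, norm_mul, hKn, mul_comm]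
      gcongr
      refine (norm_sub_le _ _).trans ?_
      rw [norm_mul, norm_pow, hl, one_pow, one_mul]
      linarith [hE (K + 1) w hw, hE 0 w hw, show ‖w - z₀‖ ≤ E from hE 0 w hw]
    exact sub_eq_zero.1 (tendsto_nhds_unique h1 h2)
  obtain ⟨s0, hs0, -, hHi0⟩ := exists_injOn_ball (hHd.analyticAt (isOpen_ball.mem_nhds hz0)) (by rw [hH1]; exact one_ne_zero)
  set s := min s0 δ with hs
  have hsp : 0 < s := by positivity
  have hsδ : ball z₀ s ⊆ ball z₀ δ := ball_subset_ball (min_le_right _ _)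
  have hHi : InjOn H (ball z₀ s) := hHi0.mono (ball_subset_ball (min_le_left _ _))
  obtain ⟨-, h, hhd, hhi, -⟩ := exists_inverse isOpen_ball (hHd.mono hsδ) hHi
  obtain ⟨t0, ht0, ht⟩ : ∃ t > 0, ∀ w ∈ ball z₀ t, b (F w) = w ∧ F w ∈ ball z₀ s := by
    have h1 : ∀ᶠ w in nhds z₀, F w ∈ ball z₀ s := by
      refine hF.continuous.continuousAt.eventually_mem ?_
      rw [hz]; exact ball_mem_nhds _ hsp
    obtain ⟨t, ht, h2⟩ := Metric.eventually_nhds_iff.1 (hbF.and h1)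
    exact ⟨t, ht, fun w hw => h2 hw⟩
  set t := min t0 s with htd
  have htp : 0 < t := by positivity
  have hts : ball z₀ t ⊆ ball z₀ s := ball_subset_ball (min_le_right _ _)
  have hopen := (exists_inverse isOpen_ball (hHd.mono (hts.trans hsδ)) (hHi.mono hts)).1
  obtain ⟨r, hr, hrsub⟩ := Metric.isOpen_iff.1 hopen 0 ⟨z₀, mem_ball_self htp, hHz⟩
  refine ⟨r, hr, h, hhd.mono (hrsub.trans (image_mono hts)), ?_, ?_, ?_⟩
  · intro u hu v hv e
    obtain ⟨p, hp, rfl⟩ := hrsub hu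
    obtain ⟨p', hp', rfl⟩ := hrsub hv
    rw [hhi p (hts hp), hhi p' (hts hp')] at e
    rw [e]
  · rw [← hHz]; exact hhi z₀ (mem_ball_self hsp)
  · intro u hu
    obtain ⟨p, hp, rfl⟩ := hrsub hu
    obtain ⟨h1, h2⟩ := ht p (ball_subset_ball (min_le_left _ _) hp)
    have h3 := hfe (F p) (hsδ h2) (by rw [h1]; exact hsδ (hts hp))
    rw [h1] at h3
    rw [hhi p (hts hp), h3, hhi _ h2]

theorem Ctx.linearizable {f : ℂ → ℂ} {z₀ lam : ℂ} {ρ M ε : ℝ} (H : Ctx f z₀ ρ M ε) {q : ℕ} (hq : 1 ≤ q)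
    (hper : f^[q] z₀ = z₀) (hmult : deriv (f^[q]) z₀ = lam) (hl : ‖lam‖ = 1)
    (hl1 : ∀ m : ℕ, 1 ≤ m → lam ^ m ≠ 1) : LinearizableAt (f^[q]) z₀ lam := by
  obtain ⟨C, ρ', hC, hρ', hM⟩ := H.claimM hq hper hmult hl hl1
  obtain ⟨C3, hC3, hbb⟩ := H.branch_bound hC hρ' hM
  have hl0 : lam ≠ 0 := by rintro rfl; simp at hl
  set F := f^[q] with hFdef
  have hFd : Differentiable ℂ F := H.hf.iterate q
  obtain ⟨δ0, hδ0, -, hinj⟩ := exists_injOn_ball (hFd.analyticAt z₀) (by rw [hmult]; exact hl0)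
  obtain ⟨hVo, b, hbd, hbi, hbder⟩ := exists_inverse (Φ := F) isOpen_ball hFd.differentiableOn hinj
  have hb0 : b z₀ = z₀ := by
    have := hbi z₀ (mem_ball_self hδ0)
    rwa [hper] at this
  have hbz' : HasDerivAt b lam⁻¹ z₀ := by
    have := hbder z₀ (mem_ball_self hδ0)
    rwa [hper, hmult] at this
  have hbinj : InjOn b (F '' ball z₀ δ0) := by
    rintro _ ⟨p, hp, rfl⟩ _ ⟨q, hq, rfl⟩ e
    rw [hbi p hp, hbi q hq] at e
    rw [e]
  have hFb : ∀ w ∈ F '' ball z₀ δ0, F (b w) = w := by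
    rintro _ ⟨p, hp, rfl⟩; rw [hbi p hp]
  obtain ⟨e1, he1, he1V⟩ := Metric.isOpen_iff.1 hVo z₀ ⟨z₀, mem_ball_self hδ0, hper⟩
  have hC3p : 0 < C3 := by linarith
  have hρ := H.hρ
  set δ := min (min ρ' (ρ / 2)) (e1 / (2 * C3)) with hδ
  have hδp : 0 < δ := by positivity
  have hδ1 : δ ≤ ρ' := (min_le_left _ _).trans (min_le_left _ _)
  have hδ2 : 2 * δ ≤ ρ := by
    have : δ ≤ ρ / 2 := (min_le_left _ _).trans (min_le_right _ _)
    linarith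
  have hδ3 : C3 * δ < e1 := by
    have : δ ≤ e1 / (2 * C3) := min_le_right _ _
    rw [le_div_iff₀ (by positivity)] at this
    nlinarith
  -- induction
  have key : ∀ k, DifferentiableOn ℂ (b^[k]) (ball z₀ δ) ∧ InjOn (b^[k]) (ball z₀ δ) ∧
      (∀ w ∈ ball z₀ δ, F^[k] (b^[k] w) = w) ∧ ∀ w ∈ ball z₀ δ, b^[k] w ∈ ball z₀ e1 := by
    intro k
    have pr : (DifferentiableOn ℂ (b^[k]) (ball z₀ δ) ∧ InjOn (b^[k]) (ball z₀ δ) ∧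
      (∀ w ∈ ball z₀ δ, F^[k] (b^[k] w) = w)) → (∀ w ∈ ball z₀ δ, b^[k] w ∈ ball z₀ e1) := by
      rintro ⟨h1, h2, h3⟩ w hw
      rw [mem_ball, dist_eq_norm]
      refine lt_of_le_of_lt (hbb δ (q * k) (b^[k]) hδp hδ1 hδ2 h1 h2 (iterate_fixed hb0 k) ?_ ?_ w hw) hδ3
      · rw [(HasDerivAt.iterate _ hbz' hb0 k).deriv, norm_pow, norm_inv, hl, inv_one, one_pow]
      · rw [iterate_mul]; exact h3
    suffices h : (DifferentiableOn ℂ (b^[k]) (ball z₀ δ) ∧ InjOn (b^[k]) (ball z₀ δ) ∧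
      (∀ w ∈ ball z₀ δ, F^[k] (b^[k] w) = w)) from ⟨h.1, h.2.1, h.2.2, pr h⟩
    clear pr
    induction k with
    | zero => exact ⟨differentiableOn_id, injOn_id _, fun w _ => rfl⟩
    | succ k ih =>
      have pr : (∀ w ∈ ball z₀ δ, b^[k] w ∈ ball z₀ e1) := by
        obtain ⟨h1, h2, h3⟩ := ih
        intro w hw
        rw [mem_ball, dist_eq_norm]
        refine lt_of_le_of_lt (hbb δ (q * k) (b^[k]) hδp hδ1 hδ2 h1 h2 (iterate_fixed hb0 k) ?_ ?_ w hw) hδ3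
        · rw [(HasDerivAt.iterate _ hbz' hb0 k).deriv, norm_pow, norm_inv, hl, inv_one, one_pow]
        · rw [iterate_mul]; exact h3
      have hm : MapsTo (b^[k]) (ball z₀ δ) (F '' ball z₀ δ0) := fun w hw => he1V (pr w hw)
      rw [iterate_succ']
      refine ⟨hbd.comp ih.1 hm, hbinj.comp ih.2.1 hm, fun w hw => ?_⟩
      rw [iterate_succ_apply, comp_apply, hFb _ (hm hw), ih.2.2 w hw]
  refine linearize hFd hper hl hb0 hbz' ?_ hδp (E := e1) (fun k => (key k).1) ?_
  · filter_upwards [ball_mem_nhds z₀ hδ0] with w hw using hbi w hw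
  · intro k w hw
    have := (key k).2.2.2 w hw
    rw [mem_ball, dist_eq_norm] at this
    exact this.le


theorem recurrent_of_close {f : ℂ → ℂ} {c : ℂ} (hc : deriv f c = 0)
    (h : ∀ e > 0, ∃ k ≥ 1, ‖c - f^[k] c‖ < e) : RecurrentCriticalPoint f c := by
  refine ⟨hc, ?_⟩
  by_cases hp : ∃ k ≥ 1, f^[k] c = c
  · obtain ⟨k, hk, hkc⟩ := hp
    refine ⟨fun i => k * i, fun a b hab => Nat.mul_lt_mul_of_pos_left hab (by omega), ?_⟩
    have : ∀ i, f^[k * i] c = c := fun i => by rw [iterate_mul]; exact iterate_fixed hkc i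
    simp [this]
  · push Not at hp
    have hfr : ∀ i : ℕ, ∃ᶠ k in atTop, ‖c - f^[k] c‖ < 1 / ((i:ℝ) + 1) := by
      intro i
      rw [frequently_atTop]
      intro N
      have h1 : ∀ᶠ e in nhdsWithin (0:ℝ) (Ioi 0), ∀ k ∈ Icc 1 N, e < ‖c - f^[k] c‖ := by
        rw [(finite_Icc 1 N).eventually_all]
        intro k hk
        refine mem_nhdsWithin_of_mem_nhds (gt_mem_nhds (norm_pos_iff.2 (sub_ne_zero.2 ?_)))
        exact (hp k hk.1).symm
      obtain ⟨e, he, he0⟩ := (h1.and self_mem_nhdsWithin).exists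
      obtain ⟨k, hk, hk2⟩ := h (min e (1 / ((i:ℝ) + 1))) (lt_min he0 (by positivity))
      refine ⟨k, ?_, hk2.trans_le (min_le_right _ _)⟩
      by_contra hcon
      have := he k ⟨hk, by omega⟩
      linarith [min_le_left e (1 / ((i:ℝ) + 1))]
    obtain ⟨φ, hφ, hφ2⟩ := extraction_forall_of_frequently hfr
    refine ⟨φ, hφ, ?_⟩
    rw [tendsto_iff_dist_tendsto_zero]
    refine squeeze_zero (fun _ => dist_nonneg) (fun i => ?_) tendsto_one_div_add_atTop_nhds_zero_nat
    rw [dist_comm, dist_eq_norm]; exact (hφ2 i).le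

theorem derived_forward {f : ℂ → ℂ} (hf : Differentiable ℂ f) (hnc : ∀ z, ¬ ∀ᶠ w in nhds z, f w = f z)
    {s z : ℂ} (h : z ∈ orbitDerivedSet f s) : f z ∈ orbitDerivedSet f s := by
  intro U hU
  have h1 : ∀ᶠ w in nhds z, w ≠ z → f w ≠ f z := by
    refine eventually_nhdsWithin_iff (s := {z}ᶜ).1 ?_
    exact ((hf.analyticAt z).eventually_eq_or_eventually_ne analyticAt_const).resolve_left (hnc z)
  have h2 := hf.continuous.continuousAt.preimage_mem_nhds hU
  obtain ⟨k, hk, hk2⟩ := h _ (inter_mem h1 h2)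
  refine ⟨k + 1, ?_, ?_⟩
  · rw [iterate_succ_apply']; exact hk.2
  · rw [iterate_succ_apply']; exact hk.1 hk2

theorem exists_ctx {f : ℂ → ℂ} (hf : Differentiable ℂ f)
    (hnotaff : ∀ a b : ℂ, f ≠ fun z => a * z + b)
    (hcrit : {c : ℂ | deriv f c = 0}.Finite)
    (hasym : {a : ℂ | AsymptoticValue f a}.Finite)
    {n : ℕ} (hn : 1 ≤ n) {z₀ : ℂ} (hper : f^[n] z₀ = z₀)
    (hneg : ¬ ∃ s : ℂ, (AsymptoticValue f s ∨ RecurrentCriticalPoint f s) ∧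
      ∀ k : ℕ, k < n → f^[k] z₀ ∈ orbitDerivedSet f s) : ∃ ρ M ε, Ctx f z₀ ρ M ε := by
  have hnc : ∀ z, ¬ ∀ᶠ w in nhds z, f w = f z := by
    intro z hz
    have := ident isOpen_univ isPreconnected_univ hf.differentiableOn
      (differentiableOn_const (f z)) (mem_univ z) hz
    refine hnotaff 0 (f z) (funext fun w => ?_)
    rw [this (mem_univ w)]; ring
  have hS : ∀ s, (AsymptoticValue f s ∨ RecurrentCriticalPoint f s) → z₀ ∉ orbitDerivedSet f s := by
    intro s hs hz
    refine hneg ⟨s, hs, fun k hk => ?_⟩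
    clear hk
    induction k with
    | zero => exact hz
    | succ k ih => rw [iterate_succ_apply']; exact derived_forward hf hnc ih
  have hmono : ∀ s : ℂ, z₀ ∉ orbitDerivedSet f s →
      ∀ᶠ ρ in nhdsWithin (0:ℝ) (Ioi 0), ∀ k, f^[k] s ∈ ball z₀ ρ → f^[k] s = z₀ := by
    intro s hs
    simp only [orbitDerivedSet, mem_ofPred_eq] at hs
    push Not at hs
    obtain ⟨U, hU, h⟩ := hs
    obtain ⟨r, hr, hrU⟩ := Metric.mem_nhds_iff.1 hU
    refine mem_nhdsWithin_of_mem_nhds (mem_of_superset (gt_mem_nhds hr) fun ρ hρ k hk => ?_)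
    exact h k (hrU (ball_subset_ball (le_of_lt hρ) hk))
  have e1 : ∀ᶠ ρ in nhdsWithin (0:ℝ) (Ioi 0), ∀ s ∈ {a : ℂ | AsymptoticValue f a},
      ∀ k, f^[k] s ∈ ball z₀ ρ → f^[k] s = z₀ :=
    hasym.eventually_all.2 fun s hs => hmono s (hS s (Or.inl hs))
  have e2 : ∀ᶠ ρ in nhdsWithin (0:ℝ) (Ioi 0), ∀ s ∈ {c : ℂ | RecurrentCriticalPoint f c},
      ∀ k, f^[k] s ∈ ball z₀ ρ → f^[k] s = z₀ :=
    (hcrit.subset fun c hc => hc.1).eventually_all.2 fun s hs => hmono s (hS s (Or.inr hs))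
  have e3 : ∀ᶠ ρ in nhdsWithin (0:ℝ) (Ioi 0), ∀ k ∈ Iio n, f^[k] z₀ ∈ ball z₀ ρ → f^[k] z₀ = z₀ := by
    refine (finite_Iio n).eventually_all.2 fun k _ => ?_
    by_cases hk : f^[k] z₀ = z₀
    · exact Eventually.of_forall fun _ _ => hk
    · refine mem_nhdsWithin_of_mem_nhds (mem_of_superset (gt_mem_nhds (dist_pos.2 hk)) fun ρ hρ h => ?_)
      exact absurd (mem_ball.1 h) (not_lt.2 (le_of_lt hρ))
  obtain ⟨ρ, ⟨⟨h1, h2⟩, h3⟩, hρ⟩ := (((e1.and e2).and e3).and self_mem_nhdsWithin).exists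
  have m1 : ∀ᶠ M in atTop, ∀ c ∈ {c : ℂ | deriv f c = 0}, ‖c‖ ≤ M ∧ ‖f c‖ ≤ M :=
    hcrit.eventually_all.2 fun c _ => (eventually_ge_atTop _).and (eventually_ge_atTop _)
  obtain ⟨M, hM, hz⟩ := (m1.and (eventually_gt_atTop ‖z₀‖)).exists
  have k1 : ∀ᶠ ε in nhdsWithin (0:ℝ) (Ioi 0), ∀ c ∈ {c : ℂ | deriv f c = 0},
      ¬ RecurrentCriticalPoint f c → ∀ k ≥ 1, ε ≤ ‖c - f^[k] c‖ := by
    refine hcrit.eventually_all.2 fun c hc => ?_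
    by_cases hr : RecurrentCriticalPoint f c
    · exact Eventually.of_forall fun _ h => absurd hr h
    · have : ∃ e > 0, ∀ k ≥ 1, e ≤ ‖c - f^[k] c‖ := by
        by_contra hcon
        push Not at hcon
        exact hr (recurrent_of_close hc hcon)
      obtain ⟨e, he, h⟩ := this
      refine mem_nhdsWithin_of_mem_nhds (mem_of_superset (gt_mem_nhds he) fun ε hε _ k hk => ?_)
      exact (le_of_lt hε).trans (h k hk)
  have k2 : ∀ᶠ ε in nhdsWithin (0:ℝ) (Ioi 0), ∀ c ∈ {c : ℂ | deriv f c = 0}, ∀ c' ∈ {c : ℂ | deriv f c = 0},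
      f c ≠ f c' → ε ≤ ‖f c - f c'‖ := by
    refine hcrit.eventually_all.2 fun c _ => hcrit.eventually_all.2 fun c' _ => ?_
    by_cases h : f c = f c'
    · exact Eventually.of_forall fun _ h' => absurd h h'
    · refine mem_nhdsWithin_of_mem_nhds (mem_of_superset
        (gt_mem_nhds (norm_pos_iff.2 (sub_ne_zero.2 h))) fun ε hε _ => le_of_lt hε)
  obtain ⟨ε, ⟨hk1, hk2⟩, hε⟩ := ((k1.and k2).and self_mem_nhdsWithin).exists
  refine ⟨ρ, M, ε, ⟨hf, hnc, hcrit, hρ, hε, h1, h2, hM, hz, hk1, fun c c' hc hc' => hk2 c hc c' hc', ?_⟩⟩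
  intro k hk
  have : f^[k] z₀ = f^[k % n] z₀ := by
    conv_lhs => rw [← Nat.mod_add_div k n, iterate_add_apply, iterate_mul, iterate_fixed hper]
  rw [this] at hk ⊢
  exact h3 _ (Nat.mod_lt _ hn) hk


/-- **Generalized Mañé theorem, Cremer case**: for an entire function with finitely many
critical points and finite asymptotic values, every Cremer cycle is contained in the derived
set of the orbit of some finite asymptotic value or recurrent critical point. -/
theorem mane_cremer
    (f : ℂ → ℂ) (hf : Differentiable ℂ f)
    (hnotaff : ∀ a b : ℂ, f ≠ fun z => a * z + b)
    (hcrit : {c : ℂ | deriv f c = 0}.Finite)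
    (hasym : {a : ℂ | AsymptoticValue f a}.Finite)
    (n : ℕ) (hn : 1 ≤ n) (z₀ : ℂ)
    (hper : f^[n] z₀ = z₀) (hexact : ∀ k, 1 ≤ k → k < n → f^[k] z₀ ≠ z₀)
    (α : ℝ) (hα : Irrational α)
    (hmult : deriv (f^[n]) z₀ = Complex.exp (2 * Real.pi * Complex.I * α))
    (hcremer : ¬ LinearizableAt (f^[n]) z₀ (Complex.exp (2 * Real.pi * Complex.I * α))) :
    ∃ s : ℂ, (AsymptoticValue f s ∨ RecurrentCriticalPoint f s) ∧
      ∀ k : ℕ, k < n → f^[k] z₀ ∈ orbitDerivedSet f s := by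
  by_contra hneg
  obtain ⟨ρ, M, ε, H⟩ := exists_ctx hf hnotaff hcrit hasym hn hper hneg
  refine hcremer (H.linearizable hn hper hmult ?_ ?_)
  · have : (2 * Real.pi * Complex.I * α : ℂ) = ((2 * Real.pi * α : ℝ) : ℂ) * Complex.I := by
      push_cast; ring
    rw [this, Complex.norm_exp_ofReal_mul_I]
  · intro m hm h
    rw [← Complex.exp_nat_mul, Complex.exp_eq_one_iff] at h
    obtain ⟨k, hk⟩ := h
    have hpi : (2 * Real.pi * Complex.I : ℂ) ≠ 0 := Complex.two_pi_I_ne_zero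
    have h1 : (m:ℂ) * α = k := by
      refine mul_right_cancel₀ hpi ?_
      linear_combination hk
    have h2 : (m:ℝ) * α = k := by exact_mod_cast h1
    have hm0 : (m:ℝ) ≠ 0 := by exact_mod_cast (by omega : m ≠ 0)
    refine hα ⟨(k:ℚ) / m, ?_⟩
    push_cast
    rw [← h2]; field_simp
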